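/- Let {W_n}_{n∈ℕ} be a sequence of orderons. Then {W_n} is a Cauchy sequence with respect to the cut-shift distance d△ if and only if for every simple ordered graph F the sequence of real numbers t(F, W_n) converges. -/

import Mathlib

open MeasureTheory Real Filter
open scoped ENNReal Classical

noncomputable section

/-- The unit interval `[0,1]` as a subtype of `ℝ`. -/
abbrev UI : Type := Set.Icc (0:ℝ) 1

/-- The unit square `[0,1]²`. -/
abbrev USq : Type := UI × UI

/-- An orderon: a symmetric measurable function `([0,1]²)² → [0,1]`. -/
def IsOrderon (W : USq → USq → ℝ) : Prop :=
  Measurable (Function.uncurry W) ∧ (∀ u v, W u v ∈ Set.Icc (0:ℝ) 1) ∧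
    ∀ u v, W u v = W v u

/-- The (unordered) cut norm: `sup_{S,T} |∫_{S×T} W|` over measurable `S,T ⊆ [0,1]²`. -/
def cutNorm (W : USq → USq → ℝ) : ℝ :=
  sSup {x | ∃ S T : Set USq, MeasurableSet S ∧ MeasurableSet T ∧
    x = |∫ p in S ×ˢ T, W p.1 p.2|}

/-- A measure-preserving bijection of `[0,1]²` with measure-preserving inverse. -/
def IsMPB (f : USq → USq) : Prop :=
  MeasurePreserving f volume volume ∧
  ∃ g : USq → USq, MeasurePreserving g volume volume ∧
    Function.LeftInverse g f ∧ Function.RightInverse g f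

/-- `Shift(f) = sup_{(x,a)} |x - π₁(f(x,a))|`. -/
def shiftOf (f : USq → USq) : ℝ := ⨆ u : USq, |(u.1 : ℝ) - ((f u).1 : ℝ)|

/-- The cut-shift distance `d△(W,U) = inf_f (Shift(f) + ‖W - U^f‖_□)`. -/
def csDist (W U : USq → USq → ℝ) : ℝ :=
  sInf {x | ∃ f : USq → USq, IsMPB f ∧
    x = shiftOf f + cutNorm (fun u v => W u v - U (f u) (f v))}

/-- The (induced) homomorphism density `t(F,W)` of a simple ordered graph `F` on `[k]`
(encoded as a `SimpleGraph (Fin k)`, the vertex order being that of `Fin k`) in `W`. -/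
def homDensity {k : ℕ} (F : SimpleGraph (Fin k)) (W : USq → USq → ℝ) : ℝ :=
  (k.factorial : ℝ) * ∫ v : Fin k → USq,
    ∏ p ∈ Finset.univ.filter (fun p : Fin k × Fin k => p.1 < p.2),
      ((if F.Adj p.1 p.2 then W (v p.1) (v p.2) else 1 - W (v p.1) (v p.2)) *
        (if ((v p.1).1 : ℝ) ≤ ((v p.2).1 : ℝ) then 1 else 0))

namespace Orderon

section Basic

variable {α β : Type*} [MeasurableSpace α] [MeasurableSpace β]

lemma integrable_of_bdd {μ : Measure α} [IsFiniteMeasure μ] {f : α → ℝ} (hf : Measurable f)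
    {C : ℝ} (hb : ∀ x, |f x| ≤ C) : Integrable f μ :=
  Integrable.of_bound hf.aestronglyMeasurable C (Eventually.of_forall hb)

lemma measurable_integral_right {ν : Measure β} [SFinite ν] {f : α → β → ℝ}
    (hf : Measurable (Function.uncurry f)) : Measurable fun x => ∫ y, f x y ∂ν :=
  (hf.stronglyMeasurable.integral_prod_right (ν := ν)).measurable

lemma abs_integral_le_of_bdd {μ : Measure α} [IsProbabilityMeasure μ] {f : α → ℝ} {C : ℝ}
    (hb : ∀ x, |f x| ≤ C) : |∫ x, f x ∂μ| ≤ C := by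
  have := norm_integral_le_of_norm_le_const (μ := μ) (f := f) (C := C) (Eventually.of_forall hb)
  simpa using this

lemma abs_setIntegral_le_of_bdd {μ : Measure α} [IsProbabilityMeasure μ] {f : α → ℝ} {C : ℝ}
    (hC : 0 ≤ C) (hb : ∀ x, |f x| ≤ C) (S : Set α) : |∫ x in S, f x ∂μ| ≤ C := by
  have := norm_integral_le_of_norm_le_const (μ := μ.restrict S) (f := f) (C := C)
    (Eventually.of_forall hb)
  refine this.trans ?_
  have h1 : (μ.restrict S).real Set.univ ≤ 1 := by
    rw [measureReal_restrict_apply_univ]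
    exact measureReal_le_one
  nlinarith

/-- Testing against a function with values in `[-1, 1]` is controlled by testing against a set. -/
lemma exists_set_abs_integral_mul_le {μ : Measure α} [IsProbabilityMeasure μ] {h f : α → ℝ}
    (hh : Measurable h) {C : ℝ} (hb : ∀ x, |h x| ≤ C) (hf : ∀ x, |f x| ≤ 1) :
    ∃ S, MeasurableSet S ∧ |∫ x, h x * f x ∂μ| ≤ 2 * |∫ x in S, h x ∂μ| := by
  have hi : Integrable h μ := integrable_of_bdd hh hb
  have hS : MeasurableSet {x | 0 ≤ h x} := measurableSet_le measurable_const hh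
  have h1 : |∫ x, h x * f x ∂μ| ≤ ∫ x, |h x| ∂μ := by
    refine (abs_integral_le_integral_abs).trans ?_
    refine integral_mono_of_nonneg (Eventually.of_forall fun x => abs_nonneg _) hi.abs
      (Eventually.of_forall fun x => ?_)
    simp only [abs_mul]
    nlinarith [hf x, abs_nonneg (h x)]
  have h2 : ∫ x, |h x| ∂μ = (∫ x in {x | 0 ≤ h x}, h x ∂μ) - ∫ x in {x | 0 ≤ h x}ᶜ, h x ∂μ := by
    rw [← integral_add_compl hS hi.abs, sub_eq_add_neg, ← integral_neg]
    congr 1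
    · exact setIntegral_congr_fun hS fun x hx => abs_of_nonneg hx
    · refine setIntegral_congr_fun hS.compl fun x hx => abs_of_neg ?_
      simpa using hx
  rcases le_total |∫ x in {x | 0 ≤ h x}, h x ∂μ| |∫ x in {x | 0 ≤ h x}ᶜ, h x ∂μ| with h3 | h3
  · refine ⟨_, hS.compl, ?_⟩
    have := abs_sub (∫ x in {x | 0 ≤ h x}, h x ∂μ) (∫ x in {x | 0 ≤ h x}ᶜ, h x ∂μ)
    have h4 := le_abs_self
      ((∫ x in {x | 0 ≤ h x}, h x ∂μ) - ∫ x in {x | 0 ≤ h x}ᶜ, h x ∂μ)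
    linarith
  · refine ⟨_, hS, ?_⟩
    have := abs_sub (∫ x in {x | 0 ≤ h x}, h x ∂μ) (∫ x in {x | 0 ≤ h x}ᶜ, h x ∂μ)
    have h4 := le_abs_self
      ((∫ x in {x | 0 ≤ h x}, h x ∂μ) - ∫ x in {x | 0 ≤ h x}ᶜ, h x ∂μ)
    linarith

lemma sq_integral_mul_le {μ : Measure α} [IsProbabilityMeasure μ] {h f : α → ℝ}
    (hh : Measurable h) {C : ℝ} (hb : ∀ x, |h x| ≤ C) (hf : ∀ x, |f x| ≤ 1) :
    (∫ x, f x * h x ∂μ) ^ 2 ≤ ∫ x, h x ^ 2 ∂μ := by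
  have hi : Integrable h μ := integrable_of_bdd hh hb
  have hi2 : Integrable (fun x => h x ^ 2) μ :=
    integrable_of_bdd (hh.pow_const 2) (C := C ^ 2) fun x => by
      rw [abs_pow]; exact pow_le_pow_left₀ (abs_nonneg _) (hb x) 2
  have h1 : |∫ x, f x * h x ∂μ| ≤ ∫ x, |h x| ∂μ := by
    refine (abs_integral_le_integral_abs).trans ?_
    refine integral_mono_of_nonneg (Eventually.of_forall fun x => abs_nonneg _) hi.abs
      (Eventually.of_forall fun x => ?_)
    simp only [abs_mul]
    nlinarith [hf x, abs_nonneg (h x)]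
  set m := ∫ x, |h x| ∂μ
  have h2 : (0 : ℝ) ≤ ∫ x, (|h x| - m) ^ 2 ∂μ := integral_nonneg fun x => sq_nonneg _
  have h3 : ∫ x, (|h x| - m) ^ 2 ∂μ = (∫ x, h x ^ 2 ∂μ) - m ^ 2 := by
    have : ∀ x, (|h x| - m) ^ 2 = h x ^ 2 - 2 * m * |h x| + m ^ 2 := fun x => by
      rw [sub_sq, sq_abs]; ring
    simp_rw [this]
    have i1 : Integrable (fun x => 2 * m * |h x|) μ := hi.abs.const_mul _
    have i2 : Integrable (fun x => h x ^ 2 - 2 * m * |h x|) μ := hi2.sub i1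
    rw [integral_add i2 (integrable_const _), integral_sub hi2 i1, integral_const_mul]
    simp only [integral_const, probReal_univ, smul_eq_mul]
    ring
  calc (∫ x, f x * h x ∂μ) ^ 2 = |∫ x, f x * h x ∂μ| ^ 2 := (sq_abs _).symm
    _ ≤ m ^ 2 := pow_le_pow_left₀ (abs_nonneg _) h1 2
    _ ≤ _ := by linarith

end Basic

lemma volume_square :
    (volume : Measure (USq × USq)) = (volume : Measure USq).prod (volume : Measure USq) := rfl

/-- Measurable kernels on the unit square with values in `[-1, 1]`. -/
def IsKer (U : USq → USq → ℝ) : Prop :=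
  Measurable (Function.uncurry U) ∧ ∀ x y, |U x y| ≤ 1

lemma isKer_of_isOrderon {W : USq → USq → ℝ} (h : IsOrderon W) : IsKer W :=
  ⟨h.1, fun x y => by rw [abs_of_nonneg (h.2.1 x y).1]; exact (h.2.1 x y).2⟩

lemma IsKer.sub_of_mem {W V : USq → USq → ℝ} (hW : Measurable (Function.uncurry W))
    (hV : Measurable (Function.uncurry V)) (hW' : ∀ x y, W x y ∈ Set.Icc (0 : ℝ) 1)
    (hV' : ∀ x y, V x y ∈ Set.Icc (0 : ℝ) 1) : IsKer fun x y => W x y - V x y :=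
  ⟨hW.sub hV, fun x y => by
    have h1 := hW' x y
    have h2 := hV' x y
    simp only [Set.mem_Icc] at h1 h2
    rw [abs_le]; constructor <;> linarith⟩

lemma cutNorm_le {U : USq → USq → ℝ} {c : ℝ}
    (h : ∀ S T, MeasurableSet S → MeasurableSet T → |∫ p in S ×ˢ T, U p.1 p.2| ≤ c) :
    cutNorm U ≤ c := by
  refine csSup_le ⟨_, ∅, ∅, MeasurableSet.empty, MeasurableSet.empty, rfl⟩ ?_
  rintro x ⟨S, T, hS, hT, rfl⟩
  exact h S T hS hT

lemma IsKer.le_cutNorm {U : USq → USq → ℝ} (hU : IsKer U) {S T : Set USq}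
    (hS : MeasurableSet S) (hT : MeasurableSet T) :
    |∫ p in S ×ˢ T, U p.1 p.2| ≤ cutNorm U := by
  refine le_csSup ⟨1, ?_⟩ ⟨S, T, hS, hT, rfl⟩
  rintro x ⟨S, T, hS, hT, rfl⟩
  rw [volume_square]
  exact abs_setIntegral_le_of_bdd zero_le_one (fun p : USq × USq => hU.2 p.1 p.2) _

lemma cutNorm_nonneg (U : USq → USq → ℝ) : 0 ≤ cutNorm U := by
  refine Real.sSup_nonneg ?_
  rintro x ⟨S, T, hS, hT, rfl⟩
  exact abs_nonneg _

/-- A measurable bilinear test is controlled by a test on a measurable rectangle. -/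
lemma IsKer.exists_rect {U : USq → USq → ℝ} (hU : IsKer U) {f g : USq → ℝ}
    (hgm : Measurable g)
    (hf : ∀ x, |f x| ≤ 1) (hg : ∀ x, |g x| ≤ 1) :
    ∃ S T, MeasurableSet S ∧ MeasurableSet T ∧
      |∫ x, (∫ y, U x y * g y) * f x| ≤ 4 * |∫ p in S ×ˢ T, U p.1 p.2| := by
  have hUm : Measurable fun p : USq × USq => U p.1 p.2 := hU.1
  have hUg : Measurable (Function.uncurry fun x y => U x y * g y) :=
    hUm.mul (hgm.comp measurable_snd)
  have hUgb : ∀ x y, |U x y * g y| ≤ 1 := fun x y => by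
    rw [abs_mul]
    exact mul_le_one₀ (hU.2 x y) (abs_nonneg _) (hg y)
  obtain ⟨S, hS, h1⟩ := exists_set_abs_integral_mul_le (μ := (volume : Measure USq))
    (h := fun x => ∫ y, U x y * g y) (f := f) (C := 1) (measurable_integral_right hUg)
    (fun x => abs_integral_le_of_bdd (hUgb x)) hf
  have h2 : ∫ x in S, ∫ y, U x y * g y = ∫ y, (∫ x in S, U x y) * g y := by
    rw [integral_integral_swap]
    · simp_rw [integral_mul_const]
    · exact integrable_of_bdd hUg (C := 1) fun p => hUgb p.1 p.2
  have hUs : Measurable (Function.uncurry fun y x => U x y) := hUm.comp measurable_swap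
  obtain ⟨T, hT, h3⟩ := exists_set_abs_integral_mul_le (μ := (volume : Measure USq))
    (h := fun y => ∫ x in S, U x y) (f := g) (C := 1) (measurable_integral_right hUs)
    (fun y => abs_setIntegral_le_of_bdd zero_le_one (fun x => hU.2 x y) _) hg
  refine ⟨S, T, hS, hT, h1.trans ?_⟩
  rw [h2]
  have h4 : ∫ y in T, ∫ x in S, U x y = ∫ p in S ×ˢ T, U p.1 p.2 := by
    rw [volume_square, setIntegral_prod (fun p : USq × USq => U p.1 p.2)
      (integrable_of_bdd hUm (C := 1) fun p => hU.2 p.1 p.2).integrableOn]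
    rw [integral_integral_swap]
    exact integrable_of_bdd hUs (C := 1) fun p => hU.2 p.2 p.1
  rw [h4] at h3
  linarith

lemma IsKer.abs_integral_le {U : USq → USq → ℝ} (hU : IsKer U) {f g : USq → ℝ}
    (hgm : Measurable g)
    (hf : ∀ x, |f x| ≤ 1) (hg : ∀ x, |g x| ≤ 1) :
    |∫ x, (∫ y, U x y * g y) * f x| ≤ 4 * cutNorm U := by
  obtain ⟨S, T, hS, hT, h⟩ := hU.exists_rect hgm hf hg
  linarith [hU.le_cutNorm hS hT]

/-- The homomorphism density of the four-cycle in a kernel, in its bipartite form. -/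
def fourCycle (U : USq → USq → ℝ) : ℝ := ∫ x', ∫ x, (∫ y, U x y * U x' y) ^ 2

section FourCycle

variable {U : USq → USq → ℝ}

lemma IsKer.measurable_codeg (hU : IsKer U) :
    Measurable fun q : USq × USq => ∫ y, U q.1 y * U q.2 y := by
  have hUm : Measurable fun p : USq × USq => U p.1 p.2 := hU.1
  refine measurable_integral_right (f := fun (q : USq × USq) y => U q.1 y * U q.2 y) ?_
  exact (hUm.comp ((measurable_fst.comp measurable_fst).prodMk measurable_snd)).mul
    (hUm.comp ((measurable_snd.comp measurable_fst).prodMk measurable_snd))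

lemma IsKer.abs_codeg_le (hU : IsKer U) (x x' : USq) : |∫ y, U x y * U x' y| ≤ 1 :=
  abs_integral_le_of_bdd fun y => by
    rw [abs_mul]
    exact mul_le_one₀ (hU.2 x y) (abs_nonneg _) (hU.2 x' y)

lemma IsKer.measurable_right (hU : IsKer U) (x : USq) : Measurable (U x) :=
  hU.1.comp measurable_prodMk_left

lemma IsKer.exists_rect_of_lt_fourCycle (hU : IsKer U) {ε : ℝ} (h : ε < fourCycle U) :
    ∃ S T, MeasurableSet S ∧ MeasurableSet T ∧ ε ≤ 4 * |∫ p in S ×ˢ T, U p.1 p.2| := by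
  have hUm : Measurable fun p : USq × USq => U p.1 p.2 := hU.1
  have hK := hU.measurable_codeg
  obtain ⟨x', hx'⟩ : ∃ x', ε ≤ ∫ x, (∫ y, U x y * U x' y) ^ 2 := by
    by_contra! hcon
    refine absurd h (not_lt.2 ?_)
    unfold fourCycle
    have h1 : ∫ x' : USq, ∫ x, (∫ y, U x y * U x' y) ^ 2 ≤ ∫ _x' : USq, ε := by
      refine integral_mono (integrable_of_bdd (C := 1) ?_ ?_) (integrable_const _)
        fun x' => (hcon x').le
      · exact measurable_integral_right (f := fun x' x => (∫ y, U x y * U x' y) ^ 2)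
          ((hK.comp measurable_swap).pow_const 2)
      · intro x'
        refine abs_integral_le_of_bdd fun x => ?_
        rw [abs_pow]
        exact pow_le_one₀ (abs_nonneg _) (hU.abs_codeg_le x x')
    simpa using h1
  obtain ⟨S, T, hS, hT, h2⟩ := hU.exists_rect (f := fun x => ∫ y, U x y * U x' y) (g := U x')
    (hU.measurable_right x')
    (fun x => hU.abs_codeg_le x x') (hU.2 x')
  refine ⟨S, T, hS, hT, hx'.trans (le_trans (le_of_eq ?_) ((le_abs_self _).trans h2))⟩
  simp_rw [sq]

/-- The four-cycle density controls the cut norm. -/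
lemma IsKer.pow_four_le_fourCycle (hU : IsKer U) {S T : Set USq}
    (hS : MeasurableSet S) (hT : MeasurableSet T) :
    |∫ p in S ×ˢ T, U p.1 p.2| ^ 4 ≤ fourCycle U := by
  have hUm : Measurable fun p : USq × USq => U p.1 p.2 := hU.1
  have hK := hU.measurable_codeg
  set f : USq → ℝ := S.indicator 1 with hf
  set g : USq → ℝ := T.indicator 1 with hg
  have hfm : Measurable f := measurable_one.indicator hS
  have hgm : Measurable g := measurable_one.indicator hT
  have hfb : ∀ x, |f x| ≤ 1 := fun x => by
    by_cases hx : x ∈ S <;> simp [hf, hx]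
  have hgb : ∀ x, |g x| ≤ 1 := fun x => by
    by_cases hx : x ∈ T <;> simp [hg, hx]
  have hUs : Measurable (Function.uncurry fun y x => U x y) := hUm.comp measurable_swap
  set h : USq → ℝ := fun y => ∫ x, f x * U x y with hh
  have hfU : Measurable (Function.uncurry fun y x => f x * U x y) :=
    (hfm.comp measurable_snd).mul hUs
  have hfUb : ∀ y x, |f x * U x y| ≤ 1 := fun y x => by
    rw [abs_mul]; exact mul_le_one₀ (hfb x) (abs_nonneg _) (hU.2 x y)
  have hhm : Measurable h := measurable_integral_right hfU
  have hhb : ∀ y, |h y| ≤ 1 := fun y => abs_integral_le_of_bdd (hfUb y)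
  have e1 : ∫ p in S ×ˢ T, U p.1 p.2 = ∫ y, g y * h y := by
    rw [volume_square, setIntegral_prod (fun p : USq × USq => U p.1 p.2)
      (integrable_of_bdd hUm (C := 1) fun p => hU.2 p.1 p.2).integrableOn,
      integral_integral_swap, ← integral_indicator hT]
    · congr 1
      ext y
      by_cases hy : y ∈ T
      · simp only [hy, Set.indicator_of_mem, hg, hh, Pi.one_apply, one_mul]
        rw [← integral_indicator hS]
        congr 1
        ext x
        by_cases hx : x ∈ S <;> simp [hx, hf]
      · simp [hy, hg]
    · exact integrable_of_bdd hUm (C := 1) fun p => hU.2 p.1 p.2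
  have s1 : (∫ y, g y * h y) ^ 2 ≤ ∫ y, h y ^ 2 := sq_integral_mul_le hhm hhb hgb
  have mU3 : Measurable fun p : (USq × USq) × USq => U p.1.1 p.2 :=
    hUm.comp ((measurable_fst.comp measurable_fst).prodMk measurable_snd)
  have mU4 : Measurable fun p : (USq × USq) × USq => U p.1.2 p.2 :=
    hUm.comp ((measurable_snd.comp measurable_fst).prodMk measurable_snd)
  have e2 : ∫ y, h y ^ 2 = ∫ x', f x' * ∫ x, f x * ∫ y, U x y * U x' y := by
    have t1 : ∀ y, h y ^ 2 = ∫ q : USq × USq, (f q.1 * U q.1 y) * (f q.2 * U q.2 y) := fun y => by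
      rw [volume_square, integral_prod_mul (fun x => f x * U x y) (fun x => f x * U x y),
        sq]
    simp_rw [t1]
    rw [integral_integral_swap]
    · have t2 : ∀ q : USq × USq, ∫ y, f q.1 * U q.1 y * (f q.2 * U q.2 y) =
          f q.1 * f q.2 * ∫ y, U q.1 y * U q.2 y := fun q => by
        rw [← integral_const_mul]
        congr 1; ext y; ring
      simp_rw [t2]
      rw [volume_square, integral_prod_symm]
      · congr 1; ext x'
        rw [← integral_const_mul]
        congr 1; ext x
        simp only
        ring
      · refine integrable_of_bdd (C := 1)
          (((hfm.comp measurable_fst).mul (hfm.comp measurable_snd)).mul hK) fun q => ?_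
        simp only [abs_mul]
        exact mul_le_one₀ (mul_le_one₀ (hfb _) (abs_nonneg _) (hfb _)) (abs_nonneg _)
          (hU.abs_codeg_le _ _)
    · refine integrable_of_bdd (C := 1) ?_ fun p => ?_
      · exact ((hfm.comp (measurable_fst.comp measurable_snd)).mul
          (mU3.comp measurable_swap)).mul ((hfm.comp (measurable_snd.comp measurable_snd)).mul
          (mU4.comp measurable_swap))
      · simp only [Function.uncurry]
        rw [abs_mul]
        exact mul_le_one₀ (hfUb _ _) (abs_nonneg _) (hfUb _ _)
  have s2 : (∫ x', f x' * ∫ x, f x * ∫ y, U x y * U x' y) ^ 2 ≤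
      ∫ x', (∫ x, f x * ∫ y, U x y * U x' y) ^ 2 := by
    refine sq_integral_mul_le (C := 1) ?_ (fun x' => ?_) hfb
    · exact measurable_integral_right (f := fun x' x => f x * ∫ y, U x y * U x' y)
        ((hfm.comp measurable_snd).mul (hK.comp measurable_swap))
    · refine abs_integral_le_of_bdd fun x => ?_
      rw [abs_mul]; exact mul_le_one₀ (hfb _) (abs_nonneg _) (hU.abs_codeg_le _ _)
  have s3 : ∫ x', (∫ x, f x * ∫ y, U x y * U x' y) ^ 2 ≤ fourCycle U := by
    refine integral_mono (integrable_of_bdd (C := 1) ?_ ?_) (integrable_of_bdd (C := 1) ?_ ?_) ?_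
    · exact (measurable_integral_right (f := fun x' x => f x * ∫ y, U x y * U x' y)
        ((hfm.comp measurable_snd).mul (hK.comp measurable_swap))).pow_const 2
    · intro x'
      rw [abs_pow]
      refine pow_le_one₀ (abs_nonneg _) (abs_integral_le_of_bdd fun x => ?_)
      rw [abs_mul]; exact mul_le_one₀ (hfb _) (abs_nonneg _) (hU.abs_codeg_le _ _)
    · exact measurable_integral_right (f := fun x' x => (∫ y, U x y * U x' y) ^ 2)
          ((hK.comp measurable_swap).pow_const 2)
    · intro x'
      refine abs_integral_le_of_bdd fun x => ?_
      rw [abs_pow]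
      exact pow_le_one₀ (abs_nonneg _) (hU.abs_codeg_le x x')
    · intro x'
      exact sq_integral_mul_le (C := 1) (hK.comp measurable_prodMk_right)
        (fun x => hU.abs_codeg_le x x') hfb
  have h0 : 0 ≤ ∫ y, h y ^ 2 := integral_nonneg fun y => sq_nonneg _
  calc |∫ p in S ×ˢ T, U p.1 p.2| ^ 4 = ((∫ y, g y * h y) ^ 2) ^ 2 := by
        rw [e1, ← sq_abs (∫ y, g y * h y)]; ring
    _ ≤ (∫ y, h y ^ 2) ^ 2 := pow_le_pow_left₀ (sq_nonneg _) s1 2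
    _ ≤ fourCycle U := by rw [e2]; exact s2.trans s3

end FourCycle

/-- `V` is a step function with at most `r` steps, labelled by natural numbers. -/
def IsStep (r : ℕ) (V : USq → USq → ℝ) : Prop :=
  ∃ (P : USq → ℕ) (B : ℕ → ℕ → ℝ), Measurable P ∧ (∀ x, P x < r) ∧
    (∀ a b, B a b ∈ Set.Icc (0 : ℝ) 1) ∧ V = fun x y => B (P x) (P y)

lemma IsStep.measurable {r : ℕ} {V : USq → USq → ℝ} (h : IsStep r V) :
    Measurable (Function.uncurry V) := by
  obtain ⟨P, B, hP, -, -, rfl⟩ := h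
  have hB : Measurable (Function.uncurry B) := measurable_of_countable _
  exact hB.comp ((hP.comp measurable_fst).prodMk (hP.comp measurable_snd))

lemma IsStep.mem {r : ℕ} {V : USq → USq → ℝ} (h : IsStep r V) (x y : USq) :
    V x y ∈ Set.Icc (0 : ℝ) 1 := by
  obtain ⟨P, B, hP, -, hB, rfl⟩ := h
  exact hB _ _

lemma abs_sub_clip_le {w z : ℝ} (hw : w ∈ Set.Icc (0 : ℝ) 1) :
    |w - max 0 (min 1 z)| ≤ |w - z| := by
  obtain ⟨h0, h1⟩ := hw
  rcases le_total 1 z with h | h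
  · rw [min_eq_left h, max_eq_right zero_le_one, abs_le]
    constructor
    · have := neg_abs_le (w - z); linarith
    · exact (sub_nonpos.2 h1).trans (abs_nonneg _)
  · rw [min_eq_right h]
    rcases le_total 0 z with h' | h'
    · rw [max_eq_right h']
    · rw [max_eq_left h', sub_zero, abs_of_nonneg h0]
      have := le_abs_self (w - z); linarith

lemma IsStep.refine {r : ℕ} {V : USq → USq → ℝ} (h : IsStep r V) {S T : Set USq}
    (hS : MeasurableSet S) (hT : MeasurableSet T) (c : ℝ) :
    IsStep (4 * r) fun x y =>
      max 0 (min 1 (V x y + c * (S ×ˢ T).indicator (fun _ => 1) (x, y))) := by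
  obtain ⟨P, B, hP, hr, hB, rfl⟩ := h
  refine ⟨fun x => 4 * P x + (if x ∈ S then 2 else 0) + (if x ∈ T then 1 else 0),
    fun a b => max 0 (min 1 (B (a / 4) (b / 4) +
      c * (if a / 2 % 2 = 1 ∧ b % 2 = 1 then 1 else 0))), ?_, ?_, ?_, ?_⟩
  · exact (((hP.const_mul 4).add (Measurable.ite hS measurable_const measurable_const)).add
      (Measurable.ite hT measurable_const measurable_const))
  · intro x
    have := hr x
    simp only
    split_ifs <;> omega
  · intro a b
    exact ⟨le_max_left _ _, max_le zero_le_one (min_le_left _ _)⟩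
  · ext x y
    have h1 : ∀ z, (4 * P z + (if z ∈ S then 2 else 0) + (if z ∈ T then 1 else 0)) / 4 = P z := by
      intro z
      split_ifs <;> omega
    have h2 : ∀ z, (4 * P z + (if z ∈ S then 2 else 0) + (if z ∈ T then 1 else 0)) / 2 % 2 = 1 ↔
        z ∈ S := by
      intro z
      split_ifs with h h' h' <;> simp only [h, iff_true, iff_false] <;> omega
    have h3 : ∀ z, (4 * P z + (if z ∈ S then 2 else 0) + (if z ∈ T then 1 else 0)) % 2 = 1 ↔
        z ∈ T := by
      intro z
      split_ifs with h h' h' <;> simp only [h', iff_true, iff_false] <;> omega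
    simp only [h1, h2, h3]
    congr 3
    by_cases hx : x ∈ S <;> by_cases hy : y ∈ T <;> simp [hx, hy]

lemma exists_step_energy {W : USq → USq → ℝ} (hW : IsOrderon W) {V : USq → USq → ℝ} {r : ℕ}
    (hV : IsStep r V) {ε : ℝ} (hε : 0 < ε) (h : ε < fourCycle fun x y => W x y - V x y) :
    ∃ V', IsStep (4 * r) V' ∧ ∫ p : USq × USq, (W p.1 p.2 - V' p.1 p.2) ^ 2 ≤
      (∫ p : USq × USq, (W p.1 p.2 - V p.1 p.2) ^ 2) - (ε / 4) ^ 2 := by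
  have hU : IsKer fun x y => W x y - V x y := IsKer.sub_of_mem hW.1 hV.measurable hW.2.1 hV.mem
  obtain ⟨S, T, hS, hT, hST⟩ := hU.exists_rect_of_lt_fourCycle h
  set c := ∫ p in S ×ˢ T, (W p.1 p.2 - V p.1 p.2) with hc
  have hV' := hV.refine hS hT c
  refine ⟨_, hV', ?_⟩
  set χ : USq × USq → ℝ := (S ×ˢ T).indicator fun _ => 1 with hχ
  have hχm : Measurable χ := measurable_const.indicator (hS.prod hT)
  have hχb : ∀ p, |χ p| ≤ 1 := fun p => by
    by_cases hp : p ∈ S ×ˢ T <;> simp only [hχ, hp, Set.indicator_of_mem,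
      Set.indicator_of_notMem, not_false_eq_true] <;> norm_num
  set U : USq × USq → ℝ := fun p => W p.1 p.2 - V p.1 p.2 with hUdef
  have hUm : Measurable U := hU.1
  have hUb : ∀ p, |U p| ≤ 1 := fun p => hU.2 p.1 p.2
  have i1 : Integrable (fun p => U p ^ 2) (volume : Measure (USq × USq)) :=
    integrable_of_bdd (hUm.pow_const 2) (C := 1) fun p => by
      rw [abs_pow]; exact pow_le_one₀ (abs_nonneg _) (hUb p)
  have i2 : Integrable (fun p => U p * χ p) (volume : Measure (USq × USq)) :=
    integrable_of_bdd (hUm.mul hχm) (C := 1) fun p => by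
      rw [abs_mul]; exact mul_le_one₀ (hUb p) (abs_nonneg _) (hχb p)
  have i3 : Integrable χ (volume : Measure (USq × USq)) := integrable_of_bdd hχm hχb
  have e1 : ∫ p, U p * χ p = c := by
    rw [hc, ← integral_indicator (hS.prod hT)]
    congr 1
    ext p
    by_cases hp : p ∈ S ×ˢ T <;> simp [hχ, hp, hUdef]
  have e2 : ∫ p, χ p ≤ 1 := (le_abs_self _).trans (abs_integral_le_of_bdd hχb)
  have e3 : ∫ p, (U p - c * χ p) ^ 2 = (∫ p, U p ^ 2) - 2 * c * c + c ^ 2 * ∫ p, χ p := by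
    have : ∀ p, (U p - c * χ p) ^ 2 = U p ^ 2 - 2 * c * (U p * χ p) + c ^ 2 * χ p := fun p => by
      have : χ p ^ 2 = χ p := by
        by_cases hp : p ∈ S ×ˢ T <;> simp [hχ, hp]
      rw [sub_sq, mul_pow, this]; ring
    simp_rw [this]
    have j1 := i2.const_mul (2 * c)
    have j2 : Integrable (fun p => U p ^ 2 - 2 * c * (U p * χ p))
        (volume : Measure (USq × USq)) := i1.sub j1
    rw [integral_add j2 (i3.const_mul _), integral_sub i1 j1, integral_const_mul,
      integral_const_mul, e1]
  have e4 : (ε / 4) ^ 2 ≤ c ^ 2 := by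
    rw [← sq_abs c]
    exact pow_le_pow_left₀ (by positivity) (by linarith) 2
  calc _ ≤ ∫ p, (U p - c * χ p) ^ 2 := by
        refine integral_mono_of_nonneg (Eventually.of_forall fun p => sq_nonneg _) ?_
          (Eventually.of_forall fun p => ?_)
        · refine integrable_of_bdd ((hUm.sub (hχm.const_mul c)).pow_const 2)
            (C := (1 + |c|) ^ 2) fun p => ?_
          rw [abs_pow]
          refine pow_le_pow_left₀ (abs_nonneg _) ((abs_sub _ _).trans ?_) 2
          rw [abs_mul]
          nlinarith [hUb p, hχb p, abs_nonneg c]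
        · simp only
          rw [← sq_abs, ← sq_abs (U p - c * χ p)]
          refine pow_le_pow_left₀ (abs_nonneg _) ((abs_sub_clip_le (hW.2.1 p.1 p.2)).trans ?_) 2
          refine le_of_eq ?_
          congr 1
          simp only [hUdef, hχ, Prod.mk.eta]
          ring
    _ ≤ _ := by
        rw [e3]
        nlinarith [sq_nonneg c]

/-- A weak regularity lemma: every orderon is close, in the four-cycle norm, to a step function
with a number of steps depending only on the accuracy. -/
lemma exists_step_approx {ε : ℝ} (hε : 0 < ε) :
    ∃ r, ∀ W, IsOrderon W → ∃ V, IsStep r V ∧ fourCycle (fun x y => W x y - V x y) ≤ ε := by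
  obtain ⟨n, hn⟩ := exists_nat_gt (1 / (ε / 4) ^ 2)
  refine ⟨4 ^ n, fun W hW => ?_⟩
  have mono : ∀ {r s V}, r ≤ s → IsStep r V → IsStep s V := by
    rintro r s V hrs ⟨P, B, hP, hr, h⟩
    exact ⟨P, B, hP, fun x => (hr x).trans_le hrs, h⟩
  have key : ∀ m : ℕ, (∃ V, IsStep (4 ^ m) V ∧ fourCycle (fun x y => W x y - V x y) ≤ ε) ∨
      ∃ V, IsStep (4 ^ m) V ∧
        ∫ p : USq × USq, (W p.1 p.2 - V p.1 p.2) ^ 2 ≤ 1 - m * (ε / 4) ^ 2 := by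
    intro m
    induction m with
    | zero =>
      right
      refine ⟨fun _ _ => 0, ⟨fun _ => 0, fun _ _ => 0, measurable_const, by simp, by simp, rfl⟩, ?_⟩
      refine (le_abs_self _).trans ((abs_integral_le_of_bdd (C := 1) fun p => ?_).trans (by simp))
      rw [sub_zero, abs_pow]
      exact pow_le_one₀ (abs_nonneg _) ((isKer_of_isOrderon hW).2 _ _)
    | succ m ih =>
      rcases ih with ⟨V, hV, h⟩ | ⟨V, hV, h⟩
      · exact Or.inl ⟨V, mono (Nat.pow_le_pow_right (by norm_num) (Nat.le_succ m)) hV, h⟩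
      · by_cases hc : fourCycle (fun x y => W x y - V x y) ≤ ε
        · exact Or.inl ⟨V, mono (Nat.pow_le_pow_right (by norm_num) (Nat.le_succ m)) hV, hc⟩
        · obtain ⟨V', hV', h'⟩ := exists_step_energy hW hV hε (not_le.1 hc)
          refine Or.inr ⟨V', by rwa [pow_succ, mul_comm], h'.trans ?_⟩
          push_cast
          linarith
  rcases key n with h | ⟨V, hV, h⟩
  · exact h
  · exfalso
    have h0 : 0 ≤ ∫ p : USq × USq, (W p.1 p.2 - V p.1 p.2) ^ 2 :=
      integral_nonneg fun p => sq_nonneg _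
    rw [div_lt_iff₀ (by positivity)] at hn
    linarith

section EdgeWeight

variable {k : ℕ}

/-- The probability that independent edges with probabilities `w` form the graph `F`. -/
def edgeWeight (F : SimpleGraph (Fin k)) (w : Fin k → Fin k → ℝ) : ℝ :=
  ∏ p ∈ Finset.univ.filter (fun p : Fin k × Fin k => p.1 < p.2),
    if F.Adj p.1 p.2 then w p.1 p.2 else 1 - w p.1 p.2

lemma edgeWeight_nonneg (F : SimpleGraph (Fin k)) {w : Fin k → Fin k → ℝ}
    (hw : ∀ i j, w i j ∈ Set.Icc (0 : ℝ) 1) : 0 ≤ edgeWeight F w := by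
  refine Finset.prod_nonneg fun p _ => ?_
  have := hw p.1 p.2
  simp only [Set.mem_Icc] at this
  split_ifs <;> linarith

/-- Graphs on `Fin k` as functions on increasing pairs. -/
def graphEquiv (k : ℕ) :
    SimpleGraph (Fin k) ≃ ({p : Fin k × Fin k // p.1 < p.2} → Bool) where
  toFun F p := decide (F.Adj p.1.1 p.1.2)
  invFun x := SimpleGraph.fromRel fun a c => ∃ h : a < c, x ⟨(a, c), h⟩ = true
  left_inv F := by
    ext a c
    simp only [SimpleGraph.fromRel_adj, decide_eq_true_eq]
    constructor
    · rintro ⟨-, ⟨-, h⟩ | ⟨-, h⟩⟩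
      · exact h
      · exact h.symm
    · intro h
      refine ⟨h.ne, ?_⟩
      rcases lt_or_gt_of_ne h.ne with hlt | hlt
      · exact Or.inl ⟨hlt, h⟩
      · exact Or.inr ⟨hlt, h.symm⟩
  right_inv x := by
    ext ⟨⟨a, c⟩, h⟩
    have h' : ¬ c < a := not_lt.2 (le_of_lt h)
    have h2 : a ≠ c := ne_of_lt h
    simp only at h
    simp [SimpleGraph.fromRel_adj, h, h', h2]

lemma sum_edgeWeight (w : Fin k → Fin k → ℝ) :
    ∑ F : SimpleGraph (Fin k), edgeWeight F w = 1 := by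
  have h1 : ∀ F : SimpleGraph (Fin k), edgeWeight F w =
      ∏ p : {p : Fin k × Fin k // p.1 < p.2},
        if graphEquiv k F p = true then w p.1.1 p.1.2 else 1 - w p.1.1 p.1.2 := by
    intro F
    unfold edgeWeight
    rw [Finset.prod_subtype (p := fun p : Fin k × Fin k => p.1 < p.2)
      (F := inferInstance) _ (by simp)]
    simp [graphEquiv]
  simp_rw [h1]
  rw [Fintype.sum_equiv (graphEquiv k) _ (fun x : {p : Fin k × Fin k // p.1 < p.2} → Bool =>
    ∏ p, if x p = true then w p.1.1 p.1.2 else 1 - w p.1.1 p.1.2) fun F => rfl]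
  have h2 := Finset.prod_univ_sum
    (fun _ : {p : Fin k × Fin k // p.1 < p.2} => (Finset.univ : Finset Bool))
    (fun p b => if b = true then w p.1.1 p.1.2 else 1 - w p.1.1 p.1.2)
  rw [Fintype.piFinset_univ] at h2
  rw [← h2]
  simp

/-- Toggling the adjacency of `a` and `c`. -/
def toggle (a c : Fin k) (F : SimpleGraph (Fin k)) : SimpleGraph (Fin k) :=
  symmDiff F (SimpleGraph.edge a c)

lemma toggle_involutive (a c : Fin k) : Function.Involutive (toggle a c) :=
  fun F => symmDiff_symmDiff_cancel_right _ F

lemma toggle_comm (a c : Fin k) : toggle a c = toggle c a := by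
  unfold toggle
  rw [SimpleGraph.edge_comm]

lemma toggle_adj_self {a c : Fin k} (h : a ≠ c) (F : SimpleGraph (Fin k)) :
    (toggle a c F).Adj a c ↔ ¬ F.Adj a c := by
  simp [toggle, symmDiff, SimpleGraph.edge_adj, h]

lemma toggle_adj_of_ne {a c x y : Fin k} (F : SimpleGraph (Fin k))
    (h1 : ¬ (x = a ∧ y = c)) (h2 : ¬ (x = c ∧ y = a)) :
    (toggle a c F).Adj x y ↔ F.Adj x y := by
  have h3 : ¬ (SimpleGraph.edge a c).Adj x y := by
    rw [SimpleGraph.edge_adj]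
    tauto
  simp [toggle, symmDiff, h3]

lemma sum_edgeWeight_mul_of_lt (w : Fin k → Fin k → ℝ) {a c : Fin k} (hac : a < c) (b : ℝ)
    (Ψ : SimpleGraph (Fin k) → ℝ) (hΨ : ∀ F, Ψ (toggle a c F) = Ψ F) :
    ∑ F, edgeWeight F w * (((if F.Adj a c then 1 else 0) - b) * Ψ F) =
      (w a c - b) * ∑ F, edgeWeight F w * Ψ F := by
  set R : SimpleGraph (Fin k) → ℝ := fun F =>
    ∏ p ∈ (Finset.univ.filter (fun p : Fin k × Fin k => p.1 < p.2)).erase (a, c),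
      if F.Adj p.1 p.2 then w p.1 p.2 else 1 - w p.1 p.2 with hR
  have hR1 : ∀ F, edgeWeight F w = (if F.Adj a c then w a c else 1 - w a c) * R F := fun F => by
    unfold edgeWeight
    rw [← Finset.mul_prod_erase _ _ (a := (a, c)) (by simpa using hac)]
  have hR2 : ∀ F, R (toggle a c F) = R F := fun F => by
    refine Finset.prod_congr rfl fun p hp => ?_
    simp only [Finset.mem_erase, Finset.mem_filter, Finset.mem_univ, true_and] at hp
    have h1 : ¬ (p.1 = a ∧ p.2 = c) := fun h => hp.1 (Prod.ext h.1 h.2)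
    have h2 : ¬ (p.1 = c ∧ p.2 = a) := fun h => by
      have := hp.2; rw [h.1, h.2] at this; exact lt_asymm this hac
    simp only [toggle_adj_of_ne F h1 h2]
  have key : ∀ G : SimpleGraph (Fin k) → ℝ, ∑ F, (G F + G (toggle a c F)) = 2 * ∑ F, G F := by
    intro G
    rw [Finset.sum_add_distrib, (toggle_involutive a c).bijective.sum_comp G, two_mul]
  have e : ∀ F, edgeWeight F w * (((if F.Adj a c then 1 else 0) - b) * Ψ F) +
      edgeWeight (toggle a c F) w *
        (((if (toggle a c F).Adj a c then 1 else 0) - b) * Ψ (toggle a c F)) =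
      (w a c - b) * (edgeWeight F w * Ψ F + edgeWeight (toggle a c F) w * Ψ (toggle a c F)) := by
    intro F
    rw [hR1, hR1, hR2, hΨ]
    by_cases h : F.Adj a c
    · have h' : ¬ (toggle a c F).Adj a c := by rw [toggle_adj_self hac.ne]; simpa using h
      simp only [h, h', if_true, if_false]
      ring
    · have h' : (toggle a c F).Adj a c := by rw [toggle_adj_self hac.ne]; simpa using h
      simp only [h, h', if_true, if_false]
      ring
  have k1 := key fun F => edgeWeight F w * (((if F.Adj a c then 1 else 0) - b) * Ψ F)
  have k2 := key fun F => edgeWeight F w * Ψ F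
  have k3 := Finset.sum_congr (rfl : (Finset.univ : Finset (SimpleGraph (Fin k))) = _)
    fun F _ => e F
  rw [← Finset.mul_sum] at k3
  rw [k1, k2] at k3
  linarith

lemma sum_edgeWeight_mul {w : Fin k → Fin k → ℝ} (hw : ∀ i j, w i j = w j i) {a c : Fin k}
    (hac : a ≠ c) (b : ℝ) (Ψ : SimpleGraph (Fin k) → ℝ) (hΨ : ∀ F, Ψ (toggle a c F) = Ψ F) :
    ∑ F, edgeWeight F w * (((if F.Adj a c then 1 else 0) - b) * Ψ F) =
      (w a c - b) * ∑ F, edgeWeight F w * Ψ F := by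
  rcases lt_or_gt_of_ne hac with h | h
  · exact sum_edgeWeight_mul_of_lt w h b Ψ hΨ
  · rw [toggle_comm] at hΨ
    rw [hw a c, ← sum_edgeWeight_mul_of_lt w h b Ψ hΨ]
    simp only [SimpleGraph.adj_comm]

/-- The discrepancy between a graph and a matrix. -/
def graphDiff (F : SimpleGraph (Fin k)) (b : Fin k → Fin k → ℝ) (i j : Fin k) : ℝ :=
  (if F.Adj i j then 1 else 0) - b i j

lemma abs_graphDiff_le (F : SimpleGraph (Fin k)) {b : Fin k → Fin k → ℝ}
    (hb : ∀ i j, b i j ∈ Set.Icc (0 : ℝ) 1) (i j : Fin k) : |graphDiff F b i j| ≤ 1 := by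
  have := hb i j
  simp only [Set.mem_Icc] at this
  unfold graphDiff
  rw [abs_le]
  split_ifs <;> constructor <;> linarith

lemma sum_edgeWeight_four {w : Fin k → Fin k → ℝ} (hw : ∀ i j, w i j = w j i)
    (b : Fin k → Fin k → ℝ) {i i' j j' : Fin k} (hii : i ≠ i') (hjj : j ≠ j') (h1 : i ≠ j)
    (h2 : i ≠ j') (h3 : i' ≠ j) (h4 : i' ≠ j') :
    ∑ F, edgeWeight F w * (graphDiff F b i j * (graphDiff F b i' j *
      (graphDiff F b i j' * graphDiff F b i' j'))) =
    (w i j - b i j) * ((w i' j - b i' j) * ((w i j' - b i j') * (w i' j' - b i' j'))) := by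
  have inv : ∀ {a c x y : Fin k}, ¬ (x = a ∧ y = c) → ¬ (x = c ∧ y = a) → ∀ F,
      graphDiff (toggle a c F) b x y = graphDiff F b x y := by
    intro a c x y h h' F
    unfold graphDiff
    simp only [toggle_adj_of_ne F h h']
  have s1 := sum_edgeWeight_mul hw h1 (b i j) (fun F => graphDiff F b i' j *
      (graphDiff F b i j' * graphDiff F b i' j')) fun F => by
    rw [inv, inv, inv] <;> grind
  have s2 := sum_edgeWeight_mul hw h3 (b i' j) (fun F =>
      (graphDiff F b i j' * graphDiff F b i' j')) fun F => by
    rw [inv, inv] <;> grind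
  have s3 := sum_edgeWeight_mul hw h2 (b i j') (fun F => graphDiff F b i' j') fun F => by
    rw [inv] <;> grind
  have s4 := sum_edgeWeight_mul hw h4 (b i' j') (fun F => 1) fun F => rfl
  simp only [mul_one] at s4
  rw [sum_edgeWeight, mul_one] at s4
  unfold graphDiff at *
  rw [s1, s2, s3, s4]

lemma edgeWeight_sq {w : Fin k → Fin k → ℝ} (hw : ∀ i j, w i j = w j i)
    (F : SimpleGraph (Fin k)) : edgeWeight F w ^ 2 =
      ∏ p : Fin k × Fin k, if p.1 = p.2 then 1 else
        if F.Adj p.1 p.2 then w p.1 p.2 else 1 - w p.1 p.2 := by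
  have h1 : edgeWeight F w = ∏ p : Fin k × Fin k, if p.1 < p.2 then
      (if F.Adj p.1 p.2 then w p.1 p.2 else 1 - w p.1 p.2) else 1 := by
    unfold edgeWeight
    rw [Finset.prod_filter]
  have h2 : edgeWeight F w = ∏ p : Fin k × Fin k, if p.2 < p.1 then
      (if F.Adj p.1 p.2 then w p.1 p.2 else 1 - w p.1 p.2) else 1 := by
    rw [h1, ← (Equiv.prodComm (Fin k) (Fin k)).prod_comp]
    refine Finset.prod_congr rfl fun p _ => ?_
    simp only [Equiv.prodComm_apply, Prod.fst_swap, Prod.snd_swap, hw p.2 p.1,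
      SimpleGraph.adj_comm F p.2 p.1]
  rw [sq]
  nth_rewrite 1 [h1]
  rw [h2, ← Finset.prod_mul_distrib]
  refine Finset.prod_congr rfl fun p _ => ?_
  rcases lt_trichotomy p.1 p.2 with h | h | h
  · simp [h, h.ne, not_lt.2 h.le]
  · simp [h]
  · simp [h, h.ne', not_lt.2 h.le]

lemma edgeWeight_comp {w : Fin k → Fin k → ℝ} (hw : ∀ i j, w i j = w j i)
    (hw' : ∀ i j, w i j ∈ Set.Icc (0 : ℝ) 1) (F : SimpleGraph (Fin k))
    (e : Equiv.Perm (Fin k)) :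
    edgeWeight (F.comap e) (fun i j => w (e i) (e j)) = edgeWeight F w := by
  rw [← sq_eq_sq₀ (edgeWeight_nonneg _ fun i j => hw' _ _) (edgeWeight_nonneg _ hw'),
    edgeWeight_sq hw F, edgeWeight_sq fun i j => hw _ _,
    ← (Equiv.prodCongr e e).prod_comp (fun p : Fin k × Fin k => if p.1 = p.2 then (1 : ℝ) else
        if F.Adj p.1 p.2 then w p.1 p.2 else 1 - w p.1 p.2)]
  refine Finset.prod_congr rfl fun p _ => ?_
  simp

/-- The four-cycle density of a matrix. -/
def matFourCycle (D : Fin k → Fin k → ℝ) : ℝ :=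
  (k : ℝ)⁻¹ ^ 4 * ∑ i', ∑ i, (∑ j, D i j * D i' j) ^ 2

lemma matFourCycle_eq (D : Fin k → Fin k → ℝ) : matFourCycle D =
    (k : ℝ)⁻¹ ^ 4 * ∑ i', ∑ i, ∑ j, ∑ j', D i j * (D i' j * (D i j' * D i' j')) := by
  unfold matFourCycle
  congr 1
  refine Finset.sum_congr rfl fun i' _ => Finset.sum_congr rfl fun i _ => ?_
  rw [sq, Finset.sum_mul_sum]
  refine Finset.sum_congr rfl fun j _ => Finset.sum_congr rfl fun j' _ => ?_
  ring

lemma matFourCycle_nonneg (D : Fin k → Fin k → ℝ) : 0 ≤ matFourCycle D :=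
  mul_nonneg (by positivity)
    (Finset.sum_nonneg fun _ _ => Finset.sum_nonneg fun _ _ => sq_nonneg _)

lemma matFourCycle_comp (D : Fin k → Fin k → ℝ) (e : Equiv.Perm (Fin k)) :
    matFourCycle (fun i j => D (e i) (e j)) = matFourCycle D := by
  unfold matFourCycle
  congr 1
  rw [← Equiv.sum_comp e fun i' => ∑ i, (∑ j, D i j * D i' j) ^ 2]
  refine Finset.sum_congr rfl fun i' _ => ?_
  rw [← Equiv.sum_comp e fun i => (∑ j, D i j * D (e i') j) ^ 2]
  refine Finset.sum_congr rfl fun i _ => ?_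
  rw [Equiv.sum_comp e fun j => D (e i) j * D (e i') j]

end EdgeWeight

section Sampling

variable {k : ℕ}

lemma measurePreserving_pair {i j : Fin k} (h : i ≠ j) :
    MeasurePreserving (fun v : Fin k → USq => (v i, v j)) volume volume := by
  have hind := ProbabilityTheory.iIndepFun_pi (μ := fun _ : Fin k => (volume : Measure USq))
    (X := fun _ => id) fun _ => aemeasurable_id
  refine ⟨by fun_prop, ?_⟩
  have h1 := (ProbabilityTheory.indepFun_iff_map_prod_eq_prod_map_map
    (measurable_pi_apply i).aemeasurable (measurable_pi_apply j).aemeasurable).1 (hind.indepFun h)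
  rw [volume_pi, volume_square]
  rw [h1, (measurePreserving_eval (fun _ : Fin k => (volume : Measure USq)) i).map_eq,
    (measurePreserving_eval (fun _ : Fin k => (volume : Measure USq)) j).map_eq]

lemma measurePreserving_quad {a b c d : Fin k} (hab : a ≠ b) (hcd : c ≠ d) (hac : a ≠ c)
    (had : a ≠ d) (hbc : b ≠ c) (hbd : b ≠ d) :
    MeasurePreserving (fun v : Fin k → USq => ((v a, v b), (v c, v d))) volume volume := by
  have hind := ProbabilityTheory.iIndepFun_pi (μ := fun _ : Fin k => (volume : Measure USq))
    (X := fun _ => id) fun _ => aemeasurable_id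
  refine ⟨by fun_prop, ?_⟩
  have h1 := (ProbabilityTheory.indepFun_iff_map_prod_eq_prod_map_map (by fun_prop)
    (by fun_prop)).1 (hind.indepFun_prodMk_prodMk (by fun_prop) a b c d hac had hbc hbd)
  have h2 := (measurePreserving_pair hab).map_eq
  have h3 := (measurePreserving_pair hcd).map_eq
  simp only [id] at h1
  rw [volume_pi] at h2 h3 ⊢
  rw [h1, h2, h3]
  rfl

lemma IsKer.fourCycle_eq {U : USq → USq → ℝ} (hU : IsKer U) : fourCycle U =
    ∫ q : (USq × USq) × (USq × USq),
      U q.1.2 q.2.1 * (U q.1.1 q.2.1 * (U q.1.2 q.2.2 * U q.1.1 q.2.2)) := by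
  have hUm : Measurable fun p : USq × USq => U p.1 p.2 := hU.1
  have m : ∀ {f g : (USq × USq) × (USq × USq) → USq}, Measurable f → Measurable g →
      Measurable fun q => U (f q) (g q) := fun hf hg => hUm.comp (hf.prodMk hg)
  have hvol : (volume : Measure ((USq × USq) × (USq × USq))) =
    (volume : Measure (USq × USq)).prod (volume : Measure (USq × USq)) := rfl
  rw [hvol, integral_prod]
  · rw [volume_square, integral_prod]
    · unfold fourCycle
      congr 1; ext x'; congr 1; ext x
      simp only
      rw [sq, ← integral_prod_mul (fun y => U x y * U x' y) (fun y => U x y * U x' y)]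
      congr 1; ext q
      ring
    · refine integrable_of_bdd (C := 1) (measurable_integral_right (f := fun (p q : USq × USq) =>
        U p.2 q.1 * (U p.1 q.1 * (U p.2 q.2 * U p.1 q.2))) ?_) fun p => ?_
      · simp only [Function.uncurry_def]
        refine (m ?_ ?_).mul ((m ?_ ?_).mul ((m ?_ ?_).mul (m ?_ ?_))) <;> fun_prop
      · refine abs_integral_le_of_bdd (μ := (volume : Measure (USq × USq))) fun q => ?_
        simp only [abs_mul]
        exact mul_le_one₀ (hU.2 _ _) (by positivity) (mul_le_one₀ (hU.2 _ _) (by positivity)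
          (mul_le_one₀ (hU.2 _ _) (by positivity) (hU.2 _ _)))
  · refine integrable_of_bdd (C := 1) ?_ fun q => ?_
    · refine (m ?_ ?_).mul ((m ?_ ?_).mul ((m ?_ ?_).mul (m ?_ ?_))) <;> fun_prop
    · simp only [abs_mul]
      exact mul_le_one₀ (hU.2 _ _) (by positivity) (mul_le_one₀ (hU.2 _ _) (by positivity)
          (mul_le_one₀ (hU.2 _ _) (by positivity) (hU.2 _ _)))

/-- The matrix of values of a kernel on a sample. -/
def pull (W : USq → USq → ℝ) (v : Fin k → USq) (i j : Fin k) : ℝ := W (v i) (v j)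

lemma measurable_pull {W : USq → USq → ℝ} (hW : Measurable (Function.uncurry W)) (i j : Fin k) :
    Measurable fun v : Fin k → USq => pull W v i j := by
  have : Measurable fun v : Fin k → USq => (v i, v j) := by fun_prop
  exact hW.comp this

lemma measurable_edgeWeight {W : USq → USq → ℝ} (hW : Measurable (Function.uncurry W))
    (F : SimpleGraph (Fin k)) : Measurable fun v : Fin k → USq => edgeWeight F (pull W v) := by
  unfold edgeWeight
  refine Finset.measurable_prod _ fun p _ => ?_
  split_ifs
  · exact measurable_pull hW _ _
  · exact (measurable_pull hW _ _).const_sub 1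

lemma edgeWeight_le_one (F : SimpleGraph (Fin k)) {w : Fin k → Fin k → ℝ}
    (hw : ∀ i j, w i j ∈ Set.Icc (0 : ℝ) 1) : edgeWeight F w ≤ 1 := by
  refine Finset.prod_le_one (fun p _ => ?_) fun p _ => ?_ <;>
  · have := hw p.1 p.2
    simp only [Set.mem_Icc] at this
    split_ifs <;> linarith

lemma abs_edgeWeight_le_one (F : SimpleGraph (Fin k)) {w : Fin k → Fin k → ℝ}
    (hw : ∀ i j, w i j ∈ Set.Icc (0 : ℝ) 1) : |edgeWeight F w| ≤ 1 := by
  rw [abs_of_nonneg (edgeWeight_nonneg F hw)]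
  exact edgeWeight_le_one F hw

lemma measurable_graphDiff {V : USq → USq → ℝ} (hV : Measurable (Function.uncurry V))
    (F : SimpleGraph (Fin k)) (i j : Fin k) :
    Measurable fun v : Fin k → USq => graphDiff F (pull V v) i j :=
  (measurable_pull hV i j).const_sub _

lemma abs_mul_four_le {a b c d : ℝ} (ha : |a| ≤ 1) (hb : |b| ≤ 1) (hc : |c| ≤ 1) (hd : |d| ≤ 1) :
    |a * (b * (c * d))| ≤ 1 := by
  simp only [abs_mul]
  exact mul_le_one₀ ha (by positivity) (mul_le_one₀ hb (by positivity)
    (mul_le_one₀ hc (by positivity) hd))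

lemma abs_sum_edgeWeight_mul_le {w : Fin k → Fin k → ℝ} (hw : ∀ i j, w i j ∈ Set.Icc (0 : ℝ) 1)
    {Ψ : SimpleGraph (Fin k) → ℝ} {C : ℝ} (hΨ : ∀ F, |Ψ F| ≤ C) :
    |∑ F, edgeWeight F w * Ψ F| ≤ C := by
  calc |∑ F, edgeWeight F w * Ψ F| ≤ ∑ F, |edgeWeight F w * Ψ F| :=
        Finset.abs_sum_le_sum_abs _ _
    _ ≤ ∑ F, edgeWeight F w * C := Finset.sum_le_sum fun F _ => by
        rw [abs_mul, abs_of_nonneg (edgeWeight_nonneg F hw)]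
        exact mul_le_mul_of_nonneg_left (hΨ F) (edgeWeight_nonneg F hw)
    _ = C := by rw [← Finset.sum_mul, sum_edgeWeight, one_mul]

lemma integral_quad_le {W V : USq → USq → ℝ} (hW : IsOrderon W)
    (hV : Measurable (Function.uncurry V)) (hV' : ∀ x y, V x y ∈ Set.Icc (0 : ℝ) 1)
    (i i' j j' : Fin k) :
    ∫ v : Fin k → USq, ∑ F, edgeWeight F (pull W v) * (graphDiff F (pull V v) i j *
      (graphDiff F (pull V v) i' j * (graphDiff F (pull V v) i j' * graphDiff F (pull V v) i' j')))
    ≤ fourCycle (fun x y => W x y - V x y) + ((if i = i' then 1 else 0) +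
      (if j = j' then 1 else 0) + (if i = j then 1 else 0) + (if i = j' then 1 else 0) +
      (if i' = j then 1 else 0) + (if i' = j' then 1 else 0)) := by
  have hU : IsKer fun x y => W x y - V x y := IsKer.sub_of_mem hW.1 hV hW.2.1 hV'
  have h0 : 0 ≤ fourCycle fun x y => W x y - V x y :=
    integral_nonneg fun _ => integral_nonneg fun _ => sq_nonneg _
  by_cases hd : i ≠ i' ∧ j ≠ j' ∧ i ≠ j ∧ i ≠ j' ∧ i' ≠ j ∧ i' ≠ j'
  · obtain ⟨d1, d2, d3, d4, d5, d6⟩ := hd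
    simp only [d1, d2, d3, d4, d5, d6, if_false, add_zero]
    refine le_of_eq ?_
    simp_rw [fun v : Fin k → USq => sum_edgeWeight_four (w := pull W v)
      (fun a b => hW.2.2 _ _) (pull V v) d1 d2 d3 d4 d5 d6]
    rw [hU.fourCycle_eq,
      ← (measurePreserving_quad (a := i') (b := i) (c := j) (d := j')
        d1.symm d2 d5 d6 d3 d4).map_eq, integral_map (by fun_prop)]
    · rfl
    · refine Measurable.aestronglyMeasurable ?_
      have m : ∀ {f g : (USq × USq) × (USq × USq) → USq}, Measurable f → Measurable g →
        Measurable fun q => W (f q) (g q) - V (f q) (g q) := fun hf hg => hU.1.comp (hf.prodMk hg)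
      refine (m ?_ ?_).mul ((m ?_ ?_).mul ((m ?_ ?_).mul (m ?_ ?_))) <;> fun_prop
  · have h1 : (1 : ℝ) ≤ ((if i = i' then 1 else 0) +
      (if j = j' then 1 else 0) + (if i = j then 1 else 0) + (if i = j' then 1 else 0) +
      (if i' = j then 1 else 0) + (if i' = j' then 1 else 0)) := by
      by_contra hcon
      apply hd
      refine ⟨?_, ?_, ?_, ?_, ?_, ?_⟩ <;> intro h <;> apply hcon <;> rw [if_pos h] <;>
        split_ifs <;> norm_num
    refine ((le_abs_self _).trans (abs_integral_le_of_bdd (C := 1) fun v => ?_)).trans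
      (by linarith)
    refine abs_sum_edgeWeight_mul_le (fun a b => hW.2.1 _ _) fun F => ?_
    have hb := abs_graphDiff_le F (b := pull V v) fun a b => hV' _ _
    exact abs_mul_four_le (hb _ _) (hb _ _) (hb _ _) (hb _ _)

/-- The expected four-cycle discrepancy between a random graph and a kernel on its sample. -/
lemma integral_matFourCycle_le {W V : USq → USq → ℝ} (hW : IsOrderon W)
    (hV : Measurable (Function.uncurry V)) (hV' : ∀ x y, V x y ∈ Set.Icc (0 : ℝ) 1)
    (hk : 0 < k) :
    ∫ v : Fin k → USq, ∑ F, edgeWeight F (pull W v) * matFourCycle (graphDiff F (pull V v))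
      ≤ fourCycle (fun x y => W x y - V x y) + 6 / k := by
  set f := fourCycle fun x y => W x y - V x y
  have hk' : (k : ℝ) ≠ 0 := by positivity
  have e1 : ∀ v : Fin k → USq,
      ∑ F, edgeWeight F (pull W v) * matFourCycle (graphDiff F (pull V v)) =
      (k : ℝ)⁻¹ ^ 4 * ∑ i', ∑ i, ∑ j, ∑ j', ∑ F, edgeWeight F (pull W v) *
      (graphDiff F (pull V v) i j * (graphDiff F (pull V v) i' j *
        (graphDiff F (pull V v) i j' * graphDiff F (pull V v) i' j'))) := by
    intro v
    simp_rw [matFourCycle_eq, Finset.mul_sum]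
    rw [Finset.sum_comm]
    refine Finset.sum_congr rfl fun i' _ => ?_
    rw [Finset.sum_comm]
    refine Finset.sum_congr rfl fun i _ => ?_
    rw [Finset.sum_comm]
    refine Finset.sum_congr rfl fun j _ => ?_
    rw [Finset.sum_comm]
    refine Finset.sum_congr rfl fun j' _ => ?_
    refine Finset.sum_congr rfl fun F _ => ?_
    ring
  simp_rw [e1]
  have int : ∀ i' i j j', Integrable (fun v : Fin k → USq => ∑ F, edgeWeight F (pull W v) *
      (graphDiff F (pull V v) i j * (graphDiff F (pull V v) i' j *
        (graphDiff F (pull V v) i j' * graphDiff F (pull V v) i' j')))) volume := by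
    intro i' i j j'
    refine integrable_of_bdd (C := 1) ?_ fun v => ?_
    · refine Finset.measurable_sum _ fun F _ => (measurable_edgeWeight hW.1 F).mul ?_
      exact (measurable_graphDiff hV F _ _).mul ((measurable_graphDiff hV F _ _).mul
        ((measurable_graphDiff hV F _ _).mul (measurable_graphDiff hV F _ _)))
    · refine abs_sum_edgeWeight_mul_le (fun a b => hW.2.1 _ _) fun F => ?_
      have hb := abs_graphDiff_le F (b := pull V v) fun a b => hV' _ _
      exact abs_mul_four_le (hb _ _) (hb _ _) (hb _ _) (hb _ _)
  rw [integral_const_mul, integral_finsetSum _ fun i' _ => integrable_finsetSum _ fun i _ =>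
    integrable_finsetSum _ fun j _ => integrable_finsetSum _ fun j' _ => int i' i j j']
  simp_rw [fun i' => integral_finsetSum Finset.univ (fun (i : Fin k) _ =>
    integrable_finsetSum Finset.univ fun j _ =>
      integrable_finsetSum Finset.univ fun j' _ => int i' i j j')]
  simp_rw [fun i' i => integral_finsetSum Finset.univ (fun (j : Fin k) _ =>
      integrable_finsetSum Finset.univ fun j' _ => int i' i j j')]
  simp_rw [fun i' i j => integral_finsetSum Finset.univ (fun (j' : Fin k) _ => int i' i j j')]
  calc _ ≤ (k : ℝ)⁻¹ ^ 4 * ∑ i' : Fin k, ∑ i : Fin k, ∑ j : Fin k, ∑ j' : Fin k,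
        (f + ((if i = i' then 1 else 0) +
      (if j = j' then 1 else 0) + (if i = j then 1 else 0) + (if i = j' then 1 else 0) +
      (if i' = j then 1 else 0) + (if i' = j' then 1 else 0))) := by
        refine mul_le_mul_of_nonneg_left ?_ (by positivity)
        exact Finset.sum_le_sum fun i' _ => Finset.sum_le_sum fun i _ =>
          Finset.sum_le_sum fun j _ => Finset.sum_le_sum fun j' _ =>
            integral_quad_le hW hV hV' i i' j j'
    _ = f + 6 / k := by
        simp [Finset.sum_add_distrib]
        field_simp
        ring

/-- The deviation of label frequencies in a sample from their expectation. -/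
def countDev {L : Type} [Fintype L] (lab : USq → L) (v : Fin k → USq) : ℝ :=
  ∑ s, ((k : ℝ)⁻¹ * (∑ i, if lab (v i) = s then 1 else 0) - volume.real (lab ⁻¹' {s})) ^ 2

lemma countDev_nonneg {L : Type} [Fintype L] (lab : USq → L) (v : Fin k → USq) :
    0 ≤ countDev lab v := Finset.sum_nonneg fun _ _ => sq_nonneg _

lemma countDev_comp {L : Type} [Fintype L] (lab : USq → L) (v : Fin k → USq)
    (e : Equiv.Perm (Fin k)) : countDev lab (v ∘ e) = countDev lab v := by
  unfold countDev
  refine Finset.sum_congr rfl fun s _ => ?_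
  rw [← Equiv.sum_comp e fun i => if lab (v i) = s then (1 : ℝ) else 0]
  rfl

lemma measurable_labelIndicator {L : Type} [MeasurableSpace L] [MeasurableSingletonClass L]
    {lab : USq → L} (hl : Measurable lab) (s : L) :
    Measurable fun x => if lab x = s then (1 : ℝ) else 0 :=
  Measurable.ite (hl (measurableSet_singleton s)) measurable_const measurable_const

lemma measurable_countDev {L : Type} [Fintype L] [MeasurableSpace L] [MeasurableSingletonClass L]
    {lab : USq → L} (hl : Measurable lab) :
    Measurable fun v : Fin k → USq => countDev lab v := by
  unfold countDev
  refine Finset.measurable_sum _ fun s _ => Measurable.pow_const ?_ 2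
  refine Measurable.sub_const (Measurable.const_mul ?_ _) _
  exact Finset.measurable_sum _ fun i _ =>
    (measurable_labelIndicator hl s).comp (measurable_pi_apply i)

lemma countDev_le {L : Type} [Fintype L] (lab : USq → L) (v : Fin k → USq) :
    countDev lab v ≤ Fintype.card L := by
  unfold countDev
  have : ∀ s ∈ (Finset.univ : Finset L), ((k : ℝ)⁻¹ * (∑ i, if lab (v i) = s then 1 else 0) -
      volume.real (lab ⁻¹' {s})) ^ 2 ≤ 1 := by
    intro s _
    rw [← sq_abs]
    refine pow_le_one₀ (abs_nonneg _) ?_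
    have h1 : (0 : ℝ) ≤ volume.real (lab ⁻¹' {s}) := measureReal_nonneg
    have h2 : volume.real (lab ⁻¹' {s}) ≤ 1 := measureReal_le_one
    have h3 : (0 : ℝ) ≤ ∑ i, if lab (v i) = s then 1 else 0 :=
      Finset.sum_nonneg fun i _ => by split_ifs <;> norm_num
    have h4 : (∑ i, if lab (v i) = s then (1 : ℝ) else 0) ≤ k := by
      refine (Finset.sum_le_sum (g := fun _ => (1 : ℝ)) fun i _ => ?_).trans (by simp)
      split_ifs <;> norm_num
    have h5 : (k : ℝ)⁻¹ * (∑ i, if lab (v i) = s then (1 : ℝ) else 0) ≤ 1 :=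
      inv_mul_le_one_of_le₀ h4 (Nat.cast_nonneg k)
    have h6 : 0 ≤ (k : ℝ)⁻¹ * (∑ i, if lab (v i) = s then (1 : ℝ) else 0) := by positivity
    rw [abs_le]; constructor <;> linarith
  refine (Finset.sum_le_sum this).trans (by simp)

lemma integral_countDev_le {L : Type} [Fintype L] [MeasurableSpace L] [MeasurableSingletonClass L]
    {lab : USq → L} (hl : Measurable lab) (hk : 0 < k) :
    ∫ v : Fin k → USq, countDev lab v ≤ Fintype.card L / k := by
  have hk' : (k : ℝ) ≠ 0 := by positivity
  have hm := fun s => measurable_labelIndicator hl s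
  set g : L → USq → ℝ := fun s x => (if lab x = s then 1 else 0) - volume.real (lab ⁻¹' {s})
    with hg
  have hgm : ∀ s, Measurable (g s) := fun s => (hm s).sub_const _
  have hgb : ∀ s x, |g s x| ≤ 1 := fun s x => by
    have h1 : (0 : ℝ) ≤ volume.real (lab ⁻¹' {s}) := measureReal_nonneg
    have h2 : volume.real (lab ⁻¹' {s}) ≤ 1 := measureReal_le_one
    simp only [hg]
    rw [abs_le]
    split_ifs <;> constructor <;> linarith
  have hg0 : ∀ s, ∫ x, g s x = 0 := fun s => by
    simp only [hg]
    rw [integral_sub (integrable_of_bdd (C := 1) (hm s) fun x => by split_ifs <;> simp)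
      (integrable_const _)]
    have : (fun x => if lab x = s then (1 : ℝ) else 0) = (lab ⁻¹' {s}).indicator 1 := by
      ext x; simp [Set.indicator_apply]
    rw [this, integral_indicator_one (hl (measurableSet_singleton s))]
    simp
  have e : ∀ v : Fin k → USq, countDev lab v =
      ∑ s, ∑ i, ∑ j, (k : ℝ)⁻¹ ^ 2 * (g s (v i) * g s (v j)) := by
    intro v
    unfold countDev
    refine Finset.sum_congr rfl fun s _ => ?_
    simp_rw [← Finset.mul_sum]
    rw [← Finset.sum_mul, ← sq, ← mul_pow]
    congr 1
    simp only [hg]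
    rw [Finset.sum_sub_distrib, mul_sub]
    simp [hk']
  simp_rw [e]
  have mg : ∀ s (i : Fin k), Measurable fun v : Fin k → USq => g s (v i) :=
    fun s i => (hgm s).comp (measurable_pi_apply i)
  have int : ∀ s i j, Integrable
      (fun v : Fin k → USq => (k : ℝ)⁻¹ ^ 2 * (g s (v i) * g s (v j))) volume := fun s i j => by
    refine (integrable_of_bdd (C := 1) ((mg s i).mul (mg s j)) fun v => ?_).const_mul _
    rw [Pi.mul_apply, abs_mul]
    exact mul_le_one₀ (hgb _ _) (abs_nonneg _) (hgb _ _)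
  have bound : ∀ s (i j : Fin k), ∫ v : Fin k → USq, g s (v i) * g s (v j) ≤
      if i = j then 1 else 0 := by
    intro s i j
    split_ifs with hij
    · refine (le_abs_self _).trans (abs_integral_le_of_bdd fun v => ?_)
      rw [abs_mul]
      exact mul_le_one₀ (hgb _ _) (abs_nonneg _) (hgb _ _)
    · have h1 : ∫ p : USq × USq, g s p.1 * g s p.2 = 0 := by
        rw [volume_square, integral_prod_mul, hg0, zero_mul]
      rw [← (measurePreserving_pair hij).map_eq, integral_map (by fun_prop)] at h1
      · exact h1.le
      · exact (((hgm s).comp measurable_fst).mul ((hgm s).comp measurable_snd)).aestronglyMeasurable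
  rw [integral_finsetSum _ fun s _ => integrable_finsetSum _ fun i _ =>
    integrable_finsetSum _ fun j _ => int s i j]
  simp_rw [fun s => integral_finsetSum Finset.univ (fun (i : Fin k) _ =>
    integrable_finsetSum Finset.univ fun j _ => int s i j),
    fun s i => integral_finsetSum Finset.univ (fun (j : Fin k) _ => int s i j), integral_const_mul]
  calc _ ≤ ∑ s : L, ∑ i : Fin k, ∑ j : Fin k, (k : ℝ)⁻¹ ^ 2 * (if i = j then 1 else 0) :=
        Finset.sum_le_sum fun s _ => Finset.sum_le_sum fun i _ => Finset.sum_le_sum fun j _ =>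
          mul_le_mul_of_nonneg_left (bound s i j) (by positivity)
    _ = Fintype.card L / k := by
        simp
        field_simp

end Sampling

section Sorting

variable {k : ℕ}

lemma volume_near_le (c : UI) {δ : ℝ} (hδ : 0 ≤ δ) :
    volume.real {y : UI | |(y : ℝ) - c| ≤ δ} ≤ 2 * δ := by
  have h : volume {y : UI | |(y : ℝ) - c| ≤ δ} ≤ ENNReal.ofReal (2 * δ) := by
    have h1 : volume {y : UI | |(y : ℝ) - c| ≤ δ} ≤ volume (Set.Icc ((c : ℝ) - δ) (c + δ)) := by
      rw [unitInterval.volume_apply]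
      refine measure_mono ?_
      rintro _ ⟨y, hy, rfl⟩
      simp only [Set.mem_ofPred_eq, abs_le] at hy
      constructor <;> linarith
    refine h1.trans_eq ?_
    rw [Real.volume_Icc]
    congr 1; ring
  exact ENNReal.toReal_le_of_le_ofReal (by linarith) h

lemma volume_near_pair_le {δ : ℝ} (hδ : 0 ≤ δ) :
    volume.real {p : USq × USq | |(p.2.1 : ℝ) - p.1.1| ≤ δ} ≤ 2 * δ := by
  have hm : MeasurableSet {p : USq × USq | |(p.2.1 : ℝ) - p.1.1| ≤ δ} := by
    refine measurableSet_le ?_ measurable_const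
    fun_prop
  refine ENNReal.toReal_le_of_le_ofReal (by linarith) ?_
  rw [volume_square, Measure.prod_apply hm]
  refine (lintegral_mono (g := fun _ => ENNReal.ofReal (2 * δ)) fun x => ?_).trans (by simp)
  have h1 := volume_near_le x.1 hδ
  have h2 : Prod.mk x ⁻¹' {p : USq × USq | |(p.2.1 : ℝ) - p.1.1| ≤ δ} =
      {y : UI | |(y : ℝ) - x.1| ≤ δ} ×ˢ Set.univ := by
    ext; simp
  simp only
  rw [h2, Measure.volume_eq_prod, Measure.prod_prod]
  simp only [measure_univ, mul_one]
  exact (ENNReal.le_ofReal_iff_toReal_le (measure_ne_top _ _) (by linarith)).2 h1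

lemma ae_injective_fst : ∀ᵐ v : Fin k → USq, Function.Injective fun i => (v i).1 := by
  have h : ∀ i j : Fin k, i ≠ j → ∀ᵐ v : Fin k → USq, (v i).1 ≠ (v j).1 := by
    intro i j hij
    have h1 := volume_near_pair_le (le_refl 0)
    have h2 : volume {p : USq × USq | |(p.2.1 : ℝ) - p.1.1| ≤ 0} = 0 := by
      rw [← measureReal_eq_zero_iff]
      exact le_antisymm (by simpa using h1) measureReal_nonneg
    have h3 := (measurePreserving_pair hij).quasiMeasurePreserving.preimage_null h2
    rw [ae_iff]
    refine measure_mono_null ?_ h3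
    intro v hv
    simp only [ne_eq, not_not, Set.mem_ofPred_eq] at hv
    simp [hv]
  have h' : ∀ᵐ v : Fin k → USq, ∀ i j : Fin k, i ≠ j → (v i).1 ≠ (v j).1 := by
    simp only [ae_all_iff]
    exact fun i j hij => h i j hij
  filter_upwards [h'] with v hv i j hij
  by_contra hne
  exact hv i j hne hij

/-- The indicator that a sample is listed in the order of first coordinates. -/
def sortInd (v : Fin k → USq) : ℝ := if Monotone (fun i => (v i).1) then 1 else 0

lemma sortInd_nonneg (v : Fin k → USq) : 0 ≤ sortInd v := by
  unfold sortInd; split_ifs <;> norm_num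

lemma abs_sortInd_le (v : Fin k → USq) : |sortInd v| ≤ 1 := by
  unfold sortInd; split_ifs <;> norm_num

lemma sortInd_eq_prod (v : Fin k → USq) : sortInd v =
    ∏ p ∈ Finset.univ.filter (fun p : Fin k × Fin k => p.1 < p.2),
      if ((v p.1).1 : ℝ) ≤ ((v p.2).1 : ℝ) then 1 else 0 := by
  rw [Finset.prod_ite_zero]
  unfold sortInd
  simp only [Finset.prod_const_one]
  congr 1
  simp only [Finset.mem_filter, Finset.mem_univ, true_and, Prod.forall, eq_iff_iff]
  constructor
  · intro h a b hab
    exact h hab.le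
  · intro h a b hab
    rcases hab.lt_or_eq with h1 | rfl
    · exact h a b h1
    · exact le_rfl

lemma measurable_sortInd : Measurable (sortInd : (Fin k → USq) → ℝ) := by
  have : (sortInd : (Fin k → USq) → ℝ) = fun v =>
      ∏ p ∈ Finset.univ.filter (fun p : Fin k × Fin k => p.1 < p.2),
      if ((v p.1).1 : ℝ) ≤ ((v p.2).1 : ℝ) then 1 else 0 := funext sortInd_eq_prod
  rw [this]
  refine Finset.measurable_prod _ fun p _ => ?_
  refine Measurable.ite (measurableSet_le ?_ ?_) measurable_const measurable_const <;> fun_prop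

lemma homDensity_eq (F : SimpleGraph (Fin k)) (W : USq → USq → ℝ) :
    homDensity F W = k.factorial * ∫ v : Fin k → USq, edgeWeight F (pull W v) * sortInd v := by
  unfold homDensity
  congr 2
  ext v
  rw [Finset.prod_mul_distrib, sortInd_eq_prod]
  rfl

lemma sum_sortInd {v : Fin k → USq} (hv : Function.Injective fun i => (v i).1) :
    ∑ e : Equiv.Perm (Fin k), sortInd (v ∘ e) = 1 := by
  have h : ∀ e : Equiv.Perm (Fin k), sortInd (v ∘ e) =
      if e = Tuple.sort (fun i => (v i).1) then 1 else 0 := by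
    intro e
    unfold sortInd
    congr 1
    rw [eq_iff_iff]
    constructor
    · intro h
      have h1 := Tuple.unique_monotone (f := fun i => (v i).1) (σ := e) h
        (Tuple.monotone_sort fun i => (v i).1)
      ext i
      exact congrArg _ (hv (congrFun h1 i))
    · rintro rfl
      exact Tuple.monotone_sort fun i => (v i).1
  simp [h]

lemma measurePreserving_perm (e : Equiv.Perm (Fin k)) :
    MeasurePreserving (fun v : Fin k → USq => v ∘ e) volume volume := by
  have h := volume_measurePreserving_piCongrLeft (fun _ : Fin k => USq) e.symm
  convert h using 1
  ext1 v
  ext1 i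
  have := Equiv.piCongrLeft_apply_apply (fun _ : Fin k => USq) e.symm v (e i)
  simp only [MeasurableEquiv.coe_piCongrLeft]
  simpa using this.symm

lemma integral_mul_sortInd {Ψ : (Fin k → USq) → ℝ} (hm : Measurable Ψ) {C : ℝ}
    (hb : ∀ v, |Ψ v| ≤ C) (hinv : ∀ (e : Equiv.Perm (Fin k)) v, Ψ (v ∘ e) = Ψ v) :
    k.factorial * ∫ v, Ψ v * sortInd v = ∫ v, Ψ v := by
  have hintg : Integrable (fun v => Ψ v * sortInd v) volume := by
    refine integrable_of_bdd (C := C) (hm.mul measurable_sortInd) fun v => ?_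
    rw [abs_mul]
    have h1 := abs_sortInd_le v
    have h2 := hb v
    nlinarith [abs_nonneg (Ψ v), abs_nonneg (sortInd v)]
  have h1 : ∀ e : Equiv.Perm (Fin k), ∫ v, Ψ v * sortInd (v ∘ e) = ∫ v, Ψ v * sortInd v := by
    intro e
    have := (measurePreserving_perm e).map_eq
    have hae : AEStronglyMeasurable (fun v => Ψ v * sortInd v)
        (Measure.map (fun v : Fin k → USq => v ∘ e) volume) := by
      rw [this]; exact hintg.aestronglyMeasurable
    conv_rhs => rw [← this, integral_map (measurePreserving_perm e).measurable.aemeasurable hae]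
    simp only [hinv]
  have hintg' : ∀ e : Equiv.Perm (Fin k), Integrable (fun v => Ψ v * sortInd (v ∘ e)) volume := by
    intro e
    have := (measurePreserving_perm e).integrable_comp_of_integrable hintg
    refine this.congr (Eventually.of_forall fun v => ?_)
    simp [hinv]
  have h2 : ∑ e : Equiv.Perm (Fin k), ∫ v, Ψ v * sortInd (v ∘ e) = ∫ v, Ψ v := by
    rw [← integral_finsetSum _ fun e _ => hintg' e]
    refine integral_congr_ae ?_
    filter_upwards [ae_injective_fst] with v hv
    rw [← Finset.mul_sum, sum_sortInd hv, mul_one]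
  rw [← h2]
  simp [h1, Fintype.card_perm]

lemma sum_graph_comp {W : USq → USq → ℝ} (hW : IsOrderon W)
    {Φ : (Fin k → USq) → SimpleGraph (Fin k) → ℝ}
    (hΦ : ∀ (e : Equiv.Perm (Fin k)) v F, Φ (v ∘ e) (F.comap e) = Φ v F)
    (e : Equiv.Perm (Fin k)) (v : Fin k → USq) :
    ∑ F, edgeWeight F (pull W (v ∘ e)) * Φ (v ∘ e) F = ∑ F, edgeWeight F (pull W v) * Φ v F := by
  rw [← Equiv.sum_comp e.symm.simpleGraph]
  refine Finset.sum_congr rfl fun F _ => ?_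
  have h1 : e.symm.simpleGraph F = F.comap e := rfl
  rw [h1, hΦ]
  congr 1
  exact edgeWeight_comp (w := pull W v) (fun i j => hW.2.2 _ _) (fun i j => hW.2.1 _ _) F e

lemma sum_integral_edgeWeight_mul_sortInd {W : USq → USq → ℝ} (hW : IsOrderon W)
    {Φ : (Fin k → USq) → SimpleGraph (Fin k) → ℝ} (hm : ∀ F, Measurable fun v => Φ v F)
    {C : ℝ} (hb : ∀ v F, |Φ v F| ≤ C)
    (hΦ : ∀ (e : Equiv.Perm (Fin k)) v F, Φ (v ∘ e) (F.comap e) = Φ v F) :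
    ∑ F, k.factorial * ∫ v, edgeWeight F (pull W v) * sortInd v * Φ v F =
      ∫ v, ∑ F, edgeWeight F (pull W v) * Φ v F := by
  rw [← integral_mul_sortInd (Ψ := fun v => ∑ F, edgeWeight F (pull W v) * Φ v F) (C := C)
    (Finset.measurable_sum _ fun F _ => (measurable_edgeWeight hW.1 F).mul (hm F))
    (fun v => abs_sum_edgeWeight_mul_le (fun i j => hW.2.1 _ _) (hb v)) (sum_graph_comp hW hΦ),
    ← Finset.mul_sum, ← integral_finsetSum]
  · congr 2
    ext v
    rw [Finset.sum_mul]
    exact Finset.sum_congr rfl fun F _ => by ring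
  · intro F _
    refine integrable_of_bdd (C := C)
      (((measurable_edgeWeight hW.1 F).mul measurable_sortInd).mul (hm F)) fun v => ?_
    rw [abs_mul, abs_mul]
    have h1 := abs_sortInd_le v
    have h2 := hb v F
    have h3 := abs_edgeWeight_le_one F (w := pull W v) fun i j => hW.2.1 _ _
    have h4 := mul_le_one₀ h3 (abs_nonneg (sortInd v)) h1
    nlinarith [abs_nonneg (Φ v F), abs_nonneg (edgeWeight F (pull W v)), abs_nonneg (sortInd v)]

lemma sum_homDensity {W : USq → USq → ℝ} (hW : IsOrderon W) :
    ∑ F : SimpleGraph (Fin k), homDensity F W = 1 := by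
  have h := sum_integral_edgeWeight_mul_sortInd (k := k) hW (Φ := fun _ _ => 1) (C := 1)
    (fun _ => measurable_const) (by simp) (fun _ _ _ => rfl)
  simp only [mul_one, sum_edgeWeight, integral_const, probReal_univ, smul_eq_mul] at h
  rw [← h]
  exact Finset.sum_congr rfl fun F _ => homDensity_eq F W

end Sorting

section Typical

variable {k : ℕ}

lemma abs_matFourCycle_le {D : Fin k → Fin k → ℝ} (hD : ∀ i j, |D i j| ≤ 1) :
    |matFourCycle D| ≤ 1 := by
  rw [abs_of_nonneg (matFourCycle_nonneg D)]
  unfold matFourCycle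
  have h : ∀ i i', (∑ j, D i j * D i' j) ^ 2 ≤ (k : ℝ) ^ 2 := by
    intro i i'
    rw [sq_le_sq, Nat.abs_cast]
    refine (Finset.abs_sum_le_sum_abs _ _).trans ?_
    refine (Finset.sum_le_sum (g := fun _ => (1 : ℝ)) fun j _ => ?_).trans (by simp)
    rw [abs_mul]
    exact mul_le_one₀ (hD _ _) (abs_nonneg _) (hD _ _)
  calc _ ≤ (k : ℝ)⁻¹ ^ 4 * ∑ i' : Fin k, ∑ i : Fin k, (k : ℝ) ^ 2 :=
        mul_le_mul_of_nonneg_left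
          (Finset.sum_le_sum fun i' _ => Finset.sum_le_sum fun i _ => h i i') (by positivity)
    _ ≤ 1 := by
      rcases Nat.eq_zero_or_pos k with rfl | hk
      · simp
      · have : (k : ℝ) ≠ 0 := by positivity
        simp only [Finset.sum_const, Finset.card_univ, Fintype.card_fin, nsmul_eq_mul]
        field_simp
        exact le_rfl

lemma measurable_matFourCycle {V : USq → USq → ℝ} (hV : Measurable (Function.uncurry V))
    (F : SimpleGraph (Fin k)) :
    Measurable fun v : Fin k → USq => matFourCycle (graphDiff F (pull V v)) := by
  unfold matFourCycle
  refine Measurable.const_mul ?_ _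
  refine Finset.measurable_sum _ fun l _ => Finset.measurable_sum _ fun i _ => ?_
  refine Measurable.pow_const ?_ 2
  exact Finset.measurable_sum _ fun j _ =>
    (measurable_graphDiff hV F i j).mul (measurable_graphDiff hV F l j)

/-- How badly the graph `F` on the sample `v` is approximated by `V`, combined with the deviation
of the label frequencies. -/
def sampleError {L : Type} [Fintype L] (V : USq → USq → ℝ) (lab : USq → L) (c : ℝ)
    (v : Fin k → USq) (F : SimpleGraph (Fin k)) : ℝ :=
  matFourCycle (graphDiff F (pull V v)) + c * countDev lab v

/-- A graph `F` is typical if it comes with a sorted sample of small error. -/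
def IsTypical {L : Type} [Fintype L] (V : USq → USq → ℝ) (lab : USq → L) (c θ : ℝ)
    (F : SimpleGraph (Fin k)) : Prop :=
  ∃ v : Fin k → USq, Monotone (fun i => (v i).1) ∧ sampleError V lab c v F ≤ θ

variable {L : Type} [Fintype L] {W V : USq → USq → ℝ} {lab : USq → L} {c θ : ℝ}

lemma homDensity_nonneg (hW : IsOrderon W) (F : SimpleGraph (Fin k)) : 0 ≤ homDensity F W := by
  rw [homDensity_eq]
  refine mul_nonneg (by positivity) (integral_nonneg fun v => ?_)
  exact mul_nonneg (edgeWeight_nonneg F fun i j => hW.2.1 _ _) (sortInd_nonneg v)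

lemma sampleError_nonneg (hc : 0 ≤ c) (v : Fin k → USq) (F : SimpleGraph (Fin k)) :
    0 ≤ sampleError V lab c v F :=
  add_nonneg (matFourCycle_nonneg _) (mul_nonneg hc (countDev_nonneg _ _))

lemma sum_not_typical_le [MeasurableSpace L] [MeasurableSingletonClass L] (hW : IsOrderon W)
    (hV : Measurable (Function.uncurry V))
    (hV' : ∀ x y, V x y ∈ Set.Icc (0 : ℝ) 1) (hl : Measurable lab) (hc : 0 ≤ c) (hθ : 0 < θ)
    (hk : 0 < k) {e : ℝ}
    (he : fourCycle (fun x y => W x y - V x y) + 6 / k + c * (Fintype.card L / k) ≤ θ * e) :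
    ∑ F : SimpleGraph (Fin k), (if IsTypical V lab c θ F then 0 else homDensity F W) ≤ e := by
  have hm : ∀ F, Measurable fun v : Fin k → USq => sampleError V lab c v F := fun F =>
    (measurable_matFourCycle hV F).add ((measurable_countDev hl).const_mul c)
  have hb : ∀ (v : Fin k → USq) F, |sampleError V lab c v F| ≤ 1 + c * Fintype.card L := by
    intro v F
    refine (abs_add_le _ _).trans (add_le_add (abs_matFourCycle_le
      fun i j => abs_graphDiff_le F (fun a b => hV' _ _) i j) ?_)
    rw [abs_mul, abs_of_nonneg hc, abs_of_nonneg (countDev_nonneg _ _)]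
    exact mul_le_mul_of_nonneg_left (countDev_le _ _) hc
  have hperm : ∀ (e : Equiv.Perm (Fin k)) v F,
      sampleError V lab c (v ∘ e) (F.comap e) = sampleError V lab c v F := by
    intro e v F
    unfold sampleError
    rw [countDev_comp, ← matFourCycle_comp (graphDiff F (pull V v)) e]
    rfl
  have key := sum_integral_edgeWeight_mul_sortInd hW hm hb hperm
  have hE : ∫ v : Fin k → USq, ∑ F, edgeWeight F (pull W v) * sampleError V lab c v F ≤ θ * e := by
    have h1 : ∀ v : Fin k → USq, ∑ F, edgeWeight F (pull W v) * sampleError V lab c v F =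
        ∑ F, edgeWeight F (pull W v) * matFourCycle (graphDiff F (pull V v)) +
          c * countDev lab v := by
      intro v
      simp only [sampleError, mul_add, Finset.sum_add_distrib]
      rw [← Finset.sum_mul, sum_edgeWeight, one_mul]
    simp_rw [h1]
    rw [integral_add, integral_const_mul]
    · exact (add_le_add (integral_matFourCycle_le hW hV hV' hk)
        (mul_le_mul_of_nonneg_left (integral_countDev_le hl hk) hc)).trans he
    · refine integrable_of_bdd (C := 1) (Finset.measurable_sum _ fun F _ =>
        (measurable_edgeWeight hW.1 F).mul (measurable_matFourCycle hV F)) fun v => ?_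
      exact abs_sum_edgeWeight_mul_le (fun i j => hW.2.1 _ _) fun F =>
        abs_matFourCycle_le fun i j => abs_graphDiff_le F (fun a b => hV' _ _) i j
    · refine (integrable_of_bdd (C := Fintype.card L) (measurable_countDev hl)
        fun v => ?_).const_mul c
      rw [abs_of_nonneg (countDev_nonneg _ _)]
      exact countDev_le _ _
  have hW' : ∀ (v : Fin k → USq) i j, pull W v i j ∈ Set.Icc (0 : ℝ) 1 := fun v i j => hW.2.1 _ _
  have int1 : ∀ F : SimpleGraph (Fin k), Integrable
      (fun v : Fin k → USq => edgeWeight F (pull W v) * sortInd v) volume := fun F => by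
    refine integrable_of_bdd (C := 1) ((measurable_edgeWeight hW.1 F).mul measurable_sortInd)
      fun v => ?_
    rw [abs_mul]
    exact mul_le_one₀ (abs_edgeWeight_le_one F (hW' v)) (abs_nonneg _) (abs_sortInd_le v)
  have int2 : ∀ F : SimpleGraph (Fin k), Integrable
      (fun v : Fin k → USq => edgeWeight F (pull W v) * sortInd v * sampleError V lab c v F)
      volume := fun F => by
    refine integrable_of_bdd (C := 1 + c * Fintype.card L)
      (((measurable_edgeWeight hW.1 F).mul measurable_sortInd).mul (hm F)) fun v => ?_
    rw [abs_mul, abs_mul]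
    have h4 := mul_le_one₀ (abs_edgeWeight_le_one F (hW' v)) (abs_nonneg _) (abs_sortInd_le v)
    exact (mul_le_mul h4 (hb v F) (abs_nonneg _) zero_le_one).trans_eq (one_mul _)
  have hF : ∀ F : SimpleGraph (Fin k), (if IsTypical V lab c θ F then 0 else homDensity F W) ≤
      θ⁻¹ * (k.factorial * ∫ v : Fin k → USq,
        edgeWeight F (pull W v) * sortInd v * sampleError V lab c v F) := by
    intro F
    have h0 : ∀ v : Fin k → USq, 0 ≤ edgeWeight F (pull W v) * sortInd v := fun v =>
      mul_nonneg (edgeWeight_nonneg F (hW' v)) (sortInd_nonneg v)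
    split_ifs with hF
    · refine mul_nonneg (by positivity) (mul_nonneg (by positivity) (integral_nonneg fun v => ?_))
      exact mul_nonneg (h0 v) (sampleError_nonneg hc v F)
    · rw [homDensity_eq, mul_left_comm]
      refine mul_le_mul_of_nonneg_left ?_ (by positivity)
      rw [← integral_const_mul]
      refine integral_mono (int1 F) ((int2 F).const_mul _) fun v => ?_
      by_cases hs : Monotone fun i => (v i).1
      · have h1 : θ < sampleError V lab c v F := by
          by_contra hcon
          exact hF ⟨v, hs, not_lt.1 hcon⟩
        have h2 : 1 ≤ θ⁻¹ * sampleError V lab c v F := by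
          rw [inv_mul_eq_div, one_le_div hθ]; exact h1.le
        simp only
        nlinarith [h0 v]
      · simp [sortInd, hs]
  calc _ ≤ ∑ F : SimpleGraph (Fin k), θ⁻¹ * (k.factorial * ∫ v : Fin k → USq,
        edgeWeight F (pull W v) * sortInd v * sampleError V lab c v F) :=
        Finset.sum_le_sum fun F _ => hF F
    _ ≤ θ⁻¹ * (θ * e) := by
      rw [← Finset.mul_sum, key]
      exact mul_le_mul_of_nonneg_left hE (by positivity)
    _ = e := by field_simp

lemma exists_common_typical {U V' : USq → USq → ℝ} {lab' : USq → L} (hW : IsOrderon W)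
    (hU : IsOrderon U)
    (h1 : ∑ F : SimpleGraph (Fin k), (if IsTypical V lab c θ F then 0 else homDensity F W) ≤ 1 / 4)
    (h2 : ∑ F : SimpleGraph (Fin k),
      (if IsTypical V' lab' c θ F then 0 else homDensity F U) ≤ 1 / 4)
    (h : ∑ F : SimpleGraph (Fin k), |homDensity F W - homDensity F U| ≤ 1 / 4) :
    ∃ F : SimpleGraph (Fin k), IsTypical V lab c θ F ∧ IsTypical V' lab' c θ F := by
  by_contra! hcon
  have h3 : ∑ F : SimpleGraph (Fin k), homDensity F W ≤
      ∑ F : SimpleGraph (Fin k), ((if IsTypical V lab c θ F then 0 else homDensity F W) +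
        (if IsTypical V' lab' c θ F then 0 else homDensity F U) +
          |homDensity F W - homDensity F U|) := by
    refine Finset.sum_le_sum fun F _ => ?_
    have h4 := homDensity_nonneg hW F
    have h5 := homDensity_nonneg hU F
    have h6 := le_abs_self (homDensity F W - homDensity F U)
    have h7 := abs_nonneg (homDensity F W - homDensity F U)
    by_cases hF : IsTypical V lab c θ F
    · simp only [hF, hcon F hF, if_true, if_false]; linarith
    · simp only [hF, if_false]; split_ifs <;> linarith
  rw [Finset.sum_add_distrib, Finset.sum_add_distrib, sum_homDensity hW] at h3
  linarith

end Typical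

section Grid

variable (N : ℕ)

/-- The position of `x` within its subinterval. -/
def relPos (x : UI) : UI := ⟨Int.fract (N * (x : ℝ)), Int.fract_nonneg _, (Int.fract_lt_one _).le⟩

lemma measurable_relPos {N : ℕ} : Measurable (relPos N) := by
  refine Measurable.subtype_mk ?_
  exact measurable_fract.comp (measurable_const.mul measurable_subtype_coe)

lemma relPos_lt_one {N : ℕ} (x : UI) : relPos N x < 1 := Int.fract_lt_one (N * (x : ℝ))

variable [NeZero N]

/-- The index of the interval of length `1 / N` containing `x`. -/
def cellIx (x : UI) : Fin N :=
  ⟨min ⌊N * (x : ℝ)⌋₊ (N - 1), by have := Nat.pos_of_neZero N; omega⟩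

lemma cellIx_le (x : UI) : ((cellIx N x : ℕ) : ℝ) ≤ N * x := by
  have h0 : 0 ≤ N * (x : ℝ) := mul_nonneg (Nat.cast_nonneg _) x.2.1
  refine le_trans ?_ (Nat.floor_le h0)
  exact_mod_cast min_le_left _ _

lemma le_cellIx_add_one (x : UI) : N * (x : ℝ) ≤ (cellIx N x : ℕ) + 1 := by
  have hN := Nat.pos_of_neZero N
  have h1 : N * (x : ℝ) ≤ N := mul_le_of_le_one_right (Nat.cast_nonneg _) x.2.2
  have h2 := Nat.lt_floor_add_one (N * (x : ℝ))
  change _ ≤ ((min ⌊N * (x : ℝ)⌋₊ (N - 1) : ℕ) : ℝ) + 1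
  rcases le_total ⌊N * (x : ℝ)⌋₊ (N - 1) with h | h
  · rw [min_eq_left h]; exact h2.le
  · rw [min_eq_right h]
    have : ((N - 1 : ℕ) : ℝ) + 1 = N := by exact_mod_cast Nat.sub_add_cancel hN
    linarith

lemma cellIx_mono : Monotone (cellIx N) := by
  intro x y h
  refine Fin.mk_le_mk.2 (min_le_min_right _ (Nat.floor_mono ?_))
  exact mul_le_mul_of_nonneg_left (Subtype.coe_le_coe.2 h) (Nat.cast_nonneg _)

lemma measurable_cellIx : Measurable (cellIx N) := (cellIx_mono N).measurable

lemma cellIx_div {q M N : ℕ} [NeZero q] [NeZero N] (hM : 0 < M) (h : N = q * M) (x : UI) :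
    (cellIx N x : ℕ) / M = cellIx q x := by
  subst h
  have hq := Nat.pos_of_neZero q
  have h0 : ⌊((q * M : ℕ) : ℝ) * x⌋₊ / M = ⌊(q : ℝ) * x⌋₊ := by
    rw [← Nat.floor_div_natCast]
    congr 1
    push_cast
    field_simp
  change min ⌊((q * M : ℕ) : ℝ) * x⌋₊ (q * M - 1) / M = min ⌊(q : ℝ) * x⌋₊ (q - 1)
  have h1 : (q * M - 1) / M = q - 1 := by
    have e : q * M - 1 = (M - 1) + M * (q - 1) := by
      obtain ⟨q, rfl⟩ := Nat.exists_eq_add_of_lt hq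
      obtain ⟨M, rfl⟩ := Nat.exists_eq_add_of_lt hM
      simp only [zero_add, Nat.add_sub_cancel]
      ring_nf
      omega
    rw [e, Nat.add_mul_div_left _ _ hM, Nat.div_eq_of_lt (by omega), zero_add]
  rw [← h0, ← h1]
  exact (Monotone.map_min fun a b h => Nat.div_le_div_right h)

/-- The similarity of the unit interval onto its `i`-th subinterval. -/
def emb (i : Fin N) (y : UI) : UI :=
  ⟨((i : ℕ) + y) / N, by
    have hN : (0 : ℝ) < N := by exact_mod_cast Nat.pos_of_neZero N
    have h1 := y.2.1
    have h2 := y.2.2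
    have h3 : ((i : ℕ) : ℝ) + 1 ≤ N := by exact_mod_cast i.2
    constructor
    · positivity
    · rw [div_le_one hN]; linarith⟩

variable {N}

lemma measurable_emb (i : Fin N) : Measurable (emb N i) := by
  refine Measurable.subtype_mk ?_
  fun_prop

lemma mul_emb (i : Fin N) (y : UI) : N * (emb N i y : ℝ) = (i : ℕ) + y := by
  have hN : (N : ℝ) ≠ 0 := by exact_mod_cast NeZero.ne N
  simp only [emb]
  field_simp

lemma cellIx_emb (i : Fin N) {y : UI} (hy : y < 1) : cellIx N (emb N i y) = i := by
  have hy' : (y : ℝ) < 1 := hy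
  have h : ⌊N * (emb N i y : ℝ)⌋₊ = i := by
    rw [mul_emb, Nat.floor_eq_iff (by have := y.2.1; positivity)]
    exact ⟨by linarith [y.2.1], by linarith⟩
  apply Fin.ext
  change min ⌊N * (emb N i y : ℝ)⌋₊ (N - 1) = i
  rw [h]
  have := i.2
  omega

lemma relPos_emb (i : Fin N) {y : UI} (hy : y < 1) : relPos N (emb N i y) = y := by
  apply Subtype.ext
  change Int.fract (N * (emb N i y : ℝ)) = y
  rw [mul_emb, Int.fract_natCast_add, Int.fract_eq_self.2 ⟨y.2.1, hy⟩]

lemma emb_lt_one (i : Fin N) {y : UI} (hy : y < 1) : emb N i y < 1 := by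
  have hN : (0 : ℝ) < N := by exact_mod_cast Nat.pos_of_neZero N
  have h3 : ((i : ℕ) : ℝ) + 1 ≤ N := by exact_mod_cast i.2
  have hy' : (y : ℝ) < 1 := hy
  change ((i : ℕ) + (y : ℝ)) / N < 1
  rw [div_lt_one hN]
  linarith

lemma emb_cellIx_relPos {x : UI} (hx : x < 1) : emb N (cellIx N x) (relPos N x) = x := by
  have hN : (0 : ℝ) < N := by exact_mod_cast Nat.pos_of_neZero N
  have hx' : (x : ℝ) < 1 := hx
  have h0 : 0 ≤ N * (x : ℝ) := mul_nonneg (Nat.cast_nonneg _) x.2.1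
  have h1 : ⌊N * (x : ℝ)⌋₊ < N := by
    rw [Nat.floor_lt h0]
    exact mul_lt_of_lt_one_right hN hx'
  have h2 : ((cellIx N x : ℕ) : ℝ) = ⌊N * (x : ℝ)⌋ := by
    change ((min ⌊N * (x : ℝ)⌋₊ (N - 1) : ℕ) : ℝ) = _
    rw [min_eq_left (by omega)]
    exact natCast_floor_eq_intCast_floor h0
  apply Subtype.ext
  change (((cellIx N x : ℕ) : ℝ) + Int.fract (N * (x : ℝ))) / N = x
  rw [h2, Int.floor_add_fract]
  field_simp

lemma sum_clamp (t : ℝ) (ht : 0 ≤ t) (n : ℕ) :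
    ∑ i ∈ Finset.range n, max 0 (min (t - i) 1) = min t n := by
  induction n with
  | zero => simp [ht]
  | succ n ih =>
    rw [Finset.sum_range_succ, ih]
    push_cast
    rcases le_total t n with h | h
    · rw [min_eq_left h, max_eq_left ((min_le_left _ _).trans (by linarith)),
        min_eq_left (by linarith), add_zero]
    · rw [min_eq_right h]
      rcases le_total t (n + 1) with h' | h'
      · rw [min_eq_left (by linarith), max_eq_right (by linarith), min_eq_left h']; ring
      · rw [min_eq_right (by linarith), max_eq_right (by linarith), min_eq_right h']

lemma volume_preimage_emb_Iic (i : Fin N) (c : UI) :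
    volume (emb N i ⁻¹' Set.Iic c) = ENNReal.ofReal (max 0 (min (N * c - (i : ℕ)) 1)) := by
  have hN : (0 : ℝ) < N := by exact_mod_cast Nat.pos_of_neZero N
  have h : ∀ y : UI, emb N i y ≤ c ↔ (y : ℝ) ≤ N * c - (i : ℕ) := by
    intro y
    change ((i : ℕ) + (y : ℝ)) / N ≤ c ↔ _
    rw [div_le_iff₀ hN]
    constructor <;> intro h <;> linarith
  by_cases h0 : N * (c : ℝ) - (i : ℕ) < 0
  · have : emb N i ⁻¹' Set.Iic c = ∅ := by
      ext y
      simp only [Set.mem_preimage, Set.mem_Iic, h, Set.mem_empty_iff_false, iff_false, not_le]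
      exact h0.trans_le y.2.1
    rw [this, max_eq_left ((min_le_left _ _).trans h0.le)]
    simp
  · push Not at h0
    have h1 : 0 ≤ min (N * (c : ℝ) - (i : ℕ)) 1 := le_min h0 zero_le_one
    have : emb N i ⁻¹' Set.Iic c =
        Set.Iic ⟨min (N * (c : ℝ) - (i : ℕ)) 1, h1, min_le_right _ _⟩ := by
      ext y
      simp only [Set.mem_preimage, Set.mem_Iic, h, ← Subtype.coe_le_coe, le_min_iff]
      exact ⟨fun h => ⟨h, y.2.2⟩, fun h => h.1⟩
    rw [this, unitInterval.volume_Iic, max_eq_right h1]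

lemma volume_eq_sum_map_emb :
    (volume : Measure UI) = (N : ℝ≥0∞)⁻¹ • ∑ i : Fin N, Measure.map (emb N i) volume := by
  have hN : (0 : ℝ) < N := by exact_mod_cast Nat.pos_of_neZero N
  refine Measure.ext_of_Iic _ _ fun c => ?_
  rw [unitInterval.volume_Iic, Measure.smul_apply, Measure.finsetSum_apply]
  simp_rw [fun i : Fin N => Measure.map_apply (μ := volume) (measurable_emb i)
    (measurableSet_Iic (a := c)), volume_preimage_emb_Iic]
  rw [← ENNReal.ofReal_sum_of_nonneg (fun i _ => le_max_left _ _),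
    Fin.sum_univ_eq_sum_range (fun i => max 0 (min (N * (c : ℝ) - i) 1)),
    sum_clamp _ (mul_nonneg hN.le c.2.1), min_eq_left (mul_le_of_le_one_right hN.le c.2.2),
    smul_eq_mul, ← ENNReal.ofReal_natCast, ← ENNReal.ofReal_inv_of_pos hN,
    ← ENNReal.ofReal_mul (by positivity)]
  congr 1
  field_simp

lemma lintegral_eq_sum_emb {g : UI → ℝ≥0∞} (hg : Measurable g) :
    ∫⁻ x, g x = (N : ℝ≥0∞)⁻¹ * ∑ i : Fin N, ∫⁻ x, g (emb N i x) := by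
  conv_lhs => rw [volume_eq_sum_map_emb (N := N)]
  rw [lintegral_smul_measure, lintegral_finsetSum_measure, smul_eq_mul]
  congr 1
  exact Finset.sum_congr rfl fun i _ => lintegral_map hg (measurable_emb i)

/-- The grid cell of side `1 / N` containing a point. -/
def cell (N : ℕ) [NeZero N] (x : USq) : Fin N × Fin N := (cellIx N x.1, cellIx N x.2)

lemma measurable_cell : Measurable (cell N) :=
  ((measurable_cellIx N).comp measurable_fst).prodMk ((measurable_cellIx N).comp measurable_snd)

/-- The similarity of the unit square onto a grid cell. -/
def cellEmb (N : ℕ) [NeZero N] (c : Fin N × Fin N) (x : USq) : USq :=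
  (emb N c.1 x.1, emb N c.2 x.2)

lemma measurable_cellEmb (c : Fin N × Fin N) : Measurable (cellEmb N c) :=
  ((measurable_emb c.1).comp measurable_fst).prodMk ((measurable_emb c.2).comp measurable_snd)

lemma volume_eq_sum_cellEmb {S : Set USq} (hS : MeasurableSet S) :
    volume S = ((N : ℝ≥0∞)⁻¹) ^ 2 * ∑ c : Fin N × Fin N, volume (cellEmb N c ⁻¹' S) := by
  have h : ∀ c : Fin N × Fin N, volume (cellEmb N c ⁻¹' S) =
      ∫⁻ x, ∫⁻ y, S.indicator 1 (emb N c.1 x, emb N c.2 y) := by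
    intro c
    rw [← lintegral_indicator_one (measurable_cellEmb c hS), Measure.volume_eq_prod,
      lintegral_prod]
    · rfl
    · exact (measurable_one.indicator (measurable_cellEmb c hS)).aemeasurable
  have hm : Measurable (S.indicator (1 : USq → ℝ≥0∞)) := measurable_one.indicator hS
  have hm' : ∀ i j : Fin N, Measurable fun p : UI × UI =>
      S.indicator (1 : USq → ℝ≥0∞) (emb N i p.1, emb N j p.2) := fun i j =>
    hm.comp (measurable_cellEmb (i, j))
  simp_rw [h]
  rw [← lintegral_indicator_one hS, Measure.volume_eq_prod, lintegral_prod _ hm.aemeasurable,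
    lintegral_eq_sum_emb (N := N) hm.lintegral_prod_right', Fintype.sum_prod_type, sq, mul_assoc]
  congr 1
  rw [Finset.mul_sum]
  refine Finset.sum_congr rfl fun i _ => ?_
  rw [← lintegral_finsetSum _ fun j _ => (hm' i j).lintegral_prod_right',
    ← lintegral_const_mul _ (Finset.measurable_sum _ fun j _ => (hm' i j).lintegral_prod_right')]
  congr 1
  ext x
  exact lintegral_eq_sum_emb (N := N) (hm.comp measurable_prodMk_left)

end Grid

section GridMap

variable {N : ℕ} [NeZero N]

lemma ae_lt_one : ∀ᵐ x : USq, x.1 < 1 ∧ x.2 < 1 := by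
  have h : ∀ᵐ x : UI, x < 1 := by
    have h1 : (volume : Measure UI) {1} = 0 := measure_singleton 1
    rw [ae_iff]
    refine measure_mono_null (fun x hx => ?_) h1
    simp only [Set.mem_ofPred_eq, not_lt] at hx
    exact le_antisymm x.2.2 hx
  have h1 : ∀ᵐ x : USq, x.1 < 1 := Measure.quasiMeasurePreserving_fst.ae h
  have h2 : ∀ᵐ x : USq, x.2 < 1 := Measure.quasiMeasurePreserving_snd.ae h
  exact h1.and h2

lemma cell_cellEmb (c : Fin N × Fin N) {y : USq} (hy : y.1 < 1 ∧ y.2 < 1) :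
    cell N (cellEmb N c y) = c := Prod.ext (cellIx_emb _ hy.1) (cellIx_emb _ hy.2)

/-- The permutation of the grid cells by translations; the null set of points having a coordinate
equal to one is fixed. -/
def gridMap (ρ : Equiv.Perm (Fin N × Fin N)) (x : USq) : USq :=
  if x.1 < 1 ∧ x.2 < 1 then cellEmb N (ρ (cell N x)) (relPos N x.1, relPos N x.2) else x

lemma gridMap_cellEmb (ρ : Equiv.Perm (Fin N × Fin N)) (c : Fin N × Fin N) {y : USq}
    (hy : y.1 < 1 ∧ y.2 < 1) : gridMap ρ (cellEmb N c y) = cellEmb N (ρ c) y := by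
  have h : (cellEmb N c y).1 < 1 ∧ (cellEmb N c y).2 < 1 :=
    ⟨emb_lt_one _ hy.1, emb_lt_one _ hy.2⟩
  rw [gridMap, if_pos h, cell_cellEmb c hy]
  congr 1
  exact Prod.ext (relPos_emb _ hy.1) (relPos_emb _ hy.2)

lemma cellEmb_cell {x : USq} (hx : x.1 < 1 ∧ x.2 < 1) :
    cellEmb N (cell N x) (relPos N x.1, relPos N x.2) = x :=
  Prod.ext (emb_cellIx_relPos hx.1) (emb_cellIx_relPos hx.2)

lemma cell_gridMap (ρ : Equiv.Perm (Fin N × Fin N)) {x : USq} (hx : x.1 < 1 ∧ x.2 < 1) :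
    cell N (gridMap ρ x) = ρ (cell N x) := by
  rw [gridMap, if_pos hx, cell_cellEmb]
  exact ⟨relPos_lt_one _, relPos_lt_one _⟩

lemma gridMap_symm_gridMap (ρ : Equiv.Perm (Fin N × Fin N)) (x : USq) :
    gridMap ρ.symm (gridMap ρ x) = x := by
  by_cases hx : x.1 < 1 ∧ x.2 < 1
  · have h : gridMap ρ x = cellEmb N (ρ (cell N x)) (relPos N x.1, relPos N x.2) := if_pos hx
    rw [h, gridMap_cellEmb _ _ ⟨relPos_lt_one _, relPos_lt_one _⟩, Equiv.symm_apply_apply,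
      cellEmb_cell hx]
  · have h : ∀ ρ : Equiv.Perm (Fin N × Fin N), gridMap ρ x = x := fun _ => if_neg hx
    rw [h, h]

lemma measurable_gridMap (ρ : Equiv.Perm (Fin N × Fin N)) : Measurable (gridMap ρ) := by
  refine Measurable.ite ?_ ?_ measurable_id
  · have h : MeasurableSet {y : UI | y < 1} := measurableSet_Iio
    exact (measurable_fst h).inter (measurable_snd h)
  · have h : Measurable fun p : (Fin N × Fin N) × USq => cellEmb N p.1 p.2 :=
      measurable_from_prod_countable_right fun c => measurable_cellEmb c
    have h1 : Measurable fun x => ρ (cell N x) := (measurable_of_countable ρ).comp measurable_cell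
    have h2 : Measurable fun x : USq => (relPos N x.1, relPos N x.2) :=
      (measurable_relPos.comp measurable_fst).prodMk (measurable_relPos.comp measurable_snd)
    have h3 : Measurable fun x => (ρ (cell N x), ((relPos N x.1, relPos N x.2) : USq)) :=
      h1.prodMk h2
    exact h.comp (f := fun x => (ρ (cell N x), ((relPos N x.1, relPos N x.2) : USq))) h3

lemma measurePreserving_gridMap (ρ : Equiv.Perm (Fin N × Fin N)) :
    MeasurePreserving (gridMap ρ) volume volume := by
  refine ⟨measurable_gridMap ρ, ?_⟩
  ext S hS
  rw [Measure.map_apply (measurable_gridMap ρ) hS,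
    volume_eq_sum_cellEmb (N := N) (measurable_gridMap ρ hS), volume_eq_sum_cellEmb (N := N) hS,
    ← Equiv.sum_comp ρ fun c => volume (cellEmb N c ⁻¹' S)]
  congr 1
  refine Finset.sum_congr rfl fun c _ => measure_congr ?_
  filter_upwards [ae_lt_one] with y hy
  refine propext ?_
  change gridMap ρ (cellEmb N c y) ∈ S ↔ cellEmb N (ρ c) y ∈ S
  rw [gridMap_cellEmb ρ c hy]

lemma isMPB_gridMap (ρ : Equiv.Perm (Fin N × Fin N)) : IsMPB (gridMap ρ) :=
  ⟨measurePreserving_gridMap ρ, gridMap ρ.symm, measurePreserving_gridMap ρ.symm,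
    gridMap_symm_gridMap ρ, gridMap_symm_gridMap ρ.symm⟩

lemma volume_cell_mem (A : Finset (Fin N × Fin N)) :
    volume.real {x | cell N x ∈ A} = A.card / (N : ℝ) ^ 2 := by
  have hm : MeasurableSet {x | cell N x ∈ A} := measurable_cell A.measurableSet
  have h : ∀ c, volume (cellEmb N c ⁻¹' {x | cell N x ∈ A}) = if c ∈ A then 1 else 0 := by
    intro c
    have h1 : (cellEmb N c ⁻¹' {x | cell N x ∈ A} : Set USq) =ᵐ[volume]
        ({_y | c ∈ A} : Set USq) := by
      filter_upwards [ae_lt_one] with y hy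
      refine propext ?_
      change cell N (cellEmb N c y) ∈ A ↔ c ∈ A
      rw [cell_cellEmb c hy]
    rw [measure_congr h1]
    split_ifs with hc <;> simp [hc]
  rw [measureReal_def, volume_eq_sum_cellEmb (N := N) hm]
  simp only [h, Finset.sum_ite_mem, Finset.univ_inter, Finset.sum_const, nsmul_eq_mul, mul_one]
  rw [ENNReal.toReal_mul]
  simp
  ring

lemma shiftOf_le {q : ℕ} [NeZero q] {f : USq → USq}
    (h : ∀ x, cellIx q (f x).1 = cellIx q x.1) : shiftOf f ≤ 1 / q := by
  have hq : (0 : ℝ) < q := by exact_mod_cast Nat.pos_of_neZero q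
  refine ciSup_le fun x => ?_
  have h1 := cellIx_le q x.1
  have h2 := le_cellIx_add_one q x.1
  have h3 := cellIx_le q (f x).1
  have h4 := le_cellIx_add_one q (f x).1
  rw [h] at h3 h4
  rw [le_div_iff₀ hq, ← abs_of_pos hq, ← abs_mul, abs_le]

  constructor <;> nlinarith

lemma shiftOf_gridMap_le {q M : ℕ} [NeZero q] (hM : 0 < M) (hN : N = q * M)
    {ρ : Equiv.Perm (Fin N × Fin N)}
    (h : ∀ c, ((ρ c).1 : ℕ) / M = (c.1 : ℕ) / M) : shiftOf (gridMap ρ) ≤ 1 / q := by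
  refine shiftOf_le fun x => ?_
  by_cases hx : x.1 < 1 ∧ x.2 < 1
  · apply Fin.ext
    rw [← cellIx_div hM hN, ← cellIx_div hM hN]
    have h1 : cellIx N (gridMap ρ x).1 = (ρ (cell N x)).1 :=
      congrArg Prod.fst (cell_gridMap ρ hx)
    rw [h1, h]
    rfl
  · rw [gridMap, if_neg hx]

end GridMap

section GridApproximation

/-- A measurable labelling of the square is close to one that is constant on fine grid cells. -/
lemma exists_grid_labelling {r : ℕ} {P : USq → Fin r} (hP : Measurable P) {η : ℝ} (hη : 0 < η) :
    ∃ N₀ : ℕ, ∀ N : ℕ, N₀ ≤ N → ∀ [NeZero N], ∃ σ : Fin N × Fin N → Fin r,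
      volume.real {x | P x ≠ σ (cell N x)} ≤ η := by
  have hPr : Measurable fun x => ((P x : ℕ) : ℝ) :=
    (measurable_of_countable fun s : Fin r => ((s : ℕ) : ℝ)).comp hP
  have hintg : Integrable (fun x => ((P x : ℕ) : ℝ)) volume :=
    integrable_of_bdd (C := r) hPr fun x => by
      rw [Nat.abs_cast]; exact_mod_cast (P x).2.le
  obtain ⟨g, -, hg, hgc, hgi⟩ := hintg.exists_hasCompactSupport_integral_sub_le
    (show (0 : ℝ) < η / 4 by linarith)
  have huc : UniformContinuous g := CompactSpace.uniformContinuous_of_continuous hgc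
  obtain ⟨δ, hδ, hgδ⟩ := Metric.uniformContinuous_iff.1 huc (1 / 8) (by norm_num)
  obtain ⟨N₀, hN₀⟩ := exists_nat_gt (1 / δ)
  refine ⟨N₀, fun N hN _ => ?_⟩
  have hNpos : (0 : ℝ) < N := by exact_mod_cast Nat.pos_of_neZero N
  have hNδ : 1 / (N : ℝ) < δ := by
    have : (N₀ : ℝ) ≤ N := by exact_mod_cast hN
    rw [div_lt_iff₀ hNpos]
    rw [div_lt_iff₀ hδ] at hN₀
    nlinarith
  have hr : Nonempty (Fin r) := ⟨P (0, 0)⟩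
  set ctr : Fin N × Fin N → USq := fun c => cellEmb N c (0, 0) with hctr
  have hdist : ∀ x : USq, dist x (ctr (cell N x)) < δ := by
    have h1 : ∀ x : UI, dist x (emb N (cellIx N x) 0) ≤ 1 / N := by
      intro x
      have h2 := cellIx_le N x
      have h3 := le_cellIx_add_one N x
      have h4 : N * (emb N (cellIx N x) 0 : ℝ) = (cellIx N x : ℕ) := by
        rw [mul_emb]; simp
      rw [Subtype.dist_eq, Real.dist_eq, le_div_iff₀ hNpos, abs_of_nonneg]
      · nlinarith
      · by_contra hcon
        push Not at hcon
        nlinarith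
    intro x
    exact (max_le (h1 x.1) (h1 x.2)).trans_lt hNδ
  refine ⟨fun c => if h : ∃ s : Fin r, |((s : ℕ) : ℝ) - g (ctr c)| < 1 / 2 then h.choose
    else Classical.arbitrary _, ?_⟩
  have hsub : {x | P x ≠ if h : ∃ s : Fin r, |((s : ℕ) : ℝ) - g (ctr (cell N x))| < 1 / 2
      then h.choose else Classical.arbitrary _} ⊆ {x | 1 / 4 ≤ ‖((P x : ℕ) : ℝ) - g x‖} := by
    intro x hx
    by_contra hcon
    simp only [Set.mem_ofPred_eq, not_le, Real.norm_eq_abs] at hcon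
    apply hx
    have h1 := hgδ (hdist x)
    rw [Real.dist_eq] at h1
    have h2 : |((P x : ℕ) : ℝ) - g (ctr (cell N x))| < 1 / 2 := by
      have := abs_sub_le ((P x : ℕ) : ℝ) (g x) (g (ctr (cell N x)))
      linarith
    have h3 : ∃ s : Fin r, |((s : ℕ) : ℝ) - g (ctr (cell N x))| < 1 / 2 := ⟨P x, h2⟩
    rw [dif_pos h3]
    have h4 := h3.choose_spec
    have h5 : |((P x : ℕ) : ℝ) - (h3.choose : ℕ)| < 1 := by
      rw [abs_lt] at h2 h4 ⊢
      constructor <;> linarith [h2.1, h2.2, h4.1, h4.2]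
    apply Fin.ext
    rw [abs_lt] at h5
    have h6 : ((P x : ℕ) : ℝ) < (h3.choose : ℕ) + 1 := by linarith [h5.2]
    have h7 : ((h3.choose : ℕ) : ℝ) < (P x : ℕ) + 1 := by linarith [h5.1]
    have h6' : (P x : ℕ) < (h3.choose : ℕ) + 1 := by exact_mod_cast h6
    have h7' : (h3.choose : ℕ) < (P x : ℕ) + 1 := by exact_mod_cast h7
    omega
  refine (measureReal_mono hsub).trans ?_
  have h8 := mul_meas_ge_le_integral_of_nonneg (μ := (volume : Measure USq))
    (f := fun x => ‖((P x : ℕ) : ℝ) - g x‖)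
    (Eventually.of_forall fun x => norm_nonneg _) (hintg.sub hgi).norm (1 / 4)
  linarith

end GridApproximation

section Matching

open Finset

variable {X Y L : Type} [Fintype X] [Fintype Y]

lemma card_filter_le_of_equiv_max {a : Y → L} {b : X → L} {g : Y ≃ X}
    (hg : ∀ g' : Y ≃ X, #{y | a y = b (g' y)} ≤ #{y | a y = b (g y)}) (s : L) :
    (#{y | a y = s ∧ a y ≠ b (g y)} : ℝ) ≤ |(#{y | a y = s} : ℝ) - #{x | b x = s}| := by
  by_cases h : ∃ y, a y = s ∧ a y ≠ b (g y)
  · obtain ⟨y, hys, hy⟩ := h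
    have hX : ∀ x, b x = s → a (g.symm x) = s := by
      intro x hx
      by_contra hcon
      have hlt : #{z | a z = b (g z)} < #{z | a z = b ((g.trans (Equiv.swap (g y) x)) z)} := by
        refine card_lt_card ?_
        rw [ssubset_iff_of_subset]
        · refine ⟨y, mem_filter.2 ⟨mem_univ _, ?_⟩, ?_⟩
          · rw [Equiv.trans_apply, Equiv.swap_apply_left, hys, hx]
          · simpa using hy
        · intro z hz
          refine mem_filter.2 ⟨mem_univ _, ?_⟩
          replace hz := (mem_filter.1 hz).2
          rw [Equiv.trans_apply, Equiv.swap_apply_of_ne_of_ne]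
          · exact hz
          · intro h1
            rw [g.injective h1] at hz
            exact hy hz
          · rintro rfl
            rw [Equiv.symm_apply_apply] at hcon
            exact hcon (hz.trans hx)
      exact absurd (hg _) (not_le.2 hlt)
    have h1 : #{x | b x = s} ≤ #{y | a y = s ∧ a y = b (g y)} := by
      refine card_le_card_of_injOn g.symm (fun x hx => ?_) g.symm.injective.injOn
      simp only [coe_filter, mem_univ, true_and, Set.mem_ofPred_eq] at hx ⊢
      exact ⟨hX x hx, by rw [hX x hx, Equiv.apply_symm_apply, hx]⟩
    have h2 : #{y | a y = s ∧ a y = b (g y)} + #{y | a y = s ∧ a y ≠ b (g y)} =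
        #{y | a y = s} := by
      rw [← filter_filter, ← filter_filter, card_filter_add_card_filter_not]
    have h1' : (#{x | b x = s} : ℝ) ≤ #{y | a y = s ∧ a y = b (g y)} := by exact_mod_cast h1
    have h2' : (#{y | a y = s ∧ a y = b (g y)} : ℝ) + #{y | a y = s ∧ a y ≠ b (g y)} =
        #{y | a y = s} := by exact_mod_cast h2
    refine le_trans ?_ (le_abs_self _)
    linarith
  · have : (univ.filter fun y => a y = s ∧ a y ≠ b (g y)) = ∅ := by
      ext y
      simp only [mem_filter, mem_univ, true_and, notMem_empty, iff_false]
      exact fun hy => h ⟨y, hy⟩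
    rw [this]
    simp

lemma exists_equiv_labels [Fintype L] (h : Fintype.card Y = Fintype.card X)
    (a : Y → L) (b : X → L) :
    ∃ g : Y ≃ X, (#{y | a y ≠ b (g y)} : ℝ) ≤
      ∑ s, |(#{y | a y = s} : ℝ) - #{x | b x = s}| := by
  have : Nonempty (Y ≃ X) := ⟨Fintype.equivOfCardEq h⟩
  obtain ⟨g, hg⟩ := Finite.exists_max fun g : Y ≃ X => #{y | a y = b (g y)}
  refine ⟨g, ?_⟩
  rw [card_eq_sum_card_fiberwise (f := a) (t := univ) fun _ _ => by simp]
  push_cast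
  refine sum_le_sum fun s _ => ?_
  refine le_trans (le_of_eq ?_) (card_filter_le_of_equiv_max hg s)
  rw [filter_filter]
  congr 2
  ext y
  simp [and_comm]

lemma exists_perm_label_preserving (a : X → L) (f₀ : Equiv.Perm X) :
    ∃ f : Equiv.Perm X, (∀ x, a (f x) = a x) ∧ ∀ x, a (f₀ x) = a x → f x = f₀ x := by
  have : Nonempty {f : Equiv.Perm X // ∀ x, a (f x) = a x} := ⟨Equiv.refl X, fun _ => rfl⟩
  obtain ⟨⟨f, hf⟩, hmax⟩ := Finite.exists_max
    fun f : {f : Equiv.Perm X // ∀ x, a (f x) = a x} => #{x | f.1 x = f₀ x}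
  refine ⟨f, hf, fun x hx => ?_⟩
  by_contra hne
  have hswap : ∀ z, a ((f.trans (Equiv.swap (f x) (f₀ x))) z) = a z := by
    intro z
    rw [Equiv.trans_apply]
    rcases eq_or_ne (f z) (f x) with h1 | h1
    · rw [h1, Equiv.swap_apply_left, hx, f.injective h1]
    · rcases eq_or_ne (f z) (f₀ x) with h2 | h2
      · rw [h2, Equiv.swap_apply_right, hf x, ← hf z, h2, hx]
      · rw [Equiv.swap_apply_of_ne_of_ne h1 h2, hf]
  have hlt : #{z | f z = f₀ z} < #{z | (f.trans (Equiv.swap (f x) (f₀ x))) z = f₀ z} := by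
    refine card_lt_card ?_
    rw [ssubset_iff_of_subset]
    · exact ⟨x, mem_filter.2 ⟨mem_univ _, Equiv.swap_apply_left _ _⟩, by simpa using hne⟩
    · intro z hz
      refine mem_filter.2 ⟨mem_univ _, ?_⟩
      replace hz := (mem_filter.1 hz).2
      have hzx : z ≠ x := by
        rintro rfl
        exact hne hz
      rw [Equiv.trans_apply, Equiv.swap_apply_of_ne_of_ne (fun h => hzx (f.injective h))
        (fun h => hzx (f₀.injective (hz.symm.trans h))), hz]
  exact absurd (hmax ⟨_, hswap⟩) (not_le.2 hlt)

lemma card_ne_le_of_monotone {k q : ℕ} {a b : Fin k → Fin q} (ha : Monotone a) (hb : Monotone b) :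
    (#{i | a i ≠ b i} : ℝ) ≤ q * ∑ t, |(#{i | a i = t} : ℝ) - #{i | b i = t}| := by
  have h1 : ∀ i, (if a i ≠ b i then (1 : ℝ) else 0) ≤
      ∑ s : Fin q, |(if a i ≤ s then (1 : ℝ) else 0) - if b i ≤ s then 1 else 0| := by
    intro i
    split_ifs with h
    · refine le_trans ?_ (single_le_sum (fun s _ => abs_nonneg _) (mem_univ (min (a i) (b i))))
      rcases lt_or_gt_of_ne h with h | h
      · simp [min_eq_left h.le, h.not_ge]
      · simp [min_eq_right h.le, h.not_ge]
    · exact sum_nonneg fun s _ => abs_nonneg _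
  have h2 : ∀ s : Fin q, ∑ i, |(if a i ≤ s then (1 : ℝ) else 0) - if b i ≤ s then 1 else 0| =
      |∑ i, ((if a i ≤ s then (1 : ℝ) else 0) - if b i ≤ s then 1 else 0)| := by
    intro s
    by_cases hs : ∀ i, a i ≤ s → b i ≤ s
    · rw [abs_of_nonpos, ← sum_neg_distrib]
      · refine sum_congr rfl fun i _ => abs_of_nonpos ?_
        have := hs i
        split_ifs <;> simp_all
      · refine sum_nonpos fun i _ => ?_
        have := hs i
        split_ifs <;> simp_all
    · have hs' : ∀ i, b i ≤ s → a i ≤ s := by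
        push Not at hs
        obtain ⟨j, hj1, hj2⟩ := hs
        intro i hi
        by_contra hcon
        push Not at hcon
        rcases le_total i j with h | h
        · exact absurd ((ha h).trans hj1) (not_le.2 hcon)
        · exact absurd ((hb h).trans hi) (not_le.2 hj2)
      rw [abs_of_nonneg]
      · refine sum_congr rfl fun i _ => abs_of_nonneg ?_
        have := hs' i
        split_ifs <;> simp_all
      · refine sum_nonneg fun i _ => ?_
        have := hs' i
        split_ifs <;> simp_all
  have h3 : ∀ (c : Fin k → Fin q) (s : Fin q), ∑ i, (if c i ≤ s then (1 : ℝ) else 0) =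
      ∑ t, if t ≤ s then (#{i | c i = t} : ℝ) else 0 := by
    intro c s
    have : ∀ i, (if c i ≤ s then (1 : ℝ) else 0) =
        ∑ t, if t ≤ s then (if c i = t then (1 : ℝ) else 0) else 0 := by
      intro i
      rw [sum_eq_single (c i)]
      · simp
      · intro t _ ht
        simp [ht.symm]
      · simp
    simp_rw [this]
    rw [sum_comm]
    refine sum_congr rfl fun t _ => ?_
    split_ifs
    · simp
    · simp
  calc (#{i | a i ≠ b i} : ℝ) = ∑ i, if a i ≠ b i then (1 : ℝ) else 0 :=
      natCast_card_filter _ _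
    _ ≤ ∑ i, ∑ s : Fin q, |(if a i ≤ s then (1 : ℝ) else 0) - if b i ≤ s then 1 else 0| :=
      sum_le_sum fun i _ => h1 i
    _ = ∑ s : Fin q, |∑ t, if t ≤ s then (#{i | a i = t} : ℝ) - #{i | b i = t} else 0| := by
      rw [sum_comm]
      refine sum_congr rfl fun s _ => ?_
      rw [h2, sum_sub_distrib, h3, h3, ← sum_sub_distrib]
      congr 1
      refine sum_congr rfl fun t _ => ?_
      split_ifs <;> simp
    _ ≤ ∑ s : Fin q, ∑ t, |(#{i | a i = t} : ℝ) - #{i | b i = t}| := by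
      refine sum_le_sum fun s _ => (abs_sum_le_sum_abs _ _).trans (sum_le_sum fun t _ => ?_)
      split_ifs
      · exact le_rfl
      · rw [abs_zero]; exact abs_nonneg _
    _ = _ := by simp

end Matching

section Coupling

open Finset

variable {k q r : ℕ} [NeZero q]

/-- The label of a point: its vertical strip together with its part. -/
def stripLabel (q : ℕ) [NeZero q] (P : USq → Fin r) (x : USq) : Fin q × Fin r :=
  (cellIx q x.1, P x)

lemma measurable_stripLabel {P : USq → Fin r} (hP : Measurable P) :
    Measurable (stripLabel q P) :=
  ((measurable_cellIx q).comp measurable_fst).prodMk hP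

/-- The strip containing a grid cell. -/
def stripOf {N M : ℕ} (h : N = q * M) (c : Fin N × Fin N) : Fin q :=
  ⟨c.1 / M, Nat.div_lt_of_lt_mul (lt_of_lt_of_eq c.1.2 (h.trans (mul_comm _ _)))⟩

lemma stripOf_cell {N M : ℕ} [NeZero N] (hM : 0 < M) (h : N = q * M) (x : USq) :
    stripOf h (cell N x) = cellIx q x.1 := Fin.ext (cellIx_div hM h x.1)

/-- The total deviation of label frequencies in a sample. -/
def freqDev {L : Type} [Fintype L] (lab : USq → L) (v : Fin k → USq) : ℝ :=
  ∑ s, |(k : ℝ)⁻¹ * #{i | lab (v i) = s} - volume.real (lab ⁻¹' {s})|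

lemma exists_slot_matching {N M m : ℕ} [NeZero N] (hk : 0 < k) (hM : 0 < M) (hN : N = q * M)
    (hm : k * m = N * N) {P : USq → Fin r} {σ : Fin N × Fin N → Fin r} {η : ℝ}
    (hσ : volume.real {x | P x ≠ σ (cell N x)} ≤ η) (v : Fin k → USq) :
    ∃ g : Fin k × Fin m ≃ Fin N × Fin N,
      (#{y | stripLabel q P (v y.1) ≠ (stripOf hN (g y), σ (g y))} : ℝ) ≤
        N ^ 2 * (freqDev (stripLabel q P) v + q * r * η) := by
  have hNpos : (0 : ℝ) < N := by exact_mod_cast Nat.pos_of_neZero N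
  have hkpos : (0 : ℝ) < k := by exact_mod_cast hk
  have hm' : (k : ℝ) * m = N ^ 2 := by rw [sq]; exact_mod_cast hm
  obtain ⟨g, hg⟩ := exists_equiv_labels (Y := Fin k × Fin m) (X := Fin N × Fin N)
    (by simpa using hm)
    (fun y => stripLabel q P (v y.1)) (fun c => (stripOf hN c, σ c))
  refine ⟨g, ?_⟩
  have h1 : ∀ s, (#{y : Fin k × Fin m | stripLabel q P (v y.1) = s} : ℝ) =
      N ^ 2 * ((k : ℝ)⁻¹ * #{i | stripLabel q P (v i) = s}) := by
    intro s
    have : (univ.filter fun y : Fin k × Fin m => stripLabel q P (v y.1) = s) =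
        (univ.filter fun i => stripLabel q P (v i) = s) ×ˢ univ := by
      ext y; simp
    rw [this, card_product, card_univ, Fintype.card_fin, ← hm']
    push_cast
    field_simp
  have h2 : ∀ s, (#{c : Fin N × Fin N | (stripOf hN c, σ c) = s} : ℝ) =
      N ^ 2 * volume.real {x | (stripOf hN (cell N x), σ (cell N x)) = s} := by
    intro s
    have := volume_cell_mem (univ.filter fun c : Fin N × Fin N => (stripOf hN c, σ c) = s)
    simp only [mem_filter, mem_univ, true_and] at this
    rw [this]
    field_simp
  have h3 : ∀ s, |volume.real (stripLabel q P ⁻¹' {s}) -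
      volume.real {x | (stripOf hN (cell N x), σ (cell N x)) = s}| ≤ η := by
    intro s
    refine le_trans (abs_le.2 ⟨?_, ?_⟩) hσ
    · have : {x | (stripOf hN (cell N x), σ (cell N x)) = s} ⊆
          (stripLabel q P ⁻¹' {s}) ∪ {x | P x ≠ σ (cell N x)} := by
        intro x hx
        by_cases h : P x = σ (cell N x)
        · left
          simp only [Set.mem_preimage, Set.mem_singleton_iff, stripLabel, ← stripOf_cell hM hN, h]
          exact hx
        · exact Or.inr h
      have := (measureReal_mono (μ := volume) this).trans (measureReal_union_le _ _)
      linarith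
    · have : (stripLabel q P ⁻¹' {s}) ⊆ {x | (stripOf hN (cell N x), σ (cell N x)) = s} ∪
          {x | P x ≠ σ (cell N x)} := by
        intro x hx
        by_cases h : P x = σ (cell N x)
        · left
          simp only [Set.mem_preimage, Set.mem_singleton_iff, stripLabel, ← stripOf_cell hM hN,
            h] at hx
          exact hx
        · exact Or.inr h
      have := (measureReal_mono (μ := volume) this).trans (measureReal_union_le _ _)
      linarith
  have h4 : ∀ s : Fin q × Fin r, |(#{y : Fin k × Fin m | stripLabel q P (v y.1) = s} : ℝ) -
      #{c : Fin N × Fin N | (stripOf hN c, σ c) = s}| ≤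
      N ^ 2 * (|(k : ℝ)⁻¹ * #{i | stripLabel q P (v i) = s} -
        volume.real (stripLabel q P ⁻¹' {s})| + η) := by
    intro s
    rw [h1, h2, ← mul_sub, abs_mul, abs_of_pos (by positivity : (0 : ℝ) < N ^ 2)]
    refine mul_le_mul_of_nonneg_left ?_ (by positivity)
    exact (abs_sub_le _ (volume.real (stripLabel q P ⁻¹' {s})) _).trans
      (add_le_add le_rfl (h3 s))
  calc _ = _ := by congr!
    _ ≤ _ := hg
    _ = _ := sum_congr rfl fun s _ => by congr!
    _ ≤ _ := sum_le_sum fun s _ => h4 s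
    _ = _ := ?_
  rw [← mul_sum, sum_add_distrib]
  have h5 : freqDev (stripLabel q P) v = ∑ s, |(k : ℝ)⁻¹ *
      #{i | stripLabel q P (v i) = s} - volume.real (stripLabel q P ⁻¹' {s})| :=
    sum_congr rfl fun s _ => by congr!
  rw [h5]
  simp

lemma card_strip_ne_le (hk : 0 < k) {P P' : USq → Fin r} (hP : Measurable P) (hP' : Measurable P')
    {v u : Fin k → USq} (hv : Monotone fun i => (v i).1) (hu : Monotone fun i => (u i).1) :
    (#{i | cellIx q (v i).1 ≠ cellIx q (u i).1} : ℝ) ≤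
      k * (q * (freqDev (stripLabel q P) v + freqDev (stripLabel q P') u)) := by
  have hkpos : (0 : ℝ) < k := by exact_mod_cast hk
  have key : ∀ {P : USq → Fin r} (_ : Measurable P) (v : Fin k → USq),
      ∑ t, |(k : ℝ)⁻¹ * #{i | cellIx q (v i).1 = t} - volume.real {x : USq | cellIx q x.1 = t}| ≤
        freqDev (stripLabel q P) v := by
    intro P hP v
    unfold freqDev
    rw [Fintype.sum_prod_type]
    refine sum_le_sum fun t _ => ?_
    have h1 : (#{i | cellIx q (v i).1 = t} : ℝ) =
        ∑ p, (#{i | stripLabel q P (v i) = (t, p)} : ℝ) := by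
      rw [card_eq_sum_card_fiberwise (f := fun i => P (v i)) (t := univ) fun _ _ => by simp]
      push_cast
      refine sum_congr rfl fun p _ => ?_
      rw [filter_filter]
      simp [stripLabel]
    have h2 : volume.real {x : USq | cellIx q x.1 = t} =
        ∑ p, volume.real (stripLabel q P ⁻¹' {(t, p)}) := by
      have := sum_measureReal_preimage_singleton (μ := (volume : Measure USq))
        (({t} : Finset (Fin q)) ×ˢ (univ : Finset (Fin r))) (f := stripLabel q P)
        fun y _ => measurable_stripLabel hP (measurableSet_singleton y)
      rw [sum_product, sum_singleton] at this
      rw [this]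
      congr 1
      ext x
      simp only [stripLabel, Set.mem_ofPred_eq, Set.mem_preimage, coe_product, coe_singleton,
        coe_univ, Set.mem_prod, Set.mem_singleton_iff, Set.mem_univ, and_true]
    rw [h1, h2, mul_sum, ← sum_sub_distrib]
    refine (abs_sum_le_sum_abs _ _).trans_eq (sum_congr rfl fun p _ => ?_)
    congr!
  refine (card_ne_le_of_monotone (fun i j h => cellIx_mono q (hv h))
    (fun i j h => cellIx_mono q (hu h))).trans ?_
  rw [mul_left_comm]
  refine mul_le_mul_of_nonneg_left ?_ (Nat.cast_nonneg _)
  rw [← inv_mul_le_iff₀ hkpos, mul_sum]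
  refine le_trans ?_ (add_le_add (key hP v) (key hP' u))
  rw [← sum_add_distrib]
  refine sum_le_sum fun t _ => ?_
  rw [← abs_of_pos (inv_pos.2 hkpos), ← abs_mul, mul_sub, abs_of_pos (inv_pos.2 hkpos)]
  refine (abs_sub_le _ (volume.real {x : USq | cellIx q x.1 = t}) _).trans ?_
  rw [abs_sub_comm (volume.real {x : USq | cellIx q x.1 = t})]

lemma exists_coupling (hk : 0 < k) {P P' : USq → Fin r} (hP : Measurable P) (hP' : Measurable P')
    {v u : Fin k → USq} (hv : Monotone fun i => (v i).1) (hu : Monotone fun i => (u i).1)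
    {τ η : ℝ} (hη : 0 < η) (hτ : freqDev (stripLabel q P) v ≤ τ)
    (hτ' : freqDev (stripLabel q P') u ≤ τ) :
    ∃ f, IsMPB f ∧ shiftOf f ≤ 1 / q ∧ ∃ ι : USq → Fin k, Measurable ι ∧
      (∀ i, volume.real (ι ⁻¹' {i}) = (k : ℝ)⁻¹) ∧
      volume.real {x | P x ≠ P (v (ι x)) ∨ P' (f x) ≠ P' (u (ι x))} ≤ (2 + 2 * q) * τ + η := by
  have hkpos : (0 : ℝ) < k := by exact_mod_cast hk
  have hqpos := Nat.pos_of_neZero q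
  set ε : ℝ := η / (2 + 2 * (q * r)) with hε
  have hεpos : 0 < ε := by positivity
  obtain ⟨n₁, h₁⟩ := exists_grid_labelling hP hεpos
  obtain ⟨n₂, h₂⟩ := exists_grid_labelling hP' hεpos
  set M := k * (n₁ + n₂ + 1) with hMdef
  have hM : 0 < M := by positivity
  obtain ⟨N, hN⟩ : ∃ N, N = q * M := ⟨_, rfl⟩
  have hle : n₁ + n₂ ≤ N := by rw [hN, hMdef]; nlinarith [Nat.mul_pos hqpos hk]
  have : NeZero N := ⟨by rw [hN]; positivity⟩
  have hNpos : (0 : ℝ) < N := by exact_mod_cast Nat.pos_of_neZero N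
  set m := (n₁ + n₂ + 1) * q * N
  have hm : k * m = N * N := by
    change k * ((n₁ + n₂ + 1) * q * N) = N * N
    conv_rhs => rw [hN]
    rw [hMdef, hN]
    ring
  have hm' : (k : ℝ) * m = N ^ 2 := by rw [sq]; exact_mod_cast hm
  obtain ⟨σ, hσ⟩ := h₁ N (by omega)
  obtain ⟨σ', hσ'⟩ := h₂ N (by omega)
  obtain ⟨g, hg⟩ := exists_slot_matching hk hM hN hm hσ v
  obtain ⟨g', hg'⟩ := exists_slot_matching hk hM hN hm hσ' u
  obtain ⟨ρ, hρ, hρ'⟩ := exists_perm_label_preserving (stripOf hN) (g.symm.trans g')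
  have hshift : shiftOf (gridMap ρ) ≤ 1 / q :=
    shiftOf_gridMap_le hM hN fun c => congrArg Fin.val (hρ c)
  have hf := isMPB_gridMap ρ
  have hcount : ∀ i, (#{c : Fin N × Fin N | (g.symm c).1 = i}) = m := by
    intro i
    rw [show (univ.filter fun c : Fin N × Fin N => (g.symm c).1 = i) =
      (({i} : Finset (Fin k)) ×ˢ (univ : Finset (Fin m))).map g.toEmbedding by
        ext c
        simp only [mem_filter, mem_univ, true_and, mem_map_equiv, mem_product, mem_singleton,
          and_true]]
    simp
  refine ⟨gridMap ρ, hf, hshift, fun x => (g.symm (cell N x)).1,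
    (measurable_of_countable fun c => (g.symm c).1).comp measurable_cell, fun i => ?_, ?_⟩
  · have h := volume_cell_mem (univ.filter fun c : Fin N × Fin N => (g.symm c).1 = i)
    simp only [mem_filter, mem_univ, true_and] at h
    refine h.trans ?_
    rw [hcount, ← hm']
    have : (m : ℝ) ≠ 0 := by
      intro h
      rw [h, mul_zero] at hm'
      exact absurd hm' (by positivity)
    field_simp
  · set B₁ := univ.filter fun y => stripLabel q P (v y.1) ≠ (stripOf hN (g y), σ (g y))
    set B₂ := univ.filter fun y => stripLabel q P' (u y.1) ≠ (stripOf hN (g' y), σ' (g' y))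
    set B₃ := univ.filter fun y : Fin k × Fin m => cellIx q (v y.1).1 ≠ cellIx q (u y.1).1
    have hB₃ : (#B₃ : ℝ) ≤ N ^ 2 * (q * (τ + τ)) := by
      have : B₃ = (univ.filter fun i => cellIx q (v i).1 ≠ cellIx q (u i).1) ×ˢ univ := by
        ext y; simp [B₃]
      rw [this, card_product, card_univ, Fintype.card_fin]
      push_cast
      have h := card_strip_ne_le (q := q) hk hP hP' hv hu
      have h' : (k : ℝ) * (q * (freqDev (stripLabel q P) v + freqDev (stripLabel q P') u)) ≤
          k * (q * (τ + τ)) := by gcongr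
      rw [← hm']
      nlinarith [mul_le_mul_of_nonneg_right (h.trans h') (Nat.cast_nonneg (α := ℝ) m)]
    set A := (B₁ ∪ B₂ ∪ B₃).map g.toEmbedding
    have hA : (#A : ℝ) ≤ N ^ 2 * ((2 + 2 * q) * τ + 2 * (q * r * ε)) := by
      rw [card_map]
      have h : #(B₁ ∪ B₂ ∪ B₃) ≤ #B₁ + #B₂ + #B₃ :=
        (card_union_le _ _).trans (Nat.add_le_add_right (card_union_le _ _) _)
      have h' : (#(B₁ ∪ B₂ ∪ B₃) : ℝ) ≤ #B₁ + #B₂ + #B₃ := by exact_mod_cast h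
      have h1 : (N : ℝ) ^ 2 * (freqDev (stripLabel q P) v + q * r * ε) ≤
        N ^ 2 * (τ + q * r * ε) := by gcongr
      have h2 : (N : ℝ) ^ 2 * (freqDev (stripLabel q P') u + q * r * ε) ≤
        N ^ 2 * (τ + q * r * ε) := by gcongr
      linarith
    have hsub : {x | P x ≠ P (v (g.symm (cell N x)).1) ∨
        P' (gridMap ρ x) ≠ P' (u (g.symm (cell N x)).1)} ⊆
        ({x | P x ≠ σ (cell N x)} ∪ gridMap ρ ⁻¹' {x | P' x ≠ σ' (cell N x)}) ∪
          ({x | cell N x ∈ A} ∪ {x | ¬ (x.1 < 1 ∧ x.2 < 1)}) := by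
      intro x hx
      by_contra hcon
      simp only [Set.mem_union, Set.mem_ofPred_eq, Set.mem_preimage, not_or, not_not] at hcon
      obtain ⟨⟨h1, h2⟩, h3, h4⟩ := hcon
      set c := cell N x
      have h5 : g.symm c ∉ B₁ ∪ B₂ ∪ B₃ := by
        intro h
        exact h3 (mem_map.2 ⟨_, h, by simp⟩)
      simp only [mem_union, B₁, B₂, B₃, mem_filter, mem_univ, true_and, not_or, not_not] at h5
      obtain ⟨⟨h6, h7⟩, h8⟩ := h5
      rw [Equiv.apply_symm_apply] at h6
      have h6a : cellIx q (v (g.symm c).1).1 = stripOf hN c := congrArg Prod.fst h6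
      have h6b : P (v (g.symm c).1) = σ c := congrArg Prod.snd h6
      have h7a : cellIx q (u (g.symm c).1).1 = stripOf hN (g' (g.symm c)) := congrArg Prod.fst h7
      have h7b : P' (u (g.symm c).1) = σ' (g' (g.symm c)) := congrArg Prod.snd h7
      have h9 := hρ' c (by
        rw [Equiv.trans_apply, ← h6a, ← h7a]
        exact h8.symm)
      rw [cell_gridMap ρ h4, h9, Equiv.trans_apply, ← h7b] at h2
      rw [← h6b] at h1
      exact hx.elim (fun h => h h1) fun h => h h2
    have hnull : volume.real {x : USq | ¬ (x.1 < 1 ∧ x.2 < 1)} = 0 := by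
      rw [measureReal_def, ae_iff.1 ae_lt_one, ENNReal.toReal_zero]
    have hpre : volume.real (gridMap ρ ⁻¹' {x | P' x ≠ σ' (cell N x)}) ≤ ε := by
      rw [measureReal_def, hf.1.measure_preimage]
      · exact hσ'
      · exact (measurableSet_eq_fun hP'
          ((measurable_of_countable σ').comp measurable_cell)).compl.nullMeasurableSet
    have hvA : volume.real {x | cell N x ∈ A} ≤ (2 + 2 * q) * τ + 2 * (q * r * ε) := by
      rw [volume_cell_mem, div_le_iff₀ (by positivity), mul_comm]
      exact hA
    have hfin : 2 * ε + 2 * (q * r * ε) = η := by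
      rw [hε]; field_simp
    have hu1 := measureReal_union_le (μ := (volume : Measure USq))
      ({x | P x ≠ σ (cell N x)} ∪ gridMap ρ ⁻¹' {x | P' x ≠ σ' (cell N x)})
      ({x | cell N x ∈ A} ∪ {x | ¬ (x.1 < 1 ∧ x.2 < 1)})
    have hu2 := measureReal_union_le (μ := (volume : Measure USq))
      {x | P x ≠ σ (cell N x)} (gridMap ρ ⁻¹' {x | P' x ≠ σ' (cell N x)})
    have hu3 := measureReal_union_le (μ := (volume : Measure USq))
      {x | cell N x ∈ A} {x | ¬ (x.1 < 1 ∧ x.2 < 1)}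
    refine (measureReal_mono hsub).trans ?_
    linarith

end Coupling

section Slots

variable {k : ℕ}

lemma integral_comp_slot {ι : USq → Fin k} (hι : Measurable ι)
    (h : ∀ i, volume.real (ι ⁻¹' {i}) = (k : ℝ)⁻¹) (φ : Fin k → ℝ) :
    ∫ x, φ (ι x) = (k : ℝ)⁻¹ * ∑ i, φ i := by
  have hp : IsProbabilityMeasure ((volume : Measure USq).map ι) :=
    Measure.isProbabilityMeasure_map hι.aemeasurable
  rw [← integral_map (φ := ι) (f := φ) hι.aemeasurable
    (measurable_of_countable φ).aestronglyMeasurable,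
    integral_fintype (Integrable.of_finite), Finset.mul_sum]
  refine Finset.sum_congr rfl fun i _ => ?_
  rw [map_measureReal_apply hι (measurableSet_singleton i), h, smul_eq_mul]

lemma fourCycle_comp_slot {ι : USq → Fin k} (hι : Measurable ι)
    (h : ∀ i, volume.real (ι ⁻¹' {i}) = (k : ℝ)⁻¹) (D : Fin k → Fin k → ℝ) :
    fourCycle (fun x y => D (ι x) (ι y)) = matFourCycle D := by
  unfold fourCycle matFourCycle
  have h1 : ∀ x' x, ∫ y, D (ι x) (ι y) * D (ι x') (ι y) =
      (k : ℝ)⁻¹ * ∑ j, D (ι x) j * D (ι x') j := fun x' x =>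
    integral_comp_slot hι h fun j => D (ι x) j * D (ι x') j
  have h2 : ∀ x', ∫ x, ((k : ℝ)⁻¹ * ∑ j, D (ι x) j * D (ι x') j) ^ 2 =
      (k : ℝ)⁻¹ * ∑ i, ((k : ℝ)⁻¹ * ∑ j, D i j * D (ι x') j) ^ 2 := fun x' =>
    integral_comp_slot hι h fun i => ((k : ℝ)⁻¹ * ∑ j, D i j * D (ι x') j) ^ 2
  have h3 := integral_comp_slot hι h fun i' =>
    (k : ℝ)⁻¹ * ∑ i, ((k : ℝ)⁻¹ * ∑ j, D i j * D i' j) ^ 2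
  simp only [h1, h2]
  rw [h3]
  simp only [mul_pow, ← Finset.mul_sum]
  ring

end Slots

lemma IsKer.abs_setIntegral_le_of_fourCycle {K : USq → USq → ℝ} (hK : IsKer K) {δ : ℝ}
    (hδ : 0 ≤ δ) (h : fourCycle K ≤ δ ^ 4) {S T : Set USq} (hS : MeasurableSet S)
    (hT : MeasurableSet T) : |∫ p in S ×ˢ T, K p.1 p.2| ≤ δ :=
  le_of_pow_le_pow_left₀ four_ne_zero hδ ((hK.pow_four_le_fourCycle hS hT).trans h)

lemma exists_measurableEquiv_of_isMPB {f : USq → USq} (hf : IsMPB f) :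
    ∃ e : USq ≃ᵐ USq, ⇑e = f ∧ MeasurePreserving e volume volume := by
  obtain ⟨hm, g, hg, hl, hr⟩ := hf
  exact ⟨⟨⟨f, g, hl, hr⟩, hm.measurable, hg.measurable⟩, rfl, hm⟩

lemma exists_setIntegral_comp_eq {f : USq → USq} (hf : IsMPB f) (K : USq → USq → ℝ)
    {S T : Set USq} (hS : MeasurableSet S) (hT : MeasurableSet T) :
    ∃ S' T', MeasurableSet S' ∧ MeasurableSet T' ∧
      ∫ p in S ×ˢ T, K (f p.1) (f p.2) = ∫ p in S' ×ˢ T', K p.1 p.2 := by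
  obtain ⟨e, rfl, he⟩ := exists_measurableEquiv_of_isMPB hf
  refine ⟨e.symm ⁻¹' S, e.symm ⁻¹' T, e.symm.measurable hS, e.symm.measurable hT, ?_⟩
  have hp : MeasurePreserving (e.prodCongr e) (volume : Measure (USq × USq)) volume := by
    rw [volume_square]
    exact he.prod he
  have h := hp.setIntegral_preimage_emb (e.prodCongr e).measurableEmbedding
    (fun p => K p.1 p.2) ((e.symm ⁻¹' S) ×ˢ (e.symm ⁻¹' T))
  rw [← h]
  congr 2
  ext p
  simp [MeasurableEquiv.prodCongr]

section FreqDev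

open Finset

lemma freqDev_sq_le {k : ℕ} {L : Type} [Fintype L] (lab : USq → L) (v : Fin k → USq) :
    freqDev lab v ^ 2 ≤ Fintype.card L * countDev lab v := by
  unfold freqDev countDev
  refine sq_sum_le_card_mul_sum_sq.trans_eq ?_
  rw [card_univ]
  congr 1
  refine sum_congr rfl fun s _ => ?_
  rw [sq_abs, natCast_card_filter]

end FreqDev

lemma exists_fin_of_isStep {r : ℕ} {V : USq → USq → ℝ} (h : IsStep r V) :
    ∃ (P : USq → Fin r) (B : Fin r → Fin r → ℝ), Measurable P ∧
      (∀ a b, B a b ∈ Set.Icc (0 : ℝ) 1) ∧ V = fun x y => B (P x) (P y) := by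
  obtain ⟨P, B, hP, hr, hB, rfl⟩ := h
  refine ⟨fun x => ⟨P x, hr x⟩, fun a b => B a b, measurable_to_countable' fun a => ?_,
    fun a b => hB a b, rfl⟩
  have : (fun x => (⟨P x, hr x⟩ : Fin r)) ⁻¹' {a} = P ⁻¹' {(a : ℕ)} := by
    ext x; simp [Fin.ext_iff]
  rw [this]
  exact hP (measurableSet_singleton _)

lemma csDist_le {W U : USq → USq → ℝ} {f : USq → USq} (hf : IsMPB f) {c : ℝ}
    (h : shiftOf f + cutNorm (fun u v => W u v - U (f u) (f v)) ≤ c) : csDist W U ≤ c := by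
  refine le_trans (csInf_le ⟨0, ?_⟩ ⟨f, hf, rfl⟩) h
  rintro x ⟨f, -, rfl⟩
  exact add_nonneg (Real.iSup_nonneg fun _ => abs_nonneg _) (cutNorm_nonneg _)

lemma abs_integral_le_of_eq_zero_off {E : USq × USq → ℝ} (hE : Measurable E) {A : Set USq}
    (hA : MeasurableSet A) (hb : ∀ p, |E p| ≤ 2) (h0 : ∀ p, p.1 ∉ A → p.2 ∉ A → E p = 0)
    (R : Set (USq × USq)) : |∫ p in R, E p| ≤ 4 * volume.real A := by
  have hm1 : MeasurableSet ((Prod.fst : USq × USq → USq) ⁻¹' A) := measurable_fst hA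
  have hm2 : MeasurableSet ((Prod.snd : USq × USq → USq) ⁻¹' A) := measurable_snd hA
  set φ : USq × USq → ℝ := fun p => (Prod.fst ⁻¹' A).indicator (fun _ => 2) p +
    (Prod.snd ⁻¹' A).indicator (fun _ => 2) p with hφ
  have hi1 : Integrable ((Prod.fst ⁻¹' A : Set (USq × USq)).indicator fun _ => (2 : ℝ)) :=
    (integrable_const 2).indicator hm1
  have hi2 : Integrable ((Prod.snd ⁻¹' A : Set (USq × USq)).indicator fun _ => (2 : ℝ)) :=
    (integrable_const 2).indicator hm2
  have hle : ∀ p, |E p| ≤ φ p := by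
    intro p
    by_cases h1 : p.1 ∈ A
    · have h2 : 0 ≤ (Prod.snd ⁻¹' A : Set (USq × USq)).indicator (fun _ => (2 : ℝ)) p :=
        Set.indicator_nonneg (fun _ _ => by norm_num) p
      have h3 : (Prod.fst ⁻¹' A : Set (USq × USq)).indicator (fun _ => (2 : ℝ)) p = 2 :=
        Set.indicator_of_mem (show p ∈ Prod.fst ⁻¹' A from h1) _
      have := hb p
      simp only [hφ]
      linarith
    · have h3 : 0 ≤ (Prod.fst ⁻¹' A : Set (USq × USq)).indicator (fun _ => (2 : ℝ)) p :=
        Set.indicator_nonneg (fun _ _ => by norm_num) p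
      by_cases h2 : p.2 ∈ A
      · have h4 : (Prod.snd ⁻¹' A : Set (USq × USq)).indicator (fun _ => (2 : ℝ)) p = 2 :=
          Set.indicator_of_mem (show p ∈ Prod.snd ⁻¹' A from h2) _
        have := hb p
        simp only [hφ]
        linarith
      · have h4 : 0 ≤ (Prod.snd ⁻¹' A : Set (USq × USq)).indicator (fun _ => (2 : ℝ)) p :=
          Set.indicator_nonneg (fun _ _ => by norm_num) p
        rw [h0 p h1 h2, abs_zero]
        exact add_nonneg h3 h4
  have hv1 : volume.real (Prod.fst ⁻¹' A : Set (USq × USq)) = volume.real A := by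
    rw [measureReal_def, measureReal_def, volume_square,
      measurePreserving_fst.measure_preimage hA.nullMeasurableSet]
  have hv2 : volume.real (Prod.snd ⁻¹' A : Set (USq × USq)) = volume.real A := by
    rw [measureReal_def, measureReal_def, volume_square,
      measurePreserving_snd.measure_preimage hA.nullMeasurableSet]
  have hEi : Integrable fun p => |E p| := (integrable_of_bdd hE hb).abs
  calc |∫ p in R, E p| ≤ ∫ p in R, |E p| := abs_integral_le_integral_abs
    _ ≤ ∫ p, |E p| := setIntegral_le_integral hEi (Eventually.of_forall fun _ => abs_nonneg _)
    _ ≤ ∫ p, φ p := integral_mono hEi (hi1.add hi2) hle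
    _ = 4 * volume.real A := by
      simp only [hφ]
      rw [integral_add hi1 hi2, integral_indicator hm1, integral_indicator hm2,
        setIntegral_const, setIntegral_const, hv1, hv2, smul_eq_mul]
      ring

lemma integral_sub_add_add_sub {α : Type*} [MeasurableSpace α] {μ : Measure α}
    {a b c d e : α → ℝ} (ha : Integrable a μ) (hb : Integrable b μ) (hc : Integrable c μ)
    (hd : Integrable d μ) (he : Integrable e μ) :
    ∫ x, (a x - b x + c x + d x - e x) ∂μ =
      (∫ x, a x ∂μ) - (∫ x, b x ∂μ) + (∫ x, c x ∂μ) + (∫ x, d x ∂μ) - ∫ x, e x ∂μ := by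
  have h1 : Integrable (fun x => a x - b x) μ := ha.sub hb
  have h2 : Integrable (fun x => a x - b x + c x) μ := h1.add hc
  have h3 : Integrable (fun x => a x - b x + c x + d x) μ := h2.add hd
  rw [integral_sub h3 he, integral_add h2 hd, integral_add h1 hc, integral_sub ha hb]

variable {k q r : ℕ} [NeZero q]

lemma csDist_le_of_samples (hk : 0 < k) {W U : USq → USq → ℝ} (hW : IsOrderon W)
    (hU : IsOrderon U) {P P' : USq → Fin r} (hP : Measurable P) (hP' : Measurable P')
    {B B' : Fin r → Fin r → ℝ} (hB : ∀ a b, B a b ∈ Set.Icc (0 : ℝ) 1)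
    (hB' : ∀ a b, B' a b ∈ Set.Icc (0 : ℝ) 1) {δ τ η : ℝ} (hδ : 0 ≤ δ) (hη : 0 < η)
    (hWV : fourCycle (fun x y => W x y - B (P x) (P y)) ≤ δ ^ 4)
    (hUV : fourCycle (fun x y => U x y - B' (P' x) (P' y)) ≤ δ ^ 4)
    {F : SimpleGraph (Fin k)} {v u : Fin k → USq} (hv : Monotone fun i => (v i).1)
    (hu : Monotone fun i => (u i).1)
    (hFv : matFourCycle (graphDiff F (pull (fun x y => B (P x) (P y)) v)) ≤ δ ^ 4)
    (hFu : matFourCycle (graphDiff F (pull (fun x y => B' (P' x) (P' y)) u)) ≤ δ ^ 4)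
    (hτ : freqDev (stripLabel q P) v ≤ τ) (hτ' : freqDev (stripLabel q P') u ≤ τ) :
    csDist W U ≤ 1 / q + 4 * δ + 4 * ((2 + 2 * q) * τ + η) := by
  obtain ⟨f, hf, hshift, ι, hι, hιv, hbad⟩ := exists_coupling hk hP hP' hv hu hη hτ hτ'
  have hfm := hf.1.measurable
  set A := {x | P x ≠ P (v (ι x)) ∨ P' (f x) ≠ P' (u (ι x))} with hAdef
  have hPv : Measurable fun x => P (v (ι x)) :=
    (measurable_of_countable fun i => P (v i)).comp hι
  have hPu : Measurable fun x => P' (u (ι x)) :=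
    (measurable_of_countable fun i => P' (u i)).comp hι
  have hPf : Measurable fun x => P' (f x) := hP'.comp hfm
  have hA : MeasurableSet A :=
    (measurableSet_eq_fun hP hPv).compl.union (measurableSet_eq_fun hPf hPu).compl
  refine csDist_le hf ?_
  have two : ∀ {B : Fin r → Fin r → ℝ} {Q : USq → Fin r}, Measurable Q →
      Measurable fun p : USq × USq => B (Q p.1) (Q p.2) := by
    intro B Q hQ
    exact (measurable_of_countable (Function.uncurry B)).comp
      ((hQ.comp measurable_fst).prodMk (hQ.comp measurable_snd))
  have dif : ∀ D : Fin k → Fin k → ℝ, Measurable fun p : USq × USq => D (ι p.1) (ι p.2) := by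
    intro D
    exact (measurable_of_countable (Function.uncurry D)).comp
      ((hι.comp measurable_fst).prodMk (hι.comp measurable_snd))
  set Dv := graphDiff F (pull (fun x y => B (P x) (P y)) v) with hDv
  set Du := graphDiff F (pull (fun x y => B' (P' x) (P' y)) u) with hDu
  have kWV : IsKer fun x y => W x y - B (P x) (P y) :=
    IsKer.sub_of_mem hW.1 (two hP) hW.2.1 fun _ _ => hB _ _
  have kUV : IsKer fun x y => U x y - B' (P' x) (P' y) :=
    IsKer.sub_of_mem hU.1 (two hP') hU.2.1 fun _ _ => hB' _ _
  have kv : IsKer fun x y => Dv (ι x) (ι y) :=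
    ⟨dif Dv, fun x y => abs_graphDiff_le F (fun _ _ => hB _ _) _ _⟩
  have ku : IsKer fun x y => Du (ι x) (ι y) :=
    ⟨dif Du, fun x y => abs_graphDiff_le F (fun _ _ => hB' _ _) _ _⟩
  have hffm : Measurable fun p : USq × USq => (f p.1, f p.2) :=
    (hfm.comp measurable_fst).prodMk (hfm.comp measurable_snd)
  set E : USq × USq → ℝ := fun p => (B (P p.1) (P p.2) - B (P (v (ι p.1))) (P (v (ι p.2)))) +
    (B' (P' (u (ι p.1))) (P' (u (ι p.2))) - B' (P' (f p.1)) (P' (f p.2))) with hE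
  have hEm : Measurable E := ((two hP).sub (two hPv)).add ((two hPu).sub (two hPf))
  have hEb : ∀ p, |E p| ≤ 2 := by
    intro p
    have h1 := hB (P p.1) (P p.2)
    have h2 := hB (P (v (ι p.1))) (P (v (ι p.2)))
    have h3 := hB' (P' (u (ι p.1))) (P' (u (ι p.2)))
    have h4 := hB' (P' (f p.1)) (P' (f p.2))
    simp only [Set.mem_Icc] at h1 h2 h3 h4
    simp only [hE]
    rw [abs_le]
    constructor <;> linarith
  have hE0 : ∀ p, p.1 ∉ A → p.2 ∉ A → E p = 0 := by
    intro p h1 h2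
    simp only [hAdef, Set.mem_ofPred_eq, not_or, not_not] at h1 h2
    simp only [hE]
    rw [← h1.1, ← h1.2, ← h2.1, ← h2.2]
    ring
  have hcut : cutNorm (fun x y => W x y - U (f x) (f y)) ≤ 4 * δ + 4 * volume.real A := by
    refine cutNorm_le fun S T hS hT => ?_
    have i1 : Integrable (fun p : USq × USq => W p.1 p.2 - B (P p.1) (P p.2))
        (volume.restrict (S ×ˢ T)) := integrable_of_bdd kWV.1 fun p => kWV.2 p.1 p.2
    have i2 : Integrable (fun p : USq × USq => Dv (ι p.1) (ι p.2))
        (volume.restrict (S ×ˢ T)) := integrable_of_bdd kv.1 fun p => kv.2 p.1 p.2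
    have i3 : Integrable E (volume.restrict (S ×ˢ T)) := integrable_of_bdd hEm hEb
    have i4 : Integrable (fun p : USq × USq => Du (ι p.1) (ι p.2))
        (volume.restrict (S ×ˢ T)) := integrable_of_bdd ku.1 fun p => ku.2 p.1 p.2
    have i5 : Integrable (fun p : USq × USq =>
        U (f p.1) (f p.2) - B' (P' (f p.1)) (P' (f p.2))) (volume.restrict (S ×ˢ T)) :=
      integrable_of_bdd (kUV.1.comp hffm) fun p => kUV.2 _ _
    have hsplit : ∫ p in S ×ˢ T, (W p.1 p.2 - U (f p.1) (f p.2)) =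
        (∫ p in S ×ˢ T, (W p.1 p.2 - B (P p.1) (P p.2))) -
        (∫ p in S ×ˢ T, Dv (ι p.1) (ι p.2)) + (∫ p in S ×ˢ T, E p) +
        (∫ p in S ×ˢ T, Du (ι p.1) (ι p.2)) -
        ∫ p in S ×ˢ T, (U (f p.1) (f p.2) - B' (P' (f p.1)) (P' (f p.2))) := by
      rw [← integral_sub_add_add_sub i1 i2 i3 i4 i5]
      congr 1
      ext p
      simp only [hDv, hDu, hE, graphDiff, pull]
      ring
    have b1 := kWV.abs_setIntegral_le_of_fourCycle hδ hWV hS hT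
    have b2 := kv.abs_setIntegral_le_of_fourCycle hδ
      ((fourCycle_comp_slot hι hιv Dv).trans_le hFv) hS hT
    have b3 := abs_integral_le_of_eq_zero_off hEm hA hEb hE0 (S ×ˢ T)
    have b4 := ku.abs_setIntegral_le_of_fourCycle hδ
      ((fourCycle_comp_slot hι hιv Du).trans_le hFu) hS hT
    obtain ⟨S', T', hS', hT', h'⟩ := exists_setIntegral_comp_eq hf
      (fun x y => U x y - B' (P' x) (P' y)) hS hT
    have b5 := kUV.abs_setIntegral_le_of_fourCycle hδ hUV hS' hT'
    rw [← h'] at b5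
    rw [hsplit]
    rw [abs_le] at b1 b2 b3 b4 b5 ⊢
    constructor <;> linarith
  linarith

lemma freqDev_le_of_countDev {k : ℕ} {L : Type} [Fintype L] {lab : USq → L} {v : Fin k → USq}
    {τ θ c : ℝ} (hτ : 0 < τ) (hθ : 0 < θ) (hc : c = (Fintype.card L + 1) * θ / τ ^ 2)
    (h : c * countDev lab v ≤ θ) : freqDev lab v ≤ τ := by
  have h0 := countDev_nonneg lab v
  refine le_of_sq_le_sq ?_ hτ.le
  have h1 : (Fintype.card L + 1) * countDev lab v ≤ τ ^ 2 := by
    rw [hc, div_mul_eq_mul_div, div_le_iff₀ (by positivity)] at h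
    have h' : θ * ((Fintype.card L + 1) * countDev lab v) ≤ θ * τ ^ 2 := by linarith
    exact le_of_mul_le_mul_left h' hθ
  have := freqDev_sq_le lab v
  nlinarith

lemma exists_sum_abs_sub_le {ι : Type*} [Fintype ι] {h : ι → ℕ → ℝ}
    (hh : ∀ i, ∃ L, Tendsto (h i) atTop (nhds L)) {e : ℝ} (he : 0 < e) :
    ∃ N, ∀ m n, N ≤ m → N ≤ n → ∑ i, |h i m - h i n| ≤ e := by
  choose L hL using hh
  have h1 : Tendsto (fun n => ∑ i, |h i n - L i|) atTop (nhds 0) := by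
    have : Tendsto (fun n => ∑ i, |h i n - L i|) atTop (nhds (∑ i, |L i - L i|)) :=
      tendsto_finsetSum _ fun i _ => ((hL i).sub_const (L i)).abs
    simpa using this
  obtain ⟨N, hN⟩ := eventually_atTop.1 (h1.eventually (gt_mem_nhds (half_pos he)))
  refine ⟨N, fun m n hm hn => ?_⟩
  have h2 : ∑ i, |h i m - h i n| ≤ ∑ i, |h i m - L i| + ∑ i, |h i n - L i| := by
    rw [← Finset.sum_add_distrib]
    refine Finset.sum_le_sum fun i _ => ?_
    rw [abs_sub_comm (h i n)]
    exact abs_sub_le _ _ _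
  linarith [hN m hm, hN n hn]

lemma cauchy_of_densities_converge {W : ℕ → USq → USq → ℝ} (hW : ∀ n, IsOrderon (W n))
    (h : ∀ (k : ℕ) (F : SimpleGraph (Fin k)), ∃ L : ℝ,
      Tendsto (fun n => homDensity F (W n)) atTop (nhds L)) {ε : ℝ} (hε : 0 < ε) :
    ∃ N : ℕ, ∀ m n : ℕ, N ≤ m → N ≤ n → csDist (W m) (W n) < ε := by
  obtain ⟨q, hq⟩ := exists_nat_gt (8 / ε)
  have hq0 : (0 : ℝ) < q := lt_trans (by positivity) hq
  have : NeZero q := ⟨by rintro rfl; simp at hq0⟩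
  set δ := ε / 32 with hδ
  set τ := ε / (64 * (1 + q)) with hτ
  set θ := δ ^ 4 with hθ
  have hδ0 : 0 < δ := by positivity
  have hτ0 : 0 < τ := by positivity
  have hθ0 : 0 < θ := by positivity
  obtain ⟨r, hr⟩ := exists_step_approx (ε := θ / 8) (by positivity)
  choose V hV hWV using fun n => hr (W n) (hW n)
  choose P B hP hB hVB using fun n => exists_fin_of_isStep (hV n)
  set c : ℝ := (Fintype.card (Fin q × Fin r) + 1) * θ / τ ^ 2 with hc
  have hc0 : 0 ≤ c := by positivity
  obtain ⟨k, hk⟩ := exists_nat_gt ((6 + c * Fintype.card (Fin q × Fin r)) / (θ / 8))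
  have hk0 : (0 : ℝ) < k := lt_of_le_of_lt (by positivity) hk
  have hk1 : 0 < k := by exact_mod_cast hk0
  have htyp : ∀ n, ∑ F : SimpleGraph (Fin k),
      (if IsTypical (V n) (stripLabel q (P n)) c θ F then 0 else homDensity F (W n)) ≤ 1 / 4 := by
    intro n
    refine sum_not_typical_le (hW n) (hV n).measurable (hV n).mem
      (measurable_stripLabel (hP n)) hc0 hθ0 hk1 ?_
    have h1 := hWV n
    have h2 : 6 / (k : ℝ) + c * (Fintype.card (Fin q × Fin r) / k) ≤ θ / 8 := by
      rw [mul_div_assoc', ← add_div, div_le_iff₀ hk0]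
      rw [div_lt_iff₀ (by positivity)] at hk
      linarith
    linarith
  obtain ⟨N, hN⟩ := exists_sum_abs_sub_le (h k) (e := 1 / 4) (by norm_num)
  refine ⟨N, fun m n hm hn => ?_⟩
  obtain ⟨F, ⟨v, hv, hv'⟩, u, hu, hu'⟩ :=
    exists_common_typical (hW m) (hW n) (htyp m) (htyp n) (hN m n hm hn)
  have split : ∀ {n} {v : Fin k → USq},
      sampleError (V n) (stripLabel q (P n)) c v F ≤ θ →
      matFourCycle (graphDiff F (pull (V n) v)) ≤ δ ^ 4 ∧ freqDev (stripLabel q (P n)) v ≤ τ := by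
    intro n v hs
    unfold sampleError at hs
    have h1 := matFourCycle_nonneg (graphDiff F (pull (V n) v))
    have h2 := mul_nonneg hc0 (countDev_nonneg (stripLabel q (P n)) v)
    exact ⟨by linarith, freqDev_le_of_countDev hτ0 hθ0 hc (by linarith)⟩
  obtain ⟨a1, a2⟩ := split hv'
  obtain ⟨b1, b2⟩ := split hu'
  have e1 := (hWV m).trans (by linarith : θ / 8 ≤ δ ^ 4)
  have e2 := (hWV n).trans (by linarith : θ / 8 ≤ δ ^ 4)
  rw [hVB m] at a1 e1
  rw [hVB n] at b1 e2
  have key := csDist_le_of_samples hk1 (hW m) (hW n) (hP m) (hP n) (hB m) (hB n) hδ0.le hδ0 e1 e2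
    hv hu a1 b1 a2 b2
  have h3 : 1 / (q : ℝ) < ε / 8 := by
    rw [div_lt_iff₀ hε] at hq
    rw [div_lt_iff₀ hq0]
    linarith
  have h4 : (2 + 2 * (q : ℝ)) * τ = ε / 32 := by
    rw [hτ]; field_simp; norm_num
  rw [h4] at key
  linarith

section Resampling

variable {k : ℕ}

lemma measurePreserving_update (i : Fin k) :
    MeasurePreserving (fun q : (Fin k → USq) × USq => Function.update q.1 i q.2)
      (volume.prod volume) volume := by
  have hm : Measurable fun q : (Fin k → USq) × USq => Function.update q.1 i q.2 := by
    refine measurable_pi_lambda _ fun j => ?_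
    rcases eq_or_ne j i with rfl | h
    · simpa using measurable_snd
    · simp only [Function.update_of_ne h]
      exact (measurable_pi_apply j).comp measurable_fst
  refine ⟨hm, ?_⟩
  rw [volume_pi]
  refine (Measure.pi_eq fun s hs => ?_).symm
  rw [Measure.map_apply hm (MeasurableSet.univ_pi hs)]
  have : (fun q : (Fin k → USq) × USq => Function.update q.1 i q.2) ⁻¹' Set.univ.pi s =
      Set.univ.pi (Function.update s i Set.univ) ×ˢ s i := by
    ext q
    simp only [Set.mem_preimage, Set.mem_univ_pi, Set.mem_prod]
    constructor
    · refine fun h => ⟨fun j => ?_, by simpa using h i⟩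
      rcases eq_or_ne j i with rfl | hj
      · simp
      · simpa [Function.update_of_ne hj] using h j
    · rintro ⟨h, h'⟩ j
      rcases eq_or_ne j i with rfl | hj
      · simpa using h'
      · simpa [Function.update_of_ne hj] using h j
  rw [this, Measure.prod_prod, Measure.pi_pi,
    ← Finset.prod_erase_mul _ _ (Finset.mem_univ i),
    ← Finset.prod_erase_mul Finset.univ (fun i => volume (s i)) (Finset.mem_univ i)]
  simp only [Function.update_self, measure_univ, mul_one]
  congr 1
  refine Finset.prod_congr rfl fun j hj => ?_
  rw [Function.update_of_ne (Finset.ne_of_mem_erase hj)]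

lemma integral_eq_integral_update (i : Fin k) {G : (Fin k → USq) → ℝ} (hG : Measurable G) {C : ℝ}
    (hb : ∀ v, |G v| ≤ C) : ∫ v, G v = ∫ v, ∫ x, G (Function.update v i x) := by
  have h := measurePreserving_update i
  have hintg : Integrable (fun q : (Fin k → USq) × USq => G (Function.update q.1 i q.2))
      (volume.prod volume) := integrable_of_bdd (hG.comp h.measurable) fun _ => hb _
  rw [← integral_prod _ hintg, ← integral_map (φ := fun q : (Fin k → USq) × USq =>
    Function.update q.1 i q.2) h.measurable.aemeasurable hG.aestronglyMeasurable, h.map_eq]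

lemma measurable_update_pair (i : Fin k) :
    Measurable fun q : (Fin k → USq) × USq => Function.update q.1 i q.2 :=
  (measurePreserving_update i).measurable

/-- If `φ` ignores the coordinate `j` and `ψ` ignores the coordinate `i`, then integrating a
kernel in the coordinates `i, j` against `φ * ψ` is controlled by its rank-one tests. -/
lemma abs_integral_pair_le {K : USq → USq → ℝ} (hK : IsKer K) {c : ℝ}
    (hc : ∀ f g : USq → ℝ, Measurable f → Measurable g → (∀ x, |f x| ≤ 1) → (∀ x, |g x| ≤ 1) →
      |∫ p : USq × USq, K p.1 p.2 * (f p.1 * g p.2)| ≤ c) {i j : Fin k} (hij : i ≠ j)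
    {φ ψ : (Fin k → USq) → ℝ} (hφ : Measurable φ) (hψ : Measurable ψ) (hφ1 : ∀ v, |φ v| ≤ 1)
    (hψ1 : ∀ v, |ψ v| ≤ 1) (hφj : ∀ v y, φ (Function.update v j y) = φ v)
    (hψi : ∀ v x, ψ (Function.update v i x) = ψ v) :
    |∫ v : Fin k → USq, K (v i) (v j) * (φ v * ψ v)| ≤ c := by
  have hKm : Measurable fun v : Fin k → USq => K (v i) (v j) :=
    hK.1.comp (f := fun v : Fin k → USq => (v i, v j))
      ((measurable_pi_apply i).prodMk (measurable_pi_apply j))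
  have hG : Measurable fun v : Fin k → USq => K (v i) (v j) * (φ v * ψ v) :=
    hKm.mul (hφ.mul hψ)
  have hb : ∀ {a b c : ℝ}, |a| ≤ 1 → |b| ≤ 1 → |c| ≤ 1 → |a * (b * c)| ≤ 1 := by
    intro a b c ha hb hc
    rw [abs_mul, abs_mul]
    exact mul_le_one₀ ha (by positivity) (mul_le_one₀ hb (abs_nonneg _) hc)
  rw [integral_eq_integral_update j hG fun v => hb (hK.2 _ _) (hφ1 v) (hψ1 v),
    integral_eq_integral_update i (C := 1)
      (G := fun v => ∫ y, K (Function.update v j y i) (Function.update v j y j) *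
        (φ (Function.update v j y) * ψ (Function.update v j y)))
      (measurable_integral_right (f := fun v y => K (Function.update v j y i)
        (Function.update v j y j) * (φ (Function.update v j y) * ψ (Function.update v j y)))
        (hG.comp (measurable_update_pair j)))
      fun v => abs_integral_le_of_bdd fun y => hb (hK.2 _ _) (hφ1 _) (hψ1 _)]
  refine abs_integral_le_of_bdd fun v => ?_
  have h := hc (fun x => φ (Function.update v i x)) (fun y => ψ (Function.update v j y))
    (hφ.comp (measurable_update v)) (hψ.comp (measurable_update v)) (fun _ => hφ1 _)
    fun _ => hψ1 _
  rw [volume_square, integral_prod] at h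
  · convert h using 2
    refine integral_congr_ae (Eventually.of_forall fun x => integral_congr_ae
      (Eventually.of_forall fun y => ?_))
    simp only [Function.update_self, Function.update_of_ne hij, hφj]
    rw [Function.update_comm hij, hψi]
  · refine integrable_of_bdd (C := 1) ?_ fun p => hb (hK.2 _ _) (hφ1 _) (hψ1 _)
    refine Measurable.mul hK.1 (Measurable.mul ?_ ?_)
    · exact (hφ.comp (measurable_update v)).comp measurable_fst
    · exact (hψ.comp (measurable_update v)).comp measurable_snd

end Resampling

section Counting

open Finset

variable {k : ℕ}

/-- The product of the kernels `w p` over the pairs `p ∈ T` of coordinates. -/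
def pairProd (T : Finset (Fin k × Fin k)) (w : Fin k × Fin k → USq → USq → ℝ)
    (v : Fin k → USq) : ℝ :=
  ∏ p ∈ T, w p (v p.1) (v p.2)

lemma measurable_pairProd (T : Finset (Fin k × Fin k)) {w : Fin k × Fin k → USq → USq → ℝ}
    (hw : ∀ p, Measurable (Function.uncurry (w p))) : Measurable (pairProd T w) := by
  refine Finset.measurable_prod _ fun p _ => ?_
  exact (hw p).comp (f := fun v : Fin k → USq => (v p.1, v p.2))
    ((measurable_pi_apply p.1).prodMk (measurable_pi_apply p.2))

lemma abs_pairProd_le (T : Finset (Fin k × Fin k)) {w : Fin k × Fin k → USq → USq → ℝ}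
    (hw : ∀ p x y, w p x y ∈ Set.Icc (0 : ℝ) 1) (v : Fin k → USq) : |pairProd T w v| ≤ 1 := by
  unfold pairProd
  rw [abs_of_nonneg (prod_nonneg fun p _ => (hw p _ _).1)]
  exact prod_le_one (fun p _ => (hw p _ _).1) fun p _ => (hw p _ _).2

lemma pairProd_update {T : Finset (Fin k × Fin k)} {j : Fin k}
    (h : ∀ p ∈ T, p.1 ≠ j ∧ p.2 ≠ j) (w : Fin k × Fin k → USq → USq → ℝ) (v : Fin k → USq)
    (y : USq) : pairProd T w (Function.update v j y) = pairProd T w v :=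
  prod_congr rfl fun p hp => by
    rw [Function.update_of_ne (h p hp).1, Function.update_of_ne (h p hp).2]

lemma abs_integral_pairProd_sub_le {s : Finset (Fin k × Fin k)} (hs : ∀ p ∈ s, p.1 < p.2)
    {g h : Fin k × Fin k → USq → USq → ℝ} (hg : ∀ p, Measurable (Function.uncurry (g p)))
    (hh : ∀ p, Measurable (Function.uncurry (h p)))
    (hg' : ∀ p x y, g p x y ∈ Set.Icc (0 : ℝ) 1) (hh' : ∀ p x y, h p x y ∈ Set.Icc (0 : ℝ) 1)
    {c : ℝ} (hc : ∀ p, ∀ a b : USq → ℝ, Measurable a → Measurable b → (∀ x, |a x| ≤ 1) →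
      (∀ x, |b x| ≤ 1) →
      |∫ q : USq × USq, (g p q.1 q.2 - h p q.1 q.2) * (a q.1 * b q.2)| ≤ c) :
    |(∫ v, pairProd s g v) - ∫ v, pairProd s h v| ≤ #s * c := by
  set w : Finset (Fin k × Fin k) → Fin k × Fin k → USq → USq → ℝ :=
    fun A p => if p ∈ A then g p else h p with hwdef
  have hwm : ∀ A p, Measurable (Function.uncurry (w A p)) := by
    intro A p
    simp only [hwdef]
    split_ifs
    exacts [hg p, hh p]
  have hwb : ∀ A p x y, w A p x y ∈ Set.Icc (0 : ℝ) 1 := by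
    intro A p
    simp only [hwdef]
    split_ifs
    exacts [hg' p, hh' p]
  have key : ∀ A ⊆ s, |(∫ v, pairProd s (w A) v) - ∫ v, pairProd s h v| ≤ #A * c := by
    intro A
    induction A using Finset.induction_on with
    | empty => intro _; simp [hwdef]
    | insert e A he ih =>
      intro hsub
      have hes : e ∈ s := hsub (mem_insert_self _ _)
      have hlt := hs e hes
      have ih := ih ((subset_insert _ _).trans hsub)
      set T₁ := (s.erase e).filter fun p => ¬ (p.1 = e.2 ∨ p.2 = e.2) with hT₁
      set T₂ := (s.erase e).filter fun p => p.1 = e.2 ∨ p.2 = e.2 with hT₂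
      have hT₁' : ∀ p ∈ T₁, p.1 ≠ e.2 ∧ p.2 ≠ e.2 := fun p hp =>
        not_or.1 (mem_filter.1 hp).2
      have hT₂' : ∀ p ∈ T₂, p.1 ≠ e.1 ∧ p.2 ≠ e.1 := by
        intro p hp
        obtain ⟨hp1, hp2⟩ := mem_filter.1 hp
        have hp3 := hs p (mem_of_mem_erase hp1)
        have hp4 := ne_of_mem_erase hp1
        constructor
        · intro h1
          rcases hp2 with h2 | h2
          · exact hlt.ne (h1.symm.trans h2)
          · exact hp4 (Prod.ext h1 h2)
        · intro h1
          rcases hp2 with h2 | h2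
          · rw [h1, h2] at hp3
            exact lt_asymm hlt hp3
          · exact hlt.ne (h1.symm.trans h2)
      have hrest : ∀ v, pairProd (s.erase e) (w A) v = pairProd T₁ (w A) v * pairProd T₂ (w A) v :=
        fun v => by
          unfold pairProd
          rw [mul_comm]
          exact (prod_filter_mul_prod_filter_not _ _ _).symm
      have e1 : ∀ v, pairProd s (w (insert e A)) v =
          g e (v e.1) (v e.2) * (pairProd T₁ (w A) v * pairProd T₂ (w A) v) := by
        intro v
        rw [← hrest]
        unfold pairProd
        rw [← mul_prod_erase s _ hes]
        congr 1
        · simp [hwdef]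
        · refine prod_congr rfl fun p hp => ?_
          simp only [hwdef, mem_insert, ne_of_mem_erase hp, false_or]
      have e2 : ∀ v, pairProd s (w A) v =
          h e (v e.1) (v e.2) * (pairProd T₁ (w A) v * pairProd T₂ (w A) v) := by
        intro v
        rw [← hrest]
        unfold pairProd
        rw [← mul_prod_erase s _ hes]
        congr 1
        simp [hwdef, he]
      have hintg : ∀ A, Integrable (fun v => pairProd s (w A) v) volume := fun A =>
        integrable_of_bdd (measurable_pairProd s (hwm A)) (abs_pairProd_le s (hwb A))
      have e3 : (∫ v, pairProd s (w (insert e A)) v) - ∫ v, pairProd s (w A) v =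
          ∫ v : Fin k → USq, (g e (v e.1) (v e.2) - h e (v e.1) (v e.2)) *
            (pairProd T₁ (w A) v * pairProd T₂ (w A) v) := by
        rw [← integral_sub (hintg _) (hintg _)]
        congr 1
        ext v
        rw [e1, e2, sub_mul]
      have e4 := abs_integral_pair_le (K := fun x y => g e x y - h e x y)
        (IsKer.sub_of_mem (hg e) (hh e) (hg' e) (hh' e)) (hc e) hlt.ne
        (measurable_pairProd T₁ (hwm A)) (measurable_pairProd T₂ (hwm A))
        (abs_pairProd_le T₁ (hwb A)) (abs_pairProd_le T₂ (hwb A))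
        (pairProd_update hT₁' (w A)) (pairProd_update hT₂' (w A))
      rw [← e3] at e4
      rw [card_insert_of_notMem he]
      push_cast
      have e5 := abs_sub_le (∫ v, pairProd s (w (insert e A)) v) (∫ v, pairProd s (w A) v)
        (∫ v, pairProd s h v)
      linarith
  have h1 : ∫ v, pairProd s (w s) v = ∫ v, pairProd s g v := by
    congr 1
    ext v
    exact prod_congr rfl fun p hp => by simp only [hwdef, if_pos hp]
  have h2 := key s subset_rfl
  rwa [h1] at h2

end Counting

lemma abs_integral_near_le {E : USq × USq → ℝ} (hE : Measurable E) (hb : ∀ p, |E p| ≤ 1) {δ : ℝ}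
    (hδ : 0 ≤ δ) (h0 : ∀ p, E p ≠ 0 → |(p.2.1 : ℝ) - p.1.1| ≤ δ) : |∫ p, E p| ≤ 2 * δ := by
  have hm : MeasurableSet {p : USq × USq | |(p.2.1 : ℝ) - p.1.1| ≤ δ} := by
    refine measurableSet_le ?_ measurable_const
    fun_prop
  refine le_trans abs_integral_le_integral_abs (le_trans ?_ (volume_near_pair_le hδ))
  rw [← integral_indicator_one hm]
  refine integral_mono (integrable_of_bdd hE hb).abs ((integrable_const (1 : ℝ)).indicator hm)
    fun p => ?_
  by_cases h : E p = 0
  · simp only [h, abs_zero]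
    exact Set.indicator_nonneg (fun _ _ => zero_le_one) p
  · rw [Set.indicator_of_mem (show p ∈ {p : USq × USq | |(p.2.1 : ℝ) - p.1.1| ≤ δ} from h0 p h)]
    exact hb p

/-- Indicator of the first coordinates being in order. -/
def leInd (x y : USq) : ℝ := if (x.1 : ℝ) ≤ (y.1 : ℝ) then 1 else 0

lemma measurable_leInd : Measurable (Function.uncurry leInd) := by
  unfold leInd
  refine Measurable.ite (measurableSet_le ?_ ?_) measurable_const measurable_const <;> fun_prop

lemma leInd_mem (x y : USq) : leInd x y ∈ Set.Icc (0 : ℝ) 1 := by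
  unfold leInd; split_ifs <;> norm_num

lemma IsKer.abs_integral_prod_le {K : USq → USq → ℝ} (hK : IsKer K) {a b : USq → ℝ}
    (ha : Measurable a) (hb : Measurable b) (ha1 : ∀ x, |a x| ≤ 1) (hb1 : ∀ x, |b x| ≤ 1) :
    |∫ p : USq × USq, K p.1 p.2 * (a p.1 * b p.2)| ≤ 4 * cutNorm K := by
  refine le_trans (le_of_eq ?_) (hK.abs_integral_le hb ha1 hb1)
  rw [volume_square, integral_prod]
  · congr 1
    refine integral_congr_ae (Eventually.of_forall fun x => ?_)
    simp only
    rw [← integral_mul_const]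
    congr 1
    ext y
    ring
  · refine integrable_of_bdd (C := 1) ?_ fun p => ?_
    · exact Measurable.mul hK.1 ((ha.comp measurable_fst).mul (hb.comp measurable_snd))
    · rw [abs_mul, abs_mul]
      exact mul_le_one₀ (hK.2 _ _) (by positivity) (mul_le_one₀ (ha1 _) (abs_nonneg _) (hb1 _))

lemma IsKer.abs_integral_leInd_le {K : USq → USq → ℝ} (hK : IsKer K) (q : ℕ) [NeZero q]
    {a b : USq → ℝ} (ha : Measurable a) (hb : Measurable b) (ha1 : ∀ x, |a x| ≤ 1)
    (hb1 : ∀ x, |b x| ≤ 1) :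
    |∫ p : USq × USq, K p.1 p.2 * leInd p.1 p.2 * (a p.1 * b p.2)| ≤
      4 * q * cutNorm K + 2 / q := by
  have hq0 : (0 : ℝ) < q := by exact_mod_cast Nat.pos_of_neZero q
  set C : USq → Fin q := fun x => cellIx q x.1 with hC
  have hCm : Measurable C := (measurable_cellIx q).comp measurable_fst
  set a' : Fin q → USq → ℝ := fun t x => if C x = t then a x else 0 with ha'
  set b' : Fin q → USq → ℝ := fun t x => if t < C x then b x else 0 with hb'
  have ham : ∀ t, Measurable (a' t) := fun t =>
    Measurable.ite (hCm (measurableSet_singleton t)) ha measurable_const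
  have hbm : ∀ t, Measurable (b' t) := fun t =>
    Measurable.ite (hCm (measurableSet_Ioi (a := t))) hb measurable_const
  have ham1 : ∀ t x, |a' t x| ≤ 1 := by
    intro t x; simp only [ha']; split_ifs; exacts [ha1 x, by simp]
  have hbm1 : ∀ t x, |b' t x| ≤ 1 := by
    intro t x; simp only [hb']; split_ifs; exacts [hb1 x, by simp]
  set E : USq × USq → ℝ := fun p =>
    if C p.1 = C p.2 then K p.1 p.2 * leInd p.1 p.2 * (a p.1 * b p.2) else 0 with hE
  have habs : ∀ {u v w z : ℝ}, |u| ≤ 1 → |v| ≤ 1 → |w| ≤ 1 → |z| ≤ 1 →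
      |u * v * (w * z)| ≤ 1 := by
    intro u v w z hu hv hw hz
    rw [abs_mul, abs_mul, abs_mul]
    exact mul_le_one₀ (mul_le_one₀ hu (abs_nonneg _) hv) (by positivity)
      (mul_le_one₀ hw (abs_nonneg _) hz)
  have hle1 : ∀ x y, |leInd x y| ≤ 1 := fun x y => by
    rw [abs_of_nonneg (leInd_mem x y).1]; exact (leInd_mem x y).2
  have hEm : Measurable E := by
    refine Measurable.ite (measurableSet_eq_fun (hCm.comp measurable_fst)
      (hCm.comp measurable_snd)) ?_ measurable_const
    exact (Measurable.mul hK.1 measurable_leInd).mul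
      ((ha.comp measurable_fst).mul (hb.comp measurable_snd))
  have hEb : ∀ p, |E p| ≤ 1 := by
    intro p
    simp only [hE]
    split_ifs
    exacts [habs (hK.2 _ _) (hle1 _ _) (ha1 _) (hb1 _), by simp]
  have hEn : |∫ p, E p| ≤ 2 * (1 / q) := by
    refine abs_integral_near_le hEm hEb (by positivity) fun p hp => ?_
    have hCp : C p.1 = C p.2 := by
      by_contra h
      exact hp (if_neg h)
    have h1 := cellIx_le q p.1.1
    have h2 := le_cellIx_add_one q p.1.1
    have h3 := cellIx_le q p.2.1
    have h4 := le_cellIx_add_one q p.2.1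
    simp only [hC] at hCp
    rw [hCp] at h1 h2
    have h5 : |((p.2.1 : ℝ) - p.1.1) * q| ≤ 1 := abs_le.2 ⟨by linarith, by linarith⟩
    rwa [abs_mul, abs_of_pos hq0, ← le_div_iff₀ hq0] at h5
  have hpt : ∀ p : USq × USq, K p.1 p.2 * leInd p.1 p.2 * (a p.1 * b p.2) =
      ∑ t, K p.1 p.2 * (a' t p.1 * b' t p.2) + E p := by
    intro p
    rw [Finset.sum_eq_single (C p.1) (fun t _ ht => by simp [ha', ht.symm]) (by simp)]
    simp only [ha', hb', hE, if_true]
    rcases lt_trichotomy (C p.1) (C p.2) with h | h | h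
    · have h1 : (p.1.1 : ℝ) ≤ p.2.1 := by
        by_contra hcon
        exact absurd (cellIx_mono q (Subtype.coe_le_coe.1 (not_le.1 hcon).le)) (not_le.2 h)
      rw [if_pos h, if_neg h.ne, leInd, if_pos h1]
      ring
    · rw [if_neg h.not_lt, if_pos h]
      ring
    · have h1 : ¬ (p.1.1 : ℝ) ≤ p.2.1 := fun hcon =>
        absurd (cellIx_mono q (Subtype.coe_le_coe.1 hcon)) (not_le.2 h)
      rw [if_neg h.not_gt, if_neg h.ne', leInd, if_neg h1]
      ring
  have hintg : ∀ t, Integrable fun p : USq × USq => K p.1 p.2 * (a' t p.1 * b' t p.2) := by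
    intro t
    refine integrable_of_bdd (C := 1) ?_ fun p => ?_
    · exact Measurable.mul hK.1 (((ham t).comp measurable_fst).mul ((hbm t).comp measurable_snd))
    · have := habs (hK.2 p.1 p.2) (v := 1) (by simp) (ham1 t p.1) (hbm1 t p.2)
      rwa [mul_one] at this
  simp only [hpt]
  rw [integral_add (integrable_finsetSum _ fun t _ => hintg t) (integrable_of_bdd hEm hEb),
    integral_finsetSum _ fun t _ => hintg t]
  refine (abs_add_le _ _).trans (add_le_add ?_ (hEn.trans_eq (by ring)))
  refine (Finset.abs_sum_le_sum_abs _ _).trans ?_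
  refine (Finset.sum_le_sum fun t _ =>
    hK.abs_integral_prod_le (ham t) (hbm t) (ham1 t) (hbm1 t)).trans_eq ?_
  rw [Finset.sum_const, Finset.card_univ, Fintype.card_fin, nsmul_eq_mul]
  ring

lemma abs_fst_sub_le_shiftOf (f : USq → USq) (x : USq) :
    |(x.1 : ℝ) - ((f x).1 : ℝ)| ≤ shiftOf f := by
  refine le_ciSup (f := fun u : USq => |(u.1 : ℝ) - ((f u).1 : ℝ)|) ⟨1, ?_⟩ x
  rintro _ ⟨u, rfl⟩
  have h1 := u.1.2
  have h2 := (f u).1.2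
  simp only [Set.mem_Icc] at h1 h2
  exact abs_le.2 ⟨by linarith, by linarith⟩

variable {k : ℕ}

/-- The factor contributed to a density by a pair: `w` for an edge, `1 - w` for a non-edge,
times the indicator of the pair being in order. -/
def pairFactor (F : SimpleGraph (Fin k)) (W : USq → USq → ℝ) (p : Fin k × Fin k) (x y : USq) : ℝ :=
  (if F.Adj p.1 p.2 then W x y else 1 - W x y) * leInd x y

lemma homDensity_eq_pairProd (F : SimpleGraph (Fin k)) (W : USq → USq → ℝ) :
    homDensity F W = k.factorial * ∫ v : Fin k → USq,
      pairProd (Finset.univ.filter fun p : Fin k × Fin k => p.1 < p.2) (pairFactor F W) v := rfl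

variable {W U : USq → USq → ℝ}

lemma measurable_edgeFactor (hW : IsOrderon W) (F : SimpleGraph (Fin k)) (p : Fin k × Fin k) :
    Measurable fun z : USq × USq => if F.Adj p.1 p.2 then W z.1 z.2 else 1 - W z.1 z.2 := by
  split_ifs
  exacts [hW.1, hW.1.const_sub 1]

lemma measurable_pairFactor (hW : IsOrderon W) (F : SimpleGraph (Fin k)) (p : Fin k × Fin k) :
    Measurable (Function.uncurry (pairFactor F W p)) :=
  (measurable_edgeFactor hW F p).mul measurable_leInd

lemma edgeFactor_mem (hW : IsOrderon W) (F : SimpleGraph (Fin k)) (p : Fin k × Fin k)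
    (x y : USq) : (if F.Adj p.1 p.2 then W x y else 1 - W x y) ∈ Set.Icc (0 : ℝ) 1 := by
  have h := hW.2.1 x y
  split_ifs
  · exact h
  · exact ⟨by linarith [h.2], by linarith [h.1]⟩

lemma pairFactor_mem (hW : IsOrderon W) (F : SimpleGraph (Fin k)) (p : Fin k × Fin k)
    (x y : USq) : pairFactor F W p x y ∈ Set.Icc (0 : ℝ) 1 := by
  have h1 := edgeFactor_mem hW F p x y
  have h2 := leInd_mem x y
  exact ⟨mul_nonneg h1.1 h2.1, mul_le_one₀ h1.2 h2.1 h2.2⟩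

lemma abs_integral_pairFactor_sub_le (hW : IsOrderon W) (hU : IsOrderon U) {f : USq → USq}
    (hf : Measurable f) (q : ℕ) [NeZero q] (F : SimpleGraph (Fin k)) (p : Fin k × Fin k)
    {a b : USq → ℝ} (ha : Measurable a) (hb : Measurable b) (ha1 : ∀ x, |a x| ≤ 1)
    (hb1 : ∀ x, |b x| ≤ 1) :
    |∫ z : USq × USq, (pairFactor F W p z.1 z.2 - pairFactor F U p (f z.1) (f z.2)) *
        (a z.1 * b z.2)| ≤
      4 * q * cutNorm (fun x y => W x y - U (f x) (f y)) + 2 / q + 4 * shiftOf f := by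
  have hff : Measurable fun z : USq × USq => (f z.1, f z.2) :=
    (hf.comp measurable_fst).prodMk (hf.comp measurable_snd)
  have hUf : Measurable (Function.uncurry fun x y => U (f x) (f y)) :=
    hU.1.comp (f := fun z : USq × USq => (f z.1, f z.2)) hff
  set K : USq → USq → ℝ := fun x y => W x y - U (f x) (f y) with hKdef
  have hK : IsKer K := IsKer.sub_of_mem hW.1 hUf hW.2.1 fun _ _ => hU.2.1 _ _
  set σ : ℝ := if F.Adj p.1 p.2 then 1 else -1 with hσ
  have hσ1 : |σ| = 1 := by rw [hσ]; split_ifs <;> simp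
  have hsa : Measurable fun x => σ * a x := ha.const_mul σ
  have hsa1 : ∀ x, |σ * a x| ≤ 1 := fun x => by rw [abs_mul, hσ1, one_mul]; exact ha1 x
  set E : USq × USq → ℝ := fun z =>
    (if F.Adj p.1 p.2 then U (f z.1) (f z.2) else 1 - U (f z.1) (f z.2)) *
      (leInd z.1 z.2 - leInd (f z.1) (f z.2)) * (a z.1 * b z.2) with hE
  have hdm : Measurable fun z : USq × USq => leInd z.1 z.2 - leInd (f z.1) (f z.2) :=
    Measurable.sub measurable_leInd
      (measurable_leInd.comp (f := fun z : USq × USq => (f z.1, f z.2)) hff)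
  have habm : Measurable fun z : USq × USq => a z.1 * b z.2 :=
    (ha.comp measurable_fst).mul (hb.comp measurable_snd)
  have hEm : Measurable E := by
    refine Measurable.mul (Measurable.mul ?_ hdm) habm
    exact (measurable_edgeFactor hU F p).comp hff
  have habs : ∀ {u v w z : ℝ}, |u| ≤ 1 → |v| ≤ 1 → |w| ≤ 1 → |z| ≤ 1 →
      |u * v * (w * z)| ≤ 1 := by
    intro u v w z hu hv hw hz
    rw [abs_mul, abs_mul, abs_mul]
    exact mul_le_one₀ (mul_le_one₀ hu (abs_nonneg _) hv) (by positivity)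
      (mul_le_one₀ hw (abs_nonneg _) hz)
  have hd1 : ∀ x y x' y', |leInd x y - leInd x' y'| ≤ 1 := by
    intro x y x' y'
    have h1 := leInd_mem x y
    have h2 := leInd_mem x' y'
    exact abs_le.2 ⟨by linarith [h1.1, h2.2], by linarith [h1.2, h2.1]⟩
  have hEb : ∀ z, |E z| ≤ 1 := fun z =>
    habs (by
      have h := edgeFactor_mem hU F p (f z.1) (f z.2)
      exact abs_le.2 ⟨by linarith [h.1], h.2⟩) (hd1 _ _ _ _) (ha1 _) (hb1 _)
  have hs0 : 0 ≤ shiftOf f := Real.iSup_nonneg fun _ => abs_nonneg _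
  have hEn : |∫ z, E z| ≤ 2 * (2 * shiftOf f) := by
    refine abs_integral_near_le hEm hEb (by positivity) fun z hz => ?_
    have h1 := abs_le.1 (abs_fst_sub_le_shiftOf f z.1)
    have h2 := abs_le.1 (abs_fst_sub_le_shiftOf f z.2)
    by_contra hcon
    refine hz ?_
    have h3 : leInd z.1 z.2 = leInd (f z.1) (f z.2) := by
      unfold leInd
      rcases lt_abs.1 (not_le.1 hcon) with h | h
      · rw [if_pos (by linarith), if_pos (by linarith)]
      · rw [if_neg (by linarith), if_neg (by linarith)]
    simp only [hE, h3, sub_self, mul_zero, zero_mul]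
  have hpt : ∀ z : USq × USq,
      (pairFactor F W p z.1 z.2 - pairFactor F U p (f z.1) (f z.2)) * (a z.1 * b z.2) =
        K z.1 z.2 * leInd z.1 z.2 * (σ * a z.1 * b z.2) + E z := by
    intro z
    simp only [pairFactor, hE, hKdef, hσ]
    split_ifs <;> ring
  have hintg : Integrable fun z : USq × USq =>
      K z.1 z.2 * leInd z.1 z.2 * (σ * a z.1 * b z.2) := by
    refine integrable_of_bdd (C := 1) ?_ fun z => habs (hK.2 _ _) ?_ (hsa1 _) (hb1 _)
    · exact (Measurable.mul hK.1 measurable_leInd).mul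
        ((hsa.comp measurable_fst).mul (hb.comp measurable_snd))
    · rw [abs_of_nonneg (leInd_mem _ _).1]; exact (leInd_mem _ _).2
  simp only [hpt]
  rw [integral_add hintg (integrable_of_bdd hEm hEb)]
  have h1 := hK.abs_integral_leInd_le q hsa hb hsa1 hb1
  refine (abs_add_le _ _).trans ?_
  linarith

lemma abs_homDensity_sub_le (hW : IsOrderon W) (hU : IsOrderon U) {f : USq → USq} (hf : IsMPB f)
    (q : ℕ) [NeZero q] (F : SimpleGraph (Fin k)) :
    |homDensity F W - homDensity F U| ≤ k.factorial * (k ^ 2 *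
      (4 * q * cutNorm (fun x y => W x y - U (f x) (f y)) + 2 / q + 4 * shiftOf f)) := by
  have hfm := hf.1.measurable
  set s := Finset.univ.filter fun p : Fin k × Fin k => p.1 < p.2 with hs
  set c := 4 * q * cutNorm (fun x y => W x y - U (f x) (f y)) + 2 / q + 4 * shiftOf f with hc
  have hc0 : 0 ≤ c := by
    have h1 := cutNorm_nonneg fun x y => W x y - U (f x) (f y)
    have h2 : 0 ≤ shiftOf f := Real.iSup_nonneg fun _ => abs_nonneg _
    positivity
  have hpi : MeasurePreserving (fun (v : Fin k → USq) i => f (v i)) volume volume :=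
    volume_preserving_pi fun _ => hf.1
  have hm := measurable_pairProd s (measurable_pairFactor hU F)
  have hcomp : ∫ v, pairProd s (pairFactor F U) v =
      ∫ v, pairProd s (fun p x y => pairFactor F U p (f x) (f y)) v := by
    conv_lhs => rw [← hpi.map_eq]
    rw [integral_map hpi.measurable.aemeasurable hm.aestronglyMeasurable]
    rfl
  have h := abs_integral_pairProd_sub_le (s := s) (fun p hp => (Finset.mem_filter.1 hp).2)
    (g := pairFactor F W) (h := fun p x y => pairFactor F U p (f x) (f y))
    (measurable_pairFactor hW F)
    (fun p => (measurable_pairFactor hU F p).comp (f := fun z : USq × USq => (f z.1, f z.2))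
      ((hfm.comp measurable_fst).prodMk (hfm.comp measurable_snd)))
    (pairFactor_mem hW F) (fun p x y => pairFactor_mem hU F p _ _) (c := c)
    fun p a b ha hb ha1 hb1 =>
      abs_integral_pairFactor_sub_le hW hU hfm q F p ha hb ha1 hb1
  rw [homDensity_eq_pairProd, homDensity_eq_pairProd, hcomp, ← mul_sub, abs_mul,
    abs_of_nonneg (Nat.cast_nonneg _)]
  refine mul_le_mul_of_nonneg_left (h.trans (mul_le_mul_of_nonneg_right ?_ hc0))
    (Nat.cast_nonneg _)
  have : s.card ≤ k ^ 2 := by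
    refine (Finset.card_le_univ s).trans_eq ?_
    rw [Fintype.card_prod, Fintype.card_fin, sq]
  exact_mod_cast this

lemma densities_converge_of_cauchy {W : ℕ → USq → USq → ℝ} (hW : ∀ n, IsOrderon (W n))
    (h : ∀ ε : ℝ, 0 < ε → ∃ N : ℕ, ∀ m n : ℕ, N ≤ m → N ≤ n → csDist (W m) (W n) < ε)
    (F : SimpleGraph (Fin k)) :
    ∃ L : ℝ, Tendsto (fun n => homDensity F (W n)) atTop (nhds L) := by
  refine cauchySeq_tendsto_of_complete (Metric.cauchySeq_iff.2 fun ε hε => ?_)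
  set A : ℝ := k.factorial * k ^ 2 + 1 with hA
  have hA0 : 0 < A := by positivity
  obtain ⟨q, hq⟩ := exists_nat_gt (4 * A / ε)
  have hq0 : (0 : ℝ) < q := lt_trans (by positivity) hq
  have : NeZero q := ⟨by rintro rfl; simp at hq0⟩
  obtain ⟨N, hN⟩ := h (ε / (2 * A * (4 * q + 4))) (by positivity)
  refine ⟨N, fun m hm n hn => ?_⟩
  have hne : {x | ∃ f, IsMPB f ∧
      x = shiftOf f + cutNorm fun x y => W m x y - W n (f x) (f y)}.Nonempty :=
    ⟨_, id, ⟨MeasurePreserving.id _, id, MeasurePreserving.id _, fun _ => rfl, fun _ => rfl⟩, rfl⟩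
  obtain ⟨_, ⟨f, hf, rfl⟩, hlt⟩ := exists_lt_of_csInf_lt hne (hN m n hm hn)
  have h0 : 0 ≤ shiftOf f := Real.iSup_nonneg fun _ => abs_nonneg _
  have h1 := cutNorm_nonneg fun x y => W m x y - W n (f x) (f y)
  rw [Real.dist_eq]
  refine (abs_homDensity_sub_le (hW m) (hW n) hf q F).trans_lt ?_
  set γ := cutNorm fun x y => W m x y - W n (f x) (f y) with hγ
  have h2 : 4 * q * γ + 4 * shiftOf f ≤ (4 * q + 4) * (shiftOf f + γ) := by nlinarith
  have h3 : (4 * q + 4) * (shiftOf f + γ) < ε / (2 * A) := by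
    rw [lt_div_iff₀ (by positivity)] at hlt ⊢
    linarith
  have h4 : 2 / (q : ℝ) < ε / (2 * A) := by
    rw [div_lt_iff₀ hε] at hq
    rw [div_lt_div_iff₀ hq0 (by positivity)]
    linarith
  have h5 : 4 * q * γ + 2 / q + 4 * shiftOf f < ε / A := by
    have : ε / A = ε / (2 * A) + ε / (2 * A) := by field_simp; norm_num
    linarith
  rw [lt_div_iff₀ hA0] at h5
  have h6 : 0 ≤ 4 * q * γ + 2 / q + 4 * shiftOf f := by positivity
  nlinarith

end Orderon

/-- A sequence of orderons is Cauchy in the cut-shift distance if and only if all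
ordered subgraph densities converge. -/
theorem cauchy_iff_densities_converge (W : ℕ → (USq → USq → ℝ))
    (hW : ∀ n, IsOrderon (W n)) :
    (∀ ε : ℝ, 0 < ε → ∃ N : ℕ, ∀ m n : ℕ, N ≤ m → N ≤ n → csDist (W m) (W n) < ε) ↔
      (∀ (k : ℕ) (F : SimpleGraph (Fin k)), ∃ L : ℝ,
        Tendsto (fun n => homDensity F (W n)) atTop (nhds L)) := by
  exact ⟨fun h _ F => Orderon.densities_converge_of_cauchy hW h F,
    fun h _ hε => Orderon.cauchy_of_densities_converge hW h hε⟩
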